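/- Let u₀, B₀ ∈ L²(𝕋³) with ∇·B₀ ∈ L²(𝕋³) and ∇·u₀ = 0 in the weak sense. Then for any T > 0 and ν₁, ν₂ > 0 there exists a Leray–Hopf weak solution (u, B) on [0,T] of the viscous and resistive MHD equations ∂_t u − ν₁Δu + u·∇u − B·∇B + ∇p = 0, ∂_t B − ν₂ΔB + u·∇B − B·∇u = 0, ∇·u = 0, in the generalized sense allowing ∇·B ≠ 0; in particular u, B, ∇·B ∈ L^∞((0,T); L²(𝕋³)) ∩ L²((0,T); H¹(𝕋³)) and the initial data (u₀, B₀) is attained strongly in L²(𝕋³). -/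

import Mathlib

open MeasureTheory Filter Topology Complex
open scoped ENNReal Real NNReal

noncomputable section

namespace PaperHelicity

/-! Spatial points: we model the torus `𝕋³` by ℤ³-periodic functions on
Euclidean space `ℝ³`, with the cube `[0,1)³` as fundamental domain. -/

abbrev Vec : Type := EuclideanSpace ℝ (Fin 3)

/-- The integer lattice `ℤ³`. -/
abbrev Lat : Type := Fin 3 → ℤ

/-- Embedding of the lattice into space. -/
def latv (n : Lat) : Vec := (WithLp.equiv 2 (Fin 3 → ℝ)).symm fun i => (n i : ℝ)

/-- A fundamental domain for the torus. -/
def cube : Set Vec := {x : Vec | ∀ i, 0 ≤ x i ∧ x i < 1}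

/-- The measure on the torus: Lebesgue measure restricted to the fundamental domain. -/
def μT : Measure Vec := volume.restrict cube

/-- Lebesgue measure on the time interval `(0,T)`. -/
def tIoo (T : ℝ) : Measure ℝ := volume.restrict (Set.Ioo 0 T)

/-- ℤ³-periodicity. -/
def Per {E : Type*} (f : Vec → E) : Prop := ∀ (x : Vec) (n : Lat), f (x + latv n) = f x

/-- The Fourier character `e^{2πi n·x}`. -/
def chr (n : Lat) (x : Vec) : ℂ :=
  Complex.exp (2 * Real.pi * Complex.I * (∑ i, (n i : ℂ) * (x i : ℂ)))

/-- Fourier coefficient on the torus. -/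
def fc (f : Vec → ℂ) (n : Lat) : ℂ := ∫ x in cube, f x * (starRingEnd ℂ) (chr n x)

/-- Euclidean norm of a lattice point. -/
def latNorm (n : Lat) : ℝ := Real.sqrt (∑ i, ((n i : ℝ)) ^ 2)

def latSq (n : Lat) : ℝ := ∑ i, ((n i : ℝ)) ^ 2

/-- Squared Sobolev `H^s` norm of a (periodic distribution given by its) Fourier
coefficient sequence. -/
def sobSqC (s : ℝ) (c : Lat → ℂ) : ℝ≥0∞ :=
  ∑' n : Lat, ENNReal.ofReal ((1 + latNorm n ^ 2) ^ s * ‖c n‖ ^ 2)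

def HsNormC (s : ℝ) (c : Lat → ℂ) : ℝ≥0∞ := sobSqC s c ^ (1/2 : ℝ)

def HsNorm (s : ℝ) (f : Vec → ℂ) : ℝ≥0∞ := HsNormC s (fc f)

/-- `H^s` norm of an `ℝ³`-valued field. -/
def HsNormV (s : ℝ) (u : Vec → Vec) : ℝ≥0∞ := ∑ j : Fin 3, HsNorm s fun x => (u x j : ℂ)

/-- The `j`-th dyadic shell in frequency space. -/
def shell (j : ℕ) : Set Lat := {n | (2:ℝ) ^ j ≤ latNorm n ∧ latNorm n < (2:ℝ) ^ (j + 1)}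

/-- Littlewood-Paley block of a coefficient sequence (a finite trigonometric sum). -/
def lpBlockC (j : ℕ) (c : Lat → ℂ) (x : Vec) : ℂ :=
  ∑' n : Lat, (shell j).indicator (fun m => c m * chr m x) n

/-- Low-frequency Littlewood-Paley block. -/
def lpLowC (c : Lat → ℂ) (x : Vec) : ℂ :=
  ∑' n : Lat, ({m : Lat | latNorm m < 1}).indicator (fun m => c m * chr m x) n

/-- Besov `B^s_{p,q}` norm of a coefficient sequence, via Littlewood-Paley decomposition. -/
def besovC (s : ℝ) (p q : ℝ≥0∞) (c : Lat → ℂ) : ℝ≥0∞ :=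
  eLpNorm (lpLowC c) p μT +
    if q = ∞ then ⨆ j : ℕ, ENNReal.ofReal ((2:ℝ) ^ (s * (j:ℝ))) * eLpNorm (lpBlockC j c) p μT
    else (∑' j : ℕ, (ENNReal.ofReal ((2:ℝ) ^ (s * (j:ℝ))) * eLpNorm (lpBlockC j c) p μT)
      ^ q.toReal) ^ (1 / q.toReal)

def besov (s : ℝ) (p q : ℝ≥0∞) (f : Vec → ℂ) : ℝ≥0∞ := besovC s p q (fc f)

def besovV (s : ℝ) (p q : ℝ≥0∞) (u : Vec → Vec) : ℝ≥0∞ :=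
  ∑ j : Fin 3, besov s p q fun x => (u x j : ℂ)

/-- Reconstruction of a function from its Fourier coefficients. -/
def recon (c : Lat → ℂ) (x : Vec) : ℂ := ∑' n : Lat, c n * chr n x

/-- The `L^r((0,T))` norm (in time) of a nonnegative quantity. -/
def timeNorm (r : ℝ≥0∞) (T : ℝ) (F : ℝ → ℝ≥0∞) : ℝ≥0∞ :=
  if r = ∞ then essSup F (tIoo T)
  else (∫⁻ t, F t ^ r.toReal ∂tIoo T) ^ (1 / r.toReal)

/-- Spatial partial derivative in the `i`-th coordinate direction. -/
def pd {E : Type*} [NormedAddCommGroup E] [NormedSpace ℝ E] (i : Fin 3) (g : Vec → E)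
    (x : Vec) : E :=
  fderiv ℝ g x (EuclideanSpace.single i (1:ℝ))

/-- Time derivative of a time-dependent field. -/
def tderiv {E : Type*} [NormedAddCommGroup E] [NormedSpace ℝ E] (f : ℝ → Vec → E)
    (t : ℝ) (x : Vec) : E :=
  deriv (fun s => f s x) t

/-- Laplacian. -/
def lap (g : Vec → ℝ) (x : Vec) : ℝ := ∑ i, pd i (fun y => pd i g y) x

/-- Test functions on `𝕋³ × (0,T)`: smooth, ℤ³-periodic in space, compactly supported
in time inside `(0,T)`. -/
structure TestFun (T : ℝ) (E : Type*) [NormedAddCommGroup E] [NormedSpace ℝ E] where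
  f : ℝ → Vec → E
  smooth : ContDiff ℝ (⊤ : ℕ∞) (Function.uncurry f)
  periodic : ∀ t, Per (f t)
  compactIn : ∃ a b : ℝ, 0 < a ∧ b < T ∧ ∀ t, t ∉ Set.Icc a b → f t = 0

/-- Purely spatial test functions on `𝕋³`. -/
structure SpTest (E : Type*) [NormedAddCommGroup E] [NormedSpace ℝ E] where
  f : Vec → E
  smooth : ContDiff ℝ (⊤ : ℕ∞) f
  periodic : Per f

/-- A divergence-free (vector-valued) test function. -/
def DivFreeT {T : ℝ} (ζ : TestFun T Vec) : Prop :=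
  ∀ t x, ∑ i, pd i (fun y => ζ.f t y i) x = 0

/-- A time-dependent field is weakly divergence free. -/
def WeakDivFree (T : ℝ) (u : ℝ → Vec → Vec) : Prop :=
  ∀ φ : TestFun T ℝ,
    (∫ t in Set.Ioo 0 T, ∫ x in cube, ∑ i, u t x i * pd i (φ.f t) x) = 0

def eulerIntegrand (u : ℝ → Vec → Vec) (ζ ζt : ℝ → Vec → Vec) (t : ℝ) : ℝ :=
  ∫ x in cube,
    ((∑ j, u t x j * ζt t x j) + ∑ i, ∑ j, u t x i * u t x j * pd i (fun y => ζ t y j) x)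

/-- `u` is a weak solution of the incompressible Euler equations (standard sense). -/
def EulerWeak (T : ℝ) (u : ℝ → Vec → Vec) : Prop :=
  ∀ ζ : TestFun T Vec, DivFreeT ζ →
    (∫ t in Set.Ioo 0 T, eulerIntegrand u ζ.f (tderiv ζ.f) t) = 0

/-- Fourier coefficients of the vorticity `ω = ∇ × u` (a distribution). -/
def curlC (u : Vec → Vec) (n : Lat) (j : Fin 3) : ℂ :=
  2 * Real.pi * Complex.I *
    ((n (j + 1) : ℂ) * fc (fun x => (u x (j + 2) : ℂ)) n -
     (n (j + 2) : ℂ) * fc (fun x => (u x (j + 1) : ℂ)) n)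

def ωC (u : Vec → Vec) (j : Fin 3) : Lat → ℂ := fun n => curlC u n j

def uC (u : Vec → Vec) (i : Fin 3) : Vec → ℂ := fun x => (u x i : ℂ)

/-- Duality pairing of a periodic distribution (given by its Fourier coefficients)
with a function. -/
def dpair (c : Lat → ℂ) (g : Vec → ℂ) : ℂ := ∑' n : Lat, c n * fc g (-n)

/-- The integrand (in time) of the weak vorticity formulation, with the nonlinearity
interpreted by duality/paraproducts: `⟨ω, ∂ₜψ⟩ + ⟨u⊗ω - ω⊗u, ∇ψ⟩`. -/
def vortIntegrand (u : Vec → Vec) (ψ ψt : Vec → Vec) : ℂ :=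
  (∑ j, dpair (ωC u j) fun x => (ψt x j : ℂ)) +
    ∑ i, ∑ j,
      (dpair (ωC u j) (fun x => ((u x i * pd i (fun y => ψ y j) x : ℝ) : ℂ)) -
       dpair (ωC u i) (fun x => ((u x j * pd i (fun y => ψ y j) x : ℝ) : ℂ)))

/-- The weak (paraproduct) formulation of the vorticity equation. -/
def VortWeak (T : ℝ) (u : ℝ → Vec → Vec) : Prop :=
  ∀ ψ : TestFun T Vec,
    (∫ t in Set.Ioo 0 T, vortIntegrand (u t) (ψ.f t) (tderiv ψ.f t)) = 0

/-- `(u, ω)` (with `ω = ∇ × u` determined by `u`) is a functional vorticity solution of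
the Euler equations. -/
def IsFVS (T : ℝ) (u : ℝ → Vec → Vec) : Prop :=
  Measurable (Function.uncurry u) ∧ (∀ t, Per (u t)) ∧
    (∃ ε > 0, timeNorm ∞ T (fun t => HsNormV (1/2 + ε) (u t)) < ∞) ∧
    WeakDivFree T u ∧ VortWeak T u

/-- A standard radial smooth compactly supported mollifier of total mass one. -/
structure Mollifier where
  φ : Vec → ℝ
  smooth : ContDiff ℝ (⊤ : ℕ∞) φ
  cpt : HasCompactSupport φ
  nonneg : ∀ x, 0 ≤ φ x
  radial : ∀ x y : Vec, ‖x‖ = ‖y‖ → φ x = φ y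
  mass : (∫ x : Vec, φ x) = 1

/-- The rescaled mollifier `φ_ε`. -/
def mscale (m : Mollifier) (ε : ℝ) (x : Vec) : ℝ := (ε ^ 3)⁻¹ * m.φ (ε⁻¹ • x)

/-- Increment `δu(ξ;x) = u(x+ξ) - u(x)`. -/
def du (u : Vec → Vec) (ξ x : Vec) : Vec := u (x + ξ) - u x

/-- The pairing `⟨δu (δω · δu), φ⟩` (`k`-th component), with `δω` interpreted by duality. -/
def defPair1 (u : Vec → Vec) (φ : Vec → ℝ) (ξ : Vec) (k : Fin 3) : ℂ :=
  ∑ j, dpair (ωC u j) fun x =>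
    ((du u (-ξ) x k * du u (-ξ) x j * φ (x - ξ) - du u ξ x k * du u ξ x j * φ x : ℝ) : ℂ)

/-- The pairing `⟨δω |δu|², φ⟩` (`k`-th component), with `δω` interpreted by duality. -/
def defPair2 (u : Vec → Vec) (φ : Vec → ℝ) (ξ : Vec) (k : Fin 3) : ℂ :=
  dpair (ωC u k) fun x =>
    (((∑ j, du u (-ξ) x j ^ 2) * φ (x - ξ) - (∑ j, du u ξ x j ^ 2) * φ x : ℝ) : ℂ)

/-- `⟨D_{1,ε}(u,ω), φ⟩ = ∫ ∇φ_ε(ξ) · ⟨δu (δω·δu), φ⟩ dξ`. -/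
def D1pair (m : Mollifier) (ε : ℝ) (u : Vec → Vec) (φ : Vec → ℝ) : ℂ :=
  ∫ ξ : Vec, ∑ k, ((pd k (mscale m ε) ξ : ℝ) : ℂ) * defPair1 u φ ξ k

/-- `⟨D_{2,ε}(u,ω), φ⟩ = ∫ ∇φ_ε(ξ) · ⟨δω |δu|², φ⟩ dξ`. -/
def D2pair (m : Mollifier) (ε : ℝ) (u : Vec → Vec) (φ : Vec → ℝ) : ℂ :=
  ∫ ξ : Vec, ∑ k, ((pd k (mscale m ε) ξ : ℝ) : ℂ) * defPair2 u φ ξ k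

/-- The local terms of the helicity balance, paired with a test function:
`-⟨2ωu, ∂ₜφ⟩ + ⟨2∇·(pω) + ∇·(2(u·ω)u - |u|²ω), φ⟩`. -/
def helLocal (u : Vec → Vec) (p : Vec → ℝ) (φt φ : Vec → ℝ) : ℂ :=
  -2 * (∑ j, dpair (ωC u j) fun x => ((u x j * φt x : ℝ) : ℂ))
    - 2 * (∑ j, dpair (ωC u j) fun x => ((p x * pd j φ x : ℝ) : ℂ))
    - 2 * (∑ i, ∑ j, dpair (ωC u i) fun x => ((u x i * u x j * pd j φ x : ℝ) : ℂ))
    + ∑ j, dpair (ωC u j) fun x => (((∑ i, u x i ^ 2) * pd j φ x : ℝ) : ℂ)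

/-- `p` is the pressure associated with `u`: `-Δp = (∇⊗∇):(u⊗u)`, `∫ p = 0` (in Fourier form). -/
def PressureOf (u : Vec → Vec) (p : Vec → ℝ) : Prop :=
  fc (fun x => (p x : ℂ)) 0 = 0 ∧
    ∀ n : Lat,
      ((4 * Real.pi ^ 2 * latSq n : ℝ) : ℂ) * fc (fun x => (p x : ℂ)) n =
        ∑ i, ∑ j, (2 * Real.pi * Complex.I * (n i : ℂ)) * (2 * Real.pi * Complex.I * (n j : ℂ)) *
          fc (fun x => ((u x i * u x j : ℝ) : ℂ)) n

/-- The helicity `⟨ω, u⟩` at a fixed time (an `H^{-1/2} × H^{1/2}` duality pairing). -/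
def hel (u : Vec → Vec) : ℂ := ∑ j, dpair (ωC u j) (uC u j)

end PaperHelicity

namespace PaperHelicity

/-! ### Mollification in Fourier form, explicit mollified defect terms -/

/-- The Fourier transform of the rescaled mollifier at the lattice frequency `n`. -/
def molHat (m : Mollifier) (ε : ℝ) (n : Lat) : ℂ :=
  ∫ ξ : Vec, (mscale m ε ξ : ℂ) * (starRingEnd ℂ) (chr n ξ)

/-- Mollified reconstruction of a periodic distribution: `(T * φ_ε)(x)`. -/
def reconMol (m : Mollifier) (ε : ℝ) (c : Lat → ℂ) (x : Vec) : ℂ :=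
  ∑' n : Lat, c n * molHat m ε n * chr n x

/-- Fourier coefficients of the (para)product of a distribution and a function. -/
def pprodC (c : Lat → ℂ) (g : Vec → ℂ) (n : Lat) : ℂ := ∑' k : Lat, c k * fc g (n - k)

/-- Mollification of a function: `(g * φ_ε)(x)`. -/
def conv (m : Mollifier) (ε : ℝ) (g : Vec → ℝ) (x : Vec) : ℝ :=
  ∫ y : Vec, mscale m ε y * g (x - y)

/-- `⟨D_{1,ε}(u,ω), φ⟩` where `D_{1,ε} = -∇·((ω·u)u)^ε + u·∇(ω·u)^ε + u·(∇·(u⊗ω)^ε)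
+ ω·(∇·(u⊗u)^ε) - u⊗ω:∇u^ε - u⊗u:∇ω^ε` (products interpreted as paraproducts). -/
def D1explicit (m : Mollifier) (ε : ℝ) (u : Vec → Vec) (φ : Vec → ℝ) : ℂ :=
  (∑ i, ∑ j, dpair (ωC u i) fun x => uC u i x * uC u j x * ((pd j (conv m ε φ) x : ℝ) : ℂ))
  + (∫ x in cube,
      (∑ i, uC u i x * pd i (reconMol m ε fun n => ∑ j, pprodC (ωC u j) (uC u j) n) x)
        * ((φ x : ℝ) : ℂ))
  + (∫ x in cube,
      (∑ i, ∑ j, uC u j x * pd i (reconMol m ε (pprodC (ωC u j) (uC u i))) x) * ((φ x : ℝ) : ℂ))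
  + (∑ j, dpair (ωC u j) fun x =>
      (∑ i, pd i (reconMol m ε (fc fun y => uC u i y * uC u j y)) x) * ((φ x : ℝ) : ℂ))
  - (∑ i, ∑ j, dpair (ωC u j) fun x =>
      uC u i x * pd i (reconMol m ε (fc (uC u j))) x * ((φ x : ℝ) : ℂ))
  - (∫ x in cube,
      (∑ i, ∑ j, uC u i x * uC u j x * pd i (reconMol m ε (ωC u j)) x) * ((φ x : ℝ) : ℂ))

/-- `⟨D_{2,ε}(u,ω), φ⟩` where `D_{2,ε} = -∇·(|u|²ω)^ε + ω·∇(|u|²)^ε + 2u·(∇·(ω⊗u)^ε)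
- 2ω⊗u:∇u^ε` (products interpreted as paraproducts). -/
def D2explicit (m : Mollifier) (ε : ℝ) (u : Vec → Vec) (φ : Vec → ℝ) : ℂ :=
  (∑ j, dpair (ωC u j) fun x =>
      (((∑ i, u x i ^ 2) : ℝ) : ℂ) * ((pd j (conv m ε φ) x : ℝ) : ℂ))
  + (∑ j, dpair (ωC u j) fun x =>
      pd j (reconMol m ε (fc fun y => (((∑ i, u y i ^ 2) : ℝ) : ℂ))) x * ((φ x : ℝ) : ℂ))
  + 2 * (∫ x in cube,
      (∑ i, ∑ j, uC u j x * pd i (reconMol m ε (pprodC (ωC u i) (uC u j))) x) * ((φ x : ℝ) : ℂ))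
  - 2 * (∑ i, ∑ j, dpair (ωC u i) fun x =>
      uC u j x * pd i (reconMol m ε (fc (uC u j))) x * ((φ x : ℝ) : ℂ))

/-! ### Navier-Stokes -/

/-- A strong solution of the incompressible Navier-Stokes equations with viscosity `ν`
on `[0,T]`. -/
def IsStrongNS (ν T : ℝ) (u : ℝ → Vec → Vec) : Prop :=
  (∀ t, Per (u t)) ∧ (∀ t ∈ Set.Icc 0 T, ContDiff ℝ (⊤ : ℕ∞) (u t)) ∧
    (∀ t ∈ Set.Icc 0 T, ∀ x : Vec, ∑ i, pd i (fun y => u t y i) x = 0) ∧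
    ∃ p : ℝ → Vec → ℝ, (∀ t, Per (p t)) ∧ (∀ t ∈ Set.Icc 0 T, ContDiff ℝ (⊤ : ℕ∞) (p t)) ∧
      ∀ t ∈ Set.Ioo 0 T, ∀ x : Vec, ∀ j,
        HasDerivAt (fun s => u s x j)
          (ν * (∑ i, pd i (fun y => pd i (fun z => u t z j) y) x)
            - (∑ i, u t x i * pd i (fun y => u t y j) x) - pd j (p t) x) t

/-- Convergence in `L³(𝕋³ × (0,T))`. -/
def L3conv (T : ℝ) (w : ℕ → ℝ → Vec → Vec) (v : ℝ → Vec → Vec) : Prop :=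
  Tendsto (fun k => ∫⁻ t, (∫⁻ x, (‖w k t x - v t x‖₊ : ℝ≥0∞) ^ (3:ℝ) ∂μT) ∂tIoo T)
    atTop (𝓝 0)

/-! ### Spherical averages (third-order structure functions) -/

def mkVec (a b c : ℝ) : Vec := (WithLp.equiv 2 (Fin 3 → ℝ)).symm ![a, b, c]

/-- Parametrization of the unit sphere `𝕊²`. -/
def sphMap (θ ϕ : ℝ) : Vec :=
  mkVec (Real.sin θ * Real.cos ϕ) (Real.sin θ * Real.sin ϕ) (Real.cos θ)

/-- The pairing `⟨(δu(ζ)·dir)(δω(ζ)·δu(ζ)), φ⟩`, with `δω` interpreted by duality. -/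
def spIncr1 (u : Vec → Vec) (φ : Vec → ℝ) (ζ dir : Vec) : ℂ :=
  ∑ j, dpair (ωC u j) fun x =>
    (((∑ k, du u ζ (x - ζ) k * dir k) * du u ζ (x - ζ) j * φ (x - ζ)
        - (∑ k, du u ζ x k * dir k) * du u ζ x j * φ x : ℝ) : ℂ)

/-- The pairing `⟨(δω(ζ)·dir)|δu(ζ)|², φ⟩`, with `δω` interpreted by duality. -/
def spIncr2 (u : Vec → Vec) (φ : Vec → ℝ) (ζ dir : Vec) : ℂ :=
  ∑ j, ((dir j : ℝ) : ℂ) * dpair (ωC u j) fun x =>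
    (((∑ k, du u ζ (x - ζ) k ^ 2) * φ (x - ζ) - (∑ k, du u ζ x k ^ 2) * φ x : ℝ) : ℂ)

/-- `⟨S₁(u,ω,r), φ⟩`: the spherical average of the first third-order structure function,
paired with a test function (surface measure on `𝕊²`, total mass `4π`). -/
def S1pair (u : Vec → Vec) (φ : Vec → ℝ) (r : ℝ) : ℂ :=
  ∫ θ in (0:ℝ)..Real.pi, ∫ ϕ in (0:ℝ)..(2 * Real.pi),
    ((Real.sin θ : ℝ) : ℂ) * spIncr1 u φ (r • sphMap θ ϕ) (sphMap θ ϕ)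

/-- `⟨S₂(u,ω,r), φ⟩`. -/
def S2pair (u : Vec → Vec) (φ : Vec → ℝ) (r : ℝ) : ℂ :=
  ∫ θ in (0:ℝ)..Real.pi, ∫ ϕ in (0:ℝ)..(2 * Real.pi),
    ((Real.sin θ : ℝ) : ℂ) * spIncr2 u φ (r • sphMap θ ϕ) (sphMap θ ϕ)

/-! ### MHD -/

def dotV (a b : Vec) : ℝ := ∑ j, a j * b j

/-- `(a ⊗ b) : ∇ψ` at the point `x`. -/
def advPair (a b : Vec → Vec) (ψ : Vec → Vec) (x : Vec) : ℝ :=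
  ∑ i, ∑ j, a x i * b x j * pd i (fun y => ψ y j) x

/-- Weak solution of the ideal MHD equations (with divergence-free magnetic field as
part of the definition). -/
def MHDWeakDF (T : ℝ) (u B : ℝ → Vec → Vec) : Prop :=
  (∀ ψ : TestFun T Vec, DivFreeT ψ →
    (∫ t in Set.Ioo 0 T, ∫ x in cube,
      (dotV (u t x) (tderiv ψ.f t x) + advPair (u t) (u t) (ψ.f t) x
        - advPair (B t) (B t) (ψ.f t) x)) = 0) ∧
  (∀ ψ : TestFun T Vec, DivFreeT ψ →
    (∫ t in Set.Ioo 0 T, ∫ x in cube,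
      (dotV (B t x) (tderiv ψ.f t x) + advPair (u t) (B t) (ψ.f t) x
        - advPair (B t) (u t) (ψ.f t) x)) = 0) ∧
  WeakDivFree T u ∧ WeakDivFree T B

/-- `dB` is the weak divergence of `B`. -/
def WeakDiv (T : ℝ) (B : ℝ → Vec → Vec) (dB : ℝ → Vec → ℝ) : Prop :=
  ∀ φ : TestFun T ℝ,
    (∫ t in Set.Ioo 0 T, ∫ x in cube,
      (dB t x * φ.f t x + ∑ j, B t x j * pd j (φ.f t) x)) = 0

/-- Weak solution of the ideal MHD equations in the generalized sense allowing
`∇·B ≠ 0` (Definition 8.1 of the paper). -/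
def IdealMHDWeak (T : ℝ) (u B : ℝ → Vec → Vec) (dB : ℝ → Vec → ℝ) : Prop :=
  Measurable (Function.uncurry u) ∧ Measurable (Function.uncurry B) ∧
  Measurable (Function.uncurry dB) ∧
  (∀ t, Per (u t)) ∧ (∀ t, Per (B t)) ∧ (∀ t, Per (dB t)) ∧
  timeNorm ∞ T (fun t => eLpNorm (u t) 2 μT) < ∞ ∧
  timeNorm ∞ T (fun t => eLpNorm (B t) 2 μT) < ∞ ∧
  timeNorm ∞ T (fun t => eLpNorm (dB t) 2 μT) < ∞ ∧
  WeakDiv T B dB ∧ WeakDivFree T u ∧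
  (∀ ψ : TestFun T Vec, DivFreeT ψ →
    (∫ t in Set.Ioo 0 T, ∫ x in cube,
      (dotV (u t x) (tderiv ψ.f t x) + advPair (u t) (u t) (ψ.f t) x
        - advPair (B t) (B t) (ψ.f t) x - dB t x * dotV (B t x) (ψ.f t x))) = 0) ∧
  (∀ ψ : TestFun T Vec, DivFreeT ψ →
    (∫ t in Set.Ioo 0 T, ∫ x in cube,
      (dotV (B t x) (tderiv ψ.f t x) + advPair (u t) (B t) (ψ.f t) x
        - advPair (B t) (u t) (ψ.f t) x - dB t x * dotV (u t x) (ψ.f t x))) = 0)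

/-- Leray-Hopf weak solution of the viscous and resistive MHD equations in the
generalized sense allowing `∇·B ≠ 0` (Definition 8.4 of the paper). The viscous
terms `-νᵢ ∇v : ∇ψ` are written in the equivalent form `νᵢ v · Δψ`. -/
def LerayHopfMHD (ν₁ ν₂ T : ℝ) (u₀ B₀ : Vec → Vec) (u B : ℝ → Vec → Vec)
    (dB : ℝ → Vec → ℝ) : Prop :=
  Measurable (Function.uncurry u) ∧ Measurable (Function.uncurry B) ∧
  Measurable (Function.uncurry dB) ∧
  (∀ t, Per (u t)) ∧ (∀ t, Per (B t)) ∧ (∀ t, Per (dB t)) ∧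
  timeNorm ∞ T (fun t => eLpNorm (u t) 2 μT) < ∞ ∧
  timeNorm ∞ T (fun t => eLpNorm (B t) 2 μT) < ∞ ∧
  timeNorm ∞ T (fun t => eLpNorm (dB t) 2 μT) < ∞ ∧
  timeNorm 2 T (fun t => HsNormV 1 (u t)) < ∞ ∧
  timeNorm 2 T (fun t => HsNormV 1 (B t)) < ∞ ∧
  timeNorm 2 T (fun t => HsNorm 1 fun x => (dB t x : ℂ)) < ∞ ∧
  WeakDiv T B dB ∧ WeakDivFree T u ∧
  (∀ ψ : TestFun T Vec, DivFreeT ψ →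
    (∫ t in Set.Ioo 0 T, ∫ x in cube,
      (dotV (u t x) (tderiv ψ.f t x) + ν₁ * (∑ j, u t x j * lap (fun y => ψ.f t y j) x)
        + advPair (u t) (u t) (ψ.f t) x - advPair (B t) (B t) (ψ.f t) x
        - dB t x * dotV (B t x) (ψ.f t x))) = 0) ∧
  (∀ ψ : TestFun T Vec, DivFreeT ψ →
    (∫ t in Set.Ioo 0 T, ∫ x in cube,
      (dotV (B t x) (tderiv ψ.f t x) + ν₂ * (∑ j, B t x j * lap (fun y => ψ.f t y j) x)
        + advPair (u t) (B t) (ψ.f t) x - advPair (B t) (u t) (ψ.f t) x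
        - dB t x * dotV (u t x) (ψ.f t x))) = 0) ∧
  Tendsto (fun t => eLpNorm (fun x => u t x - u₀ x) 2 μT) (𝓝[>] 0) (𝓝 0) ∧
  Tendsto (fun t => eLpNorm (fun x => B t x - B₀ x) 2 μT) (𝓝[>] 0) (𝓝 0)

/-! ### Magnetic helicity -/

/-- Fourier coefficients of the divergence-free vector potential `A = ∇×(-Δ)⁻¹B`,
computed from the Fourier coefficients of `B`. -/
def vecPotC (c : Fin 3 → Lat → ℂ) (n : Lat) (j : Fin 3) : ℂ :=
  if n = 0 then 0 else
    Complex.I * ((n (j + 1) : ℂ) * c (j + 2) n - (n (j + 2) : ℂ) * c (j + 1) n) /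
      (2 * Real.pi * (latSq n : ℂ))

def fcV (B : Vec → Vec) (j : Fin 3) : Lat → ℂ := fc fun x => (B x j : ℂ)

/-- The magnetic helicity `∫ A·B dx` of a square-integrable magnetic field,
in Parseval form. -/
def magHel (B : Vec → Vec) : ℂ :=
  ∑' n : Lat, ∑ j, vecPotC (fcV B) n j * (starRingEnd ℂ) (fcV B j n)

/-- The magnetic helicity `⟨B, A⟩` of a magnetic field given as a distribution via its
Fourier coefficients (duality pairing). -/
def magHelC (c : Fin 3 → Lat → ℂ) : ℂ :=
  ∑' n : Lat, ∑ j, c j n * vecPotC c (-n) j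

/-! ### Kinematic dynamo -/

/-- `k`-th component of the curl of a (test) vector field. -/
def curlF (ψ : Vec → Vec) (k : Fin 3) (x : Vec) : ℝ :=
  pd (k + 1) (fun y => ψ y (k + 2)) x - pd (k + 2) (fun y => ψ y (k + 1)) x

/-- Functional weak solution of the kinematic dynamo equation: the magnetic field is
given by its Fourier coefficients `c`, the velocity `u` is given, and
`∫⟨B,∂ₜψ⟩ - ∫⟨B×u, ∇×ψ⟩ = 0` with `B×u` interpreted as a paraproduct; moreover `B` is
weakly divergence-free. -/
def DynamoWeak (T : ℝ) (u : ℝ → Vec → Vec) (c : ℝ → Fin 3 → Lat → ℂ) : Prop :=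
  (∀ ψ : TestFun T Vec,
    (∫ t in Set.Ioo 0 T,
      ((∑ j, dpair (c t j) fun x => (tderiv ψ.f t x j : ℂ)) -
        ∑ j, dpair (c t j) fun x =>
          ((u t x (j + 1) * curlF (ψ.f t) (j + 2) x
            - u t x (j + 2) * curlF (ψ.f t) (j + 1) x : ℝ) : ℂ))) = 0) ∧
  (∀ φ : TestFun T ℝ,
    (∫ t in Set.Ioo 0 T, ∑ j, dpair (c t j) fun x => ((pd j (φ.f t) x : ℝ) : ℂ)) = 0)

end PaperHelicity

namespace PaperHelicity


noncomputable section MainProof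

open MeasureTheory Filter Topology Complex
open scoped ENNReal Real NNReal

/-! ### Transfer between the cube and the standard torus -/

/-- The quotient map from space to the unit torus. -/
def tauT (x : Vec) : UnitAddTorus (Fin 3) := fun i => (x i : UnitAddCircle)

/-- Measurable section of the quotient map with values in the cube. -/
def secT (y : UnitAddTorus (Fin 3)) : Vec :=
  WithLp.toLp 2 fun i => ((AddCircle.measurableEquivIco (1:ℝ) 0 (y i)) : ℝ)

/-- Haar measure on the torus. -/
def volT : Measure (UnitAddTorus (Fin 3)) := Measure.pi (fun _ => AddCircle.haarAddCircle)

lemma measurable_tauT : Measurable tauT := by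
  refine measurable_pi_lambda _ (fun i => ?_)
  exact AddCircle.measurable_mk'.comp (by fun_prop)

lemma measurable_secT : Measurable secT := by
  refine (WithLp.measurable_toLp 2 (Fin 3 → ℝ)).comp ?_
  refine measurable_pi_lambda _ (fun i => ?_)
  exact measurable_subtype_coe.comp
    ((AddCircle.measurableEquivIco (1:ℝ) 0).measurable.comp (measurable_pi_apply i))

lemma tau_sec (y : UnitAddTorus (Fin 3)) : tauT (secT y) = y := by
  funext i
  show (((AddCircle.equivIco (1:ℝ) 0 (y i) : ℝ)) : AddCircle (1:ℝ)) = y i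
  exact AddCircle.coe_equivIco

lemma sec_tau {x : Vec} (hx : x ∈ cube) : secT (tauT x) = x := by
  ext i
  show ((AddCircle.equivIco (1:ℝ) 0 ((x i : AddCircle (1:ℝ))) : ℝ)) = x i
  exact AddCircle.equivIco_coe_of_mem (by simpa using hx i)

lemma measurableSet_cube : MeasurableSet cube := by
  unfold cube
  have : {x : Vec | ∀ i, 0 ≤ x i ∧ x i < 1} = ⋂ i, {x : Vec | 0 ≤ x i ∧ x i < 1} := by
    ext x; simp
  rw [this]
  refine MeasurableSet.iInter (fun i => ?_)
  have hm : Measurable fun x : Vec => x i := by fun_prop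
  exact (measurableSet_le measurable_const hm).inter (measurableSet_lt hm measurable_const)

lemma mp_tauT : MeasurePreserving tauT μT volT := by
  have h1 : MeasurePreserving (fun (x : Fin 3 → ℝ) (i : Fin 3) => ((x i : ℝ) : UnitAddCircle))
      (Measure.pi (fun _ => volume.restrict (Set.Ico (0:ℝ) 1))) volT := by
    have := measurePreserving_pi (fun _ : Fin 3 => volume.restrict (Set.Ioc (0:ℝ) (0+1)))
      (fun _ : Fin 3 => (volume : Measure (AddCircle (1:ℝ))))
      (fun i => AddCircle.measurePreserving_mk 1 (0:ℝ))
    convert this using 1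
    · simp [restrict_Ico_eq_restrict_Ioc]
    · unfold volT
      simp [volume, AddCircle.haarAddCircle]
  have h2 : MeasurePreserving (@WithLp.ofLp 2 (Fin 3 → ℝ)) μT
      (Measure.pi (fun _ => volume.restrict (Set.Ico (0:ℝ) 1))) := by
    rw [← Measure.restrict_pi_pi]
    have h3 : cube = (@WithLp.ofLp 2 (Fin 3 → ℝ)) ⁻¹' (Set.univ.pi fun _ => Set.Ico (0:ℝ) 1) := by
      ext x; simp [cube]
    unfold μT
    rw [h3]
    exact (PiLp.volume_preserving_ofLp (Fin 3)).restrict_preimage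
      (MeasurableSet.univ_pi fun _ => measurableSet_Ico)
  exact h1.comp h2

instance : IsProbabilityMeasure volT := by unfold volT; infer_instance

instance : IsProbabilityMeasure μT := by
  constructor
  have := mp_tauT.measure_preimage (s := Set.univ) MeasurableSet.univ.nullMeasurableSet
  simpa using this

lemma mp_secT : MeasurePreserving secT volT μT := by
  refine ⟨measurable_secT, ?_⟩
  rw [← mp_tauT.map_eq, Measure.map_map measurable_secT measurable_tauT]
  have : (secT ∘ tauT) =ᵐ[μT] id := by
    filter_upwards [ae_restrict_mem measurableSet_cube] with x hx using sec_tau hx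
  rw [Measure.map_congr this, Measure.map_id]

lemma chr_eq_mFourier (n : Lat) (x : Vec) : chr n x = UnitAddTorus.mFourier n (tauT x) := by
  unfold chr UnitAddTorus.mFourier tauT
  simp only [ContinuousMap.coe_mk, Complex.exp_sum, Finset.mul_sum]
  refine Finset.prod_congr rfl (fun i _ => ?_)
  rw [fourier_coe_apply]
  congr 1; push_cast; ring

lemma chr_conj (n : Lat) (x : Vec) : (starRingEnd ℂ) (chr n x) = chr (-n) x := by
  rw [chr_eq_mFourier, chr_eq_mFourier, UnitAddTorus.mFourier_neg]

lemma chr_add (m n : Lat) (x : Vec) : chr (m + n) x = chr m x * chr n x := by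
  simp only [chr_eq_mFourier, UnitAddTorus.mFourier_add]

lemma chr_zero (x : Vec) : chr 0 x = 1 := by
  simp [chr]

lemma chr_norm (n : Lat) (x : Vec) : ‖chr n x‖ = 1 := by
  have h : chr n x * (starRingEnd ℂ) (chr n x) = 1 := by
    rw [chr_conj, ← chr_add]; simp [chr_zero]
  rw [Complex.mul_conj] at h
  have h2 : Complex.normSq (chr n x) = 1 := by exact_mod_cast h
  rw [Complex.normSq_eq_norm_sq] at h2
  nlinarith [norm_nonneg (chr n x)]

lemma chr_per (n : Lat) : Per (chr n) := by
  intro x m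
  have : tauT (x + latv m) = tauT x := by
    funext i
    simp only [tauT, latv]
    show (((x i + (m i : ℝ) : ℝ)) : UnitAddCircle) = _
    rw [AddCircle.coe_add]
    have : (((m i : ℝ)) : UnitAddCircle) = 0 := by
      have := (AddCircle.coe_eq_zero_iff (1:ℝ) (x := (m i:ℝ))).2 ⟨m i, by simp⟩
      exact this
    rw [this, add_zero]
  rw [chr_eq_mFourier, chr_eq_mFourier, this]

lemma chr_contDiff (n : Lat) : ContDiff ℝ (⊤ : ℕ∞) (chr n) := by
  unfold chr
  refine ContDiff.cexp ?_
  refine contDiff_const.mul (ContDiff.sum fun i _ => contDiff_const.mul ?_)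
  exact Complex.ofRealCLM.contDiff.comp (by fun_prop)

lemma chr_continuous (n : Lat) : Continuous (chr n) := (chr_contDiff n).continuous

lemma emb_secT : MeasurableEmbedding secT := by
  refine MeasurableEmbedding.of_measurable_inverse (g := tauT) measurable_secT ?_ measurable_tauT ?_
  · have : Set.range secT = cube := by
      ext x; constructor
      · rintro ⟨y, rfl⟩ i
        have := (AddCircle.measurableEquivIco (1:ℝ) 0 (y i)).2
        simpa [secT] using this
      · intro hx; exact ⟨tauT x, sec_tau hx⟩
    rw [this]; exact measurableSet_cube
  · intro y; exact tau_sec y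

lemma integral_secT {E : Type*} [NormedAddCommGroup E] [NormedSpace ℝ E] (f : Vec → E) :
    ∫ y, f (secT y) ∂volT = ∫ x in cube, f x :=
  mp_secT.integral_comp emb_secT f

/-- Transfer of Fourier coefficients. -/
lemma fc_eq_mFourierCoeff (f : Vec → ℂ) (n : Lat) :
    fc f n = ∫ y, UnitAddTorus.mFourier (-n) y * f (secT y) ∂volT := by
  unfold fc
  rw [← integral_secT]
  refine integral_congr_ae (Eventually.of_forall fun y => ?_)
  simp only [chr_conj]
  rw [chr_eq_mFourier, tau_sec, mul_comm]

/-- Parseval. -/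
lemma parseval_prod {f g : Vec → ℂ} (hf : MemLp f 2 μT) (hg : MemLp g 2 μT) :
    HasSum (fun n => (starRingEnd ℂ) (fc f n) * fc g n)
      (∫ x in cube, (starRingEnd ℂ) (f x) * g x) := by
  have hf' : MemLp (f ∘ secT) 2 volT := hf.comp_measurePreserving mp_secT
  have hg' : MemLp (g ∘ secT) 2 volT := hg.comp_measurePreserving mp_secT
  have key := UnitAddTorus.hasSum_prod_mFourierCoeff (d := Fin 3) (hf'.toLp _) (hg'.toLp _)
  have hc : ∀ {f : Vec → ℂ} (hf' : MemLp (f ∘ secT) 2 volT) (n : Lat),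
      UnitAddTorus.mFourierCoeff (hf'.toLp _) n = fc f n := by
    intro f hf' n
    rw [fc_eq_mFourierCoeff]
    unfold UnitAddTorus.mFourierCoeff
    refine integral_congr_ae ?_
    filter_upwards [hf'.coeFn_toLp] with y hy
    rw [hy]; rfl
  have key2 := key.congr_fun (g := fun n => (starRingEnd ℂ) (fc f n) * fc g n) (fun n =>
    (congrArg₂ (fun a b => (starRingEnd ℂ) a * b) (hc hf' n) (hc hg' n)).symm)
  convert key2 using 1
  rw [← integral_secT]
  refine integral_congr_ae ?_
  filter_upwards [hf'.coeFn_toLp, hg'.coeFn_toLp] with y hy hy2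
  exact (congrArg₂ (fun a b => (starRingEnd ℂ) a * b) hy hy2).symm

lemma parseval_sq {f : Vec → ℂ} (hf : MemLp f 2 μT) :
    HasSum (fun n => ‖fc f n‖ ^ 2) (∫ x in cube, ‖f x‖ ^ 2) := by
  have := Complex.hasSum_re (parseval_prod hf hf)
  have e : ∀ z : ℂ, (starRingEnd ℂ) z * z = ((‖z‖ ^ 2 : ℝ) : ℂ) := by
    intro z; rw [Complex.conj_mul']; push_cast; rfl
  simp only [e, Complex.ofReal_re] at this
  convert this using 1
  exact ((congrArg Complex.re (integral_complex_ofReal (f := fun x => ‖f x‖ ^ 2))).trans (Complex.ofReal_re _)).symm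

lemma eLpNorm_sq_eq {f : Vec → ℂ} (hf : MemLp f 2 μT) :
    eLpNorm f 2 μT ^ 2 = ∑' n, ENNReal.ofReal (‖fc f n‖ ^ 2) := by
  have h := parseval_sq hf
  rw [← ENNReal.ofReal_tsum_of_nonneg (fun n => by positivity) h.summable, h.tsum_eq]
  rw [eLpNorm_eq_lintegral_rpow_enorm_toReal (by norm_num) (by norm_num)]
  rw [ofReal_integral_eq_lintegral_ofReal]
  · simp only [ENNReal.toReal_ofNat, one_div]
    rw [← ENNReal.rpow_natCast, ← ENNReal.rpow_mul]
    norm_num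
    refine lintegral_congr fun x => ?_
    rw [← ofReal_norm]
  · exact hf.integrable_norm_pow (by norm_num)
  · exact Eventually.of_forall fun x => by positivity

/-! ### Fourier coefficients of smooth periodic functions -/

lemma tau_add (x v : Vec) : tauT (x + v) = tauT x + tauT v := by
  funext i
  show (((x i + v i : ℝ)) : UnitAddCircle) = _
  rw [AddCircle.coe_add]; rfl

lemma per_sec_tau {E : Type*} {G : Vec → E} (hG : Per G) (x : Vec) : G (secT (tauT x)) = G x := by
  have h1 : tauT (secT (tauT x)) = tauT x := tau_sec _
  have h2 : ∀ i, ∃ m : ℤ, x i + m = secT (tauT x) i := by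
    intro i
    have h3 : (((secT (tauT x) i - x i : ℝ)) : AddCircle (1:ℝ)) = 0 := by
      rw [AddCircle.coe_sub]
      have := congrFun h1 i
      simp only [tauT] at this
      exact sub_eq_zero.2 this
    obtain ⟨m, hm⟩ := (AddCircle.coe_eq_zero_iff (1:ℝ)).1 h3
    refine ⟨m, ?_⟩
    have : (m:ℝ) = secT (tauT x) i - x i := by simpa using hm
    rw [this]; ring
  choose m hm using h2
  have : secT (tauT x) = x + latv m := by
    ext i
    show _ = x i + (m i : ℝ)
    rw [hm]
  rw [this, hG]

instance : volT.IsAddRightInvariant := by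
  unfold volT
  infer_instance

lemma integral_translate {E : Type*} [NormedAddCommGroup E] [NormedSpace ℝ E]
    {G : Vec → E} (hG : Per G) (v : Vec) :
    ∫ x in cube, G (x + v) = ∫ x in cube, G x := by
  rw [← integral_secT, ← integral_secT]
  rw [← integral_add_right_eq_self (fun y => G (secT y)) (tauT v)]
  refine integral_congr_ae (Eventually.of_forall fun y => ?_)
  simp only
  rw [← per_sec_tau hG, tau_add, tau_sec]


lemma cube_bounded {x : Vec} (hx : x ∈ cube) : x ∈ Metric.closedBall (0 : Vec) 2 := by
  rw [mem_closedBall_zero_iff, EuclideanSpace.norm_eq]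
  rw [Real.sqrt_le_left (by norm_num)]
  rw [Fin.sum_univ_three]
  have h0 := hx 0; have h1 := hx 1; have h2 := hx 2
  simp only [Real.norm_eq_abs, sq_abs]
  nlinarith

lemma per_bounded {E : Type*} [NormedAddCommGroup E] {G : Vec → E} (hG : Per G)
    (hc : Continuous G) : ∃ C, ∀ x, ‖G x‖ ≤ C := by
  obtain ⟨C, hC⟩ := (isCompact_closedBall (0:Vec) 2).exists_bound_of_continuousOn hc.continuousOn
  refine ⟨C, fun x => ?_⟩
  rw [← per_sec_tau hG]
  refine hC _ (cube_bounded fun i => ?_)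
  have := (AddCircle.measurableEquivIco (1:ℝ) 0 ((tauT x) i)).2
  simpa [secT] using this

lemma pd_per {E : Type*} [NormedAddCommGroup E] [NormedSpace ℝ E] {G : Vec → E} (hG : Per G)
    (i : Fin 3) : Per (pd i G) := by
  intro x n
  unfold pd
  have : (fun y => G (y + latv n)) = G := by funext y; exact hG y n
  rw [← fderiv_comp_add_right, this]

lemma pd_contDiff {E : Type*} [NormedAddCommGroup E] [NormedSpace ℝ E] {G : Vec → E}
    (hG : ContDiff ℝ (⊤ : ℕ∞) G) (i : Fin 3) : ContDiff ℝ (⊤ : ℕ∞) (pd i G) := by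
  unfold pd
  exact (hG.fderiv_right (by simp)).clm_apply contDiff_const

lemma integral_pd_zero {G : Vec → ℂ} (hG : Per G)
    (hs : ContDiff ℝ (⊤ : ℕ∞) G) (i : Fin 3) : ∫ x in cube, pd i G x = 0 := by
  set e : Vec := EuclideanSpace.single i (1:ℝ) with he
  obtain ⟨C, hC⟩ := per_bounded (pd_per hG i) (pd_contDiff hs i).continuous
  have key := hasDerivAt_integral_of_dominated_loc_of_deriv_le (μ := μT) (𝕜 := ℝ)
    (F := fun s x => G (x + s • e)) (F' := fun s x => pd i G (x + s • e)) (x₀ := (0:ℝ))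
    (bound := fun _ => C) (s := Set.univ) Filter.univ_mem
    (Eventually.of_forall fun s => ((hs.continuous.comp (by fun_prop)).aestronglyMeasurable))
    ?_ (((pd_contDiff hs i).continuous.comp (by fun_prop)).aestronglyMeasurable)
    (Eventually.of_forall fun x s _ => hC _) (integrable_const _) ?_
  · have h2 := key.2
    have hconst : (fun s : ℝ => ∫ x, G (x + s • e) ∂μT) = fun _ => ∫ x in cube, G x := by
      funext s; exact integral_translate hG (s • e)
    rw [hconst] at h2
    have := h2.unique (hasDerivAt_const _ _)
    have h3 : ∫ a, pd i G a ∂μT = 0 := by simpa using this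
    exact h3
  · obtain ⟨D, hD⟩ := per_bounded hG hs.continuous
    refine Integrable.of_bound (C := D) ?_ (Eventually.of_forall fun x => hD _)
    exact (hs.continuous.comp (by fun_prop)).aestronglyMeasurable
  · refine Eventually.of_forall fun x s _ => ?_
    have h1 : HasFDerivAt G (fderiv ℝ G (x + s • e)) (x + s • e) :=
      (hs.differentiable (by simp)).differentiableAt.hasFDerivAt
    have h2 : HasDerivAt (fun s : ℝ => x + s • e) e s := by
      have := ((hasDerivAt_id s).smul_const e).const_add x
      simpa using this
    exact h1.comp_hasDerivAt s h2

lemma pd_chr (n : Lat) (i : Fin 3) (x : Vec) :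
    pd i (chr n) x = 2 * Real.pi * Complex.I * (n i : ℂ) * chr n x := by
  unfold pd
  have h2 : HasDerivAt (fun s : ℝ => x + s • (EuclideanSpace.single i (1:ℝ) : Vec))
      (EuclideanSpace.single i (1:ℝ)) 0 := by
    have := ((hasDerivAt_id (0:ℝ)).smul_const (EuclideanSpace.single i (1:ℝ) : Vec)).const_add x
    simpa using this
  have h1 : HasFDerivAt (chr n) (fderiv ℝ (chr n) x)
      (x + (0:ℝ) • (EuclideanSpace.single i (1:ℝ) : Vec)) := by
    simpa using ((chr_contDiff n).differentiable (by simp)).differentiableAt.hasFDerivAt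
  have h3 := h1.comp_hasDerivAt (0:ℝ) h2
  have h4 : HasDerivAt (chr n ∘ fun s : ℝ => x + s • (EuclideanSpace.single i (1:ℝ) : Vec))
      (chr n x * (2 * Real.pi * Complex.I * (n i : ℂ))) 0 := by
    have h5 : (chr n ∘ fun s : ℝ => x + s • (EuclideanSpace.single i (1:ℝ) : Vec)) =
        fun s : ℝ => chr n x * Complex.exp ((s:ℂ) * (2 * Real.pi * Complex.I * (n i : ℂ))) := by
      funext s
      simp only [Function.comp, chr, ← Complex.exp_add]
      congr 1
      have : ∀ j : Fin 3, (((x + s • (EuclideanSpace.single i (1:ℝ) : Vec)) j : ℝ) : ℂ)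
          = (x j : ℂ) + s * (if j = i then 1 else 0) := by
        intro j
        by_cases h : j = i <;> simp [h]
      simp only [this, mul_add, Finset.sum_add_distrib]
      simp
      ring
    rw [h5]
    have h6 : HasDerivAt (fun s : ℝ => Complex.exp ((s:ℂ) * (2 * Real.pi * Complex.I * (n i : ℂ))))
        (2 * Real.pi * Complex.I * (n i : ℂ)) 0 := by
      have := (((Complex.ofRealCLM.hasDerivAt (x := (0:ℝ))).mul_const
        (2 * Real.pi * Complex.I * (n i : ℂ))).cexp)
      simpa using this
    exact h6.const_mul _
  rw [h3.unique h4]; ring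

lemma integrable_of_cont_per {E : Type*} [NormedAddCommGroup E] {G : Vec → E} (hG : Per G)
    (hc : Continuous G) : Integrable G μT := by
  obtain ⟨D, hD⟩ := per_bounded hG hc
  exact Integrable.of_bound (C := D) hc.aestronglyMeasurable
    (Eventually.of_forall fun x => hD _)

/-! ### Fourier coefficients: derivatives, decay -/

lemma fc_bound {g : Vec → ℂ} {C : ℝ} (hC : ∀ x, ‖g x‖ ≤ C) (n : Lat) : ‖fc g n‖ ≤ C := by
  have h := norm_integral_le_of_norm_le_const (μ := μT) (f := fun x => g x * (starRingEnd ℂ) (chr n x))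
    (C := C) (Eventually.of_forall fun x => by simpa [chr_norm] using hC x)
  have h2 : ‖fc g n‖ ≤ C * μT.real Set.univ := h
  simpa using h2

lemma latSq_nonneg (n : Lat) : 0 ≤ latSq n := Finset.sum_nonneg fun i _ => sq_nonneg _

lemma latSq_neg (n : Lat) : latSq (-n) = latSq n := by simp [latSq]

lemma latNorm_sq (n : Lat) : latNorm n ^ 2 = latSq n := Real.sq_sqrt (latSq_nonneg n)

lemma integrable_mul_chr {f : Vec → ℂ} (hf : Integrable f μT) (n : Lat) :
    Integrable (fun x => f x * (starRingEnd ℂ) (chr n x)) μT := by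
  refine hf.mul_bdd (c := 1) ?_ (Eventually.of_forall fun x => by simp [chr_norm])
  exact (Complex.continuous_conj.comp (chr_continuous n)).aestronglyMeasurable

lemma fc_eq (f : Vec → ℂ) (n : Lat) : fc f n = ∫ x, f x * (starRingEnd ℂ) (chr n x) ∂μT := rfl

lemma fc_add {f g : Vec → ℂ} (hf : Integrable f μT) (hg : Integrable g μT) (n : Lat) :
    fc (fun x => f x + g x) n = fc f n + fc g n := by
  simp only [fc_eq]
  rw [← integral_add (integrable_mul_chr hf n) (integrable_mul_chr hg n)]
  simp only [add_mul]

lemma fc_sum {ι : Type*} (s : Finset ι) {f : ι → Vec → ℂ} (hf : ∀ i ∈ s, Integrable (f i) μT)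
    (n : Lat) :
    fc (fun x => ∑ i ∈ s, f i x) n = ∑ i ∈ s, fc (f i) n := by
  simp only [fc_eq]
  rw [← integral_finsetSum _ (fun i hi => integrable_mul_chr (hf i hi) n)]
  simp only [Finset.sum_mul]

lemma fc_const_mul (c : ℂ) (f : Vec → ℂ) (n : Lat) :
    fc (fun x => c * f x) n = c * fc f n := by
  simp only [fc_eq]
  rw [← integral_const_mul]
  simp only [mul_assoc]

lemma fc_sub {f g : Vec → ℂ} (hf : Integrable f μT) (hg : Integrable g μT) (n : Lat) :
    fc (fun x => f x - g x) n = fc f n - fc g n := by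
  simp only [fc_eq]
  rw [← integral_sub (integrable_mul_chr hf n) (integrable_mul_chr hg n)]
  simp only [sub_mul]

lemma fc_real_conj (f : Vec → ℝ) (n : Lat) :
    (starRingEnd ℂ) (fc (fun x => (f x : ℂ)) n) = fc (fun x => (f x : ℂ)) (-n) := by
  unfold fc
  rw [← integral_conj]
  simp only [map_mul, Complex.conj_ofReal, chr_conj, neg_neg]

lemma fc_pd {g : Vec → ℂ} (hg : Per g) (hs : ContDiff ℝ (⊤ : ℕ∞) g) (i : Fin 3) (n : Lat) :
    fc (pd i g) n = 2 * Real.pi * Complex.I * (n i : ℂ) * fc g n := by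
  have h1 := integral_pd_zero (G := fun x => g x * chr (-n) x)
    (fun x m => by simp only [hg x m, chr_per (-n) x m]) (hs.mul (chr_contDiff (-n))) i
  have h2 : ∀ x, pd i (fun x => g x * chr (-n) x) x
      = pd i g x * chr (-n) x - 2 * Real.pi * Complex.I * (n i : ℂ) * (g x * chr (-n) x) := by
    intro x
    have e1 : pd i (fun x => g x * chr (-n) x) x
        = g x * pd i (chr (-n)) x + chr (-n) x * pd i g x := by
      unfold pd
      rw [fderiv_fun_mul (hs.differentiable (by simp)).differentiableAt
        ((chr_contDiff (-n)).differentiable (by simp)).differentiableAt]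
      simp
    rw [e1, pd_chr]
    simp
    ring
  simp only [h2] at h1
  have i1 : Integrable (fun x => pd i g x * chr (-n) x) μT :=
    integrable_of_cont_per (fun x m => by simp only [pd_per hg i x m, chr_per (-n) x m])
      ((pd_contDiff hs i).continuous.mul (chr_continuous _))
  have i2 : Integrable (fun x => g x * chr (-n) x) μT :=
    integrable_of_cont_per (fun x m => by simp only [hg x m, chr_per (-n) x m])
      (hs.continuous.mul (chr_continuous _))
  have h3 := integral_sub i1 (i2.const_mul (2 * Real.pi * Complex.I * (n i : ℂ)))
  rw [integral_const_mul] at h3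
  have h4 := h3.symm.trans h1
  unfold fc
  simp only [chr_conj]
  exact sub_eq_zero.1 h4

/-- The operator `1 - Δ/(4π²)`. -/
def Lop (g : Vec → ℂ) (x : Vec) : ℂ :=
  g x + ∑ i, ((-(4 * Real.pi ^ 2)⁻¹ : ℝ) : ℂ) * pd i (pd i g) x

lemma Lop_per {g : Vec → ℂ} (hg : Per g) : Per (Lop g) := by
  intro x n
  simp only [Lop, hg x n, pd_per (pd_per hg _) _ x n]

lemma Lop_contDiff {g : Vec → ℂ} (hs : ContDiff ℝ (⊤ : ℕ∞) g) : ContDiff ℝ (⊤ : ℕ∞) (Lop g) := by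
  unfold Lop
  exact hs.add (ContDiff.sum fun i _ => contDiff_const.mul (pd_contDiff (pd_contDiff hs i) i))

lemma fc_Lop {g : Vec → ℂ} (hg : Per g) (hs : ContDiff ℝ (⊤ : ℕ∞) g) (n : Lat) :
    fc (Lop g) n = ((1 + latSq n : ℝ) : ℂ) * fc g n := by
  unfold Lop
  have hi : ∀ i, Integrable (fun x => ((-(4 * Real.pi ^ 2)⁻¹ : ℝ) : ℂ) * pd i (pd i g) x) μT :=
    fun i => (integrable_of_cont_per (pd_per (pd_per hg i) i)
      (pd_contDiff (pd_contDiff hs i) i).continuous).const_mul _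
  rw [fc_add (integrable_of_cont_per hg hs.continuous) (integrable_finsetSum _ fun i _ => hi i),
    fc_sum _ (fun i _ => hi i)]
  simp only [fc_const_mul, fc_pd (pd_per hg _) (pd_contDiff hs _), fc_pd hg hs, latSq]
  push_cast
  rw [add_mul, one_mul, Finset.sum_mul]
  congr 1
  refine Finset.sum_congr rfl fun i _ => ?_
  have hp : (Real.pi : ℂ) ≠ 0 := by exact_mod_cast Real.pi_ne_zero
  field_simp
  rw [Complex.I_sq]
  ring

lemma fc_decay {g : Vec → ℂ} (hg : Per g) (hs : ContDiff ℝ (⊤ : ℕ∞) g) {C : ℝ}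
    (hC : ∀ x, ‖Lop (Lop (Lop g)) x‖ ≤ C) (n : Lat) : (1 + latSq n) ^ 3 * ‖fc g n‖ ≤ C := by
  have h := fc_bound hC n
  rw [fc_Lop (Lop_per (Lop_per hg)) (Lop_contDiff (Lop_contDiff hs)),
    fc_Lop (Lop_per hg) (Lop_contDiff hs), fc_Lop hg hs] at h
  simp only [norm_mul, Complex.norm_real, Real.norm_eq_abs,
    abs_of_nonneg (by linarith [latSq_nonneg n] : (0:ℝ) ≤ 1 + latSq n)] at h
  calc _ = (1 + latSq n) * ((1 + latSq n) * ((1 + latSq n) * ‖fc g n‖)) := by ring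
    _ ≤ C := h

lemma summable_int : Summable (fun m : ℤ => (1 + (m:ℝ) ^ 2)⁻¹) := by
  have h := (Real.summable_one_div_int_pow (p := 2)).2 (by norm_num)
  have h0 : Summable (fun m : ℤ => if m = 0 then (1:ℝ) else 0) :=
    summable_of_ne_finset_zero (s := {0}) (by intro b hb; simp at hb; simp [hb])
  refine Summable.of_nonneg_of_le (fun m => by positivity) (fun m => ?_) (h.add h0)
  by_cases hm : m = 0
  · simp [hm]
  · have : (m:ℝ) ≠ 0 := by exact_mod_cast hm
    simp only [hm, if_false, add_zero, one_div]
    gcongr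
    linarith

lemma summable_lat3 : Summable (fun n : Lat => ((1 + latSq n) ^ 3)⁻¹) := by
  have h1 : ∀ n : Lat, ((1 + latSq n) ^ 3)⁻¹ ≤ ∏ i, (1 + (n i : ℝ) ^ 2)⁻¹ := by
    intro n
    rw [Finset.prod_inv_distrib]
    refine inv_anti₀ (Finset.prod_pos fun i _ => by positivity) ?_
    · calc ∏ i, (1 + (n i : ℝ) ^ 2) ≤ ∏ i : Fin 3, (1 + latSq n) := by
            refine Finset.prod_le_prod (fun i _ => by positivity) fun i _ => ?_
            gcongr
            exact Finset.single_le_sum (f := fun i => (n i : ℝ) ^ 2) (fun i _ => sq_nonneg _)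
              (Finset.mem_univ i)
        _ = _ := by simp
  refine Summable.of_nonneg_of_le (fun n => by have := latSq_nonneg n; positivity) h1 ?_
  refine summable_of_sum_le (c := (∑' m : ℤ, (1 + (m:ℝ) ^ 2)⁻¹) ^ 3)
    (fun n => Finset.prod_nonneg fun i _ => by positivity) fun u => ?_
  calc ∑ n ∈ u, ∏ i, (1 + (n i : ℝ) ^ 2)⁻¹
      ≤ ∑ n ∈ Fintype.piFinset (fun i => u.image (fun n : Lat => n i)), ∏ i, (1 + (n i : ℝ) ^ 2)⁻¹ := by
        refine Finset.sum_le_sum_of_subset_of_nonneg ?_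
          (fun n _ _ => Finset.prod_nonneg (fun i _ => by positivity))
        intro n hn
        rw [Fintype.mem_piFinset]
        intro i
        exact Finset.mem_image_of_mem (fun n : Lat => n i) hn
    _ = ∏ i : Fin 3, ∑ m ∈ u.image (fun n : Lat => n i), (1 + (m : ℝ) ^ 2)⁻¹ := by
        rw [Finset.prod_univ_sum]
    _ ≤ ∏ i : Fin 3, ∑' m : ℤ, (1 + (m:ℝ) ^ 2)⁻¹ := by
        refine Finset.prod_le_prod (fun i _ => Finset.sum_nonneg fun m _ => by positivity)
          fun i _ => ?_
        exact summable_int.sum_le_tsum _ (fun m _ => by positivity)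
    _ = _ := by simp

/-! ### Pairing with smooth periodic functions -/

lemma integral_chr (k : Lat) : ∫ x in cube, chr k x = if k = 0 then 1 else 0 := by
  split_ifs with h
  · subst h
    have : ∫ x, (1:ℂ) ∂μT = 1 := by simp
    simp only [chr_zero]
    exact this
  · obtain ⟨i, hi⟩ : ∃ i, k i ≠ 0 := by
      by_contra hc
      push Not at hc
      exact h (funext hc)
    have h1 := integral_pd_zero (chr_per k) (chr_contDiff k) i
    simp only [pd_chr] at h1
    rw [integral_const_mul] at h1
    have hp : (Real.pi : ℂ) ≠ 0 := by exact_mod_cast Real.pi_ne_zero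
    have hi' : (k i : ℂ) ≠ 0 := by exact_mod_cast hi
    simpa [hp, hi'] using h1

lemma fc_chr (m n : Lat) : fc (chr m) n = if m = n then 1 else 0 := by
  unfold fc
  simp only [chr_conj, ← chr_add]
  rw [integral_chr]
  congr 1
  rw [← sub_eq_add_neg, sub_eq_zero]

lemma fc_summable {g : Vec → ℂ} (hg : Per g) (hs : ContDiff ℝ (⊤ : ℕ∞) g) :
    Summable (fun n => ‖fc g n‖) := by
  obtain ⟨C, hC⟩ := per_bounded (Lop_per (Lop_per (Lop_per hg)))
    (Lop_contDiff (Lop_contDiff (Lop_contDiff hs))).continuous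
  refine Summable.of_nonneg_of_le (fun n => norm_nonneg _) (fun n => ?_)
    (summable_lat3.mul_left C)
  have h := fc_decay hg hs hC n
  have h0 : 0 < (1 + latSq n) ^ 3 := by have := latSq_nonneg n; positivity
  rw [← div_eq_mul_inv, le_div_iff₀ h0]
  linarith

lemma memLp_cont_per {g : Vec → ℂ} (hg : Per g) (hc : Continuous g) : MemLp g 2 μT := by
  obtain ⟨D, hD⟩ := per_bounded hg hc
  exact MemLp.of_bound hc.aestronglyMeasurable D (Eventually.of_forall hD)

lemma ae_eq_of_fc {f g : Vec → ℂ} (hf : MemLp f 2 μT) (hg : MemLp g 2 μT)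
    (h : ∀ n, fc f n = fc g n) : f =ᵐ[μT] g := by
  have hfg : MemLp (fun x => f x - g x) 2 μT := hf.sub hg
  have h1 : eLpNorm (fun x => f x - g x) 2 μT ^ 2 = 0 := by
    rw [eLpNorm_sq_eq hfg]
    have : ∀ n, fc (fun x => f x - g x) n = 0 := by
      intro n
      rw [fc_sub (hf.integrable (by norm_num)) (hg.integrable (by norm_num)), h, sub_self]
    simp [this]
  have h2 : eLpNorm (fun x => f x - g x) 2 μT = 0 := by simpa using h1
  rw [eLpNorm_eq_zero_iff hfg.1 (by norm_num)] at h2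
  filter_upwards [h2] with x hx
  exact sub_eq_zero.1 hx

lemma fc_tsum_chr {c : Lat → ℂ} (hc : Summable (fun n => ‖c n‖)) (n : Lat) :
    fc (fun x => ∑' k, c k * chr k x) n = c n := by
  rw [fc_eq]
  have h := hasSum_integral_of_summable_integral_norm (μ := μT)
    (F := fun k x => c k * chr k x * (starRingEnd ℂ) (chr n x))
    (fun k => ?_) ?_
  · have e : ∀ x, (∑' k, c k * chr k x) * (starRingEnd ℂ) (chr n x)
        = ∑' k, c k * chr k x * (starRingEnd ℂ) (chr n x) := fun x => tsum_mul_right.symm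
    simp only [e]
    rw [← h.tsum_eq]
    have e2 : ∀ k, ∫ x, c k * chr k x * (starRingEnd ℂ) (chr n x) ∂μT
        = c k * if k = n then 1 else 0 := by
      intro k
      have := fc_const_mul (c k) (chr k) n
      rw [fc_chr, fc_eq] at this
      exact this
    simp only [e2]
    simp
  · exact integrable_mul_chr ((integrable_of_cont_per (chr_per k) (chr_continuous k)).const_mul _) n
  · simp only [norm_mul, chr_norm, RCLike.norm_conj, mul_one]
    simpa using hc

lemma tsum_chr_cont {c : Lat → ℂ} (hc : Summable (fun n => ‖c n‖)) :
    Continuous (fun x => ∑' k, c k * chr k x) :=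
  continuous_tsum (fun k => continuous_const.mul (chr_continuous k)) hc
    (fun k x => by simp [chr_norm])

lemma smooth_ae_eq {g : Vec → ℂ} (hg : Per g) (hs : ContDiff ℝ (⊤ : ℕ∞) g) :
    g =ᵐ[μT] fun x => ∑' k, fc g k * chr k x := by
  have hc := fc_summable hg hs
  refine ae_eq_of_fc (memLp_cont_per hg hs.continuous)
    (memLp_cont_per (fun x n => ?_) (tsum_chr_cont hc)) fun n => (fc_tsum_chr hc n).symm
  simp only [chr_per _ x n]

lemma pairing {f g : Vec → ℂ} (hf : Integrable f μT) (hg : Per g)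
    (hs : ContDiff ℝ (⊤ : ℕ∞) g) :
    HasSum (fun n => fc f (-n) * fc g n) (∫ x in cube, f x * g x) := by
  have hc := fc_summable hg hs
  have h := hasSum_integral_of_summable_integral_norm (μ := μT)
    (F := fun k x => f x * (fc g k * chr k x)) (fun k => ?_) ?_
  · have e2 : ∀ k, ∫ x, f x * (fc g k * chr k x) ∂μT = fc f (-k) * fc g k := by
      intro k
      rw [fc_eq f, ← integral_mul_const]
      refine integral_congr_ae (Eventually.of_forall fun x => ?_)
      simp only [chr_conj, neg_neg]; ring
    simp only [e2] at h
    have e3 : ∫ x in cube, f x * g x = ∫ x, ∑' i, f x * (fc g i * chr i x) ∂μT := ?_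
    · rw [e3]; exact h
    show ∫ x, f x * g x ∂μT = _
    refine integral_congr_ae ?_
    filter_upwards [smooth_ae_eq hg hs] with x hx
    rw [hx, tsum_mul_left]
  · have := ((integrable_mul_chr hf (-k)).mul_const (fc g k))
    refine this.congr (Eventually.of_forall fun x => ?_)
    simp only [chr_conj, neg_neg]; ring
  · simp only [norm_mul, chr_norm, mul_one, integral_mul_const]
    exact hc.mul_left _

/-- Convolution of coefficient sequences. -/
def cv (f g : Lat → ℂ) (m : Lat) : ℂ := ∑' k, f k * g (m - k)

lemma fc_mul_real {f g : Vec → ℝ} (hf : MemLp (fun x => (f x : ℂ)) 2 μT)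
    (hg : MemLp (fun x => (g x : ℂ)) 2 μT) (m : Lat) :
    fc (fun x => ((f x * g x : ℝ) : ℂ)) m
      = cv (fc fun x => (f x : ℂ)) (fc fun x => (g x : ℂ)) m := by
  have hgm : MemLp (fun x => (g x : ℂ) * (starRingEnd ℂ) (chr m x)) 2 μT := by
    have hb : MemLp (fun x => (starRingEnd ℂ) (chr m x)) ∞ μT :=
      memLp_top_of_bound (Complex.continuous_conj.comp (chr_continuous m)).aestronglyMeasurable 1
        (Eventually.of_forall fun x => by simp [chr_norm])
    exact hb.mul hg
  have h := parseval_prod hf hgm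
  unfold cv
  have e1 : fc (fun x => ((f x * g x : ℝ) : ℂ)) m
      = ∫ x in cube, (starRingEnd ℂ) (f x : ℂ) * ((g x : ℂ) * (starRingEnd ℂ) (chr m x)) := by
    unfold fc
    refine integral_congr_ae (Eventually.of_forall fun x => ?_)
    simp only [Complex.conj_ofReal]; push_cast; ring
  rw [e1, ← h.tsum_eq, ← (Equiv.neg Lat).tsum_eq]
  refine tsum_congr fun k => ?_
  simp only [Equiv.neg_apply]
  rw [fc_real_conj, neg_neg]
  congr 1
  unfold fc
  refine integral_congr_ae (Eventually.of_forall fun x => ?_)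
  simp only [chr_conj]
  rw [mul_assoc, ← chr_add]
  congr 2
  abel

/-! ### Time-dependent test functions -/

def TT (T : ℝ) (f : ℝ → Vec → ℂ) : Prop :=
  ContDiff ℝ (⊤ : ℕ∞) (Function.uncurry f) ∧ (∀ t, Per (f t)) ∧
    ∃ a b : ℝ, 0 < a ∧ b < T ∧ ∀ t, t ∉ Set.Icc a b → f t = 0

lemma TT.slice {T : ℝ} {f : ℝ → Vec → ℂ} (h : TT T f) (t : ℝ) : ContDiff ℝ (⊤ : ℕ∞) (f t) :=
  h.1.comp (contDiff_const.prodMk contDiff_id)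

lemma pd_eq_uncurry {E : Type*} [NormedAddCommGroup E] [NormedSpace ℝ E] {f : ℝ → Vec → E}
    (h : ContDiff ℝ (⊤ : ℕ∞) (Function.uncurry f)) (i : Fin 3) (t : ℝ) (x : Vec) :
    pd i (f t) x = fderiv ℝ (Function.uncurry f) (t, x) (0, EuclideanSpace.single i (1:ℝ)) := by
  unfold pd
  have h1 : HasFDerivAt (Function.uncurry f) (fderiv ℝ (Function.uncurry f) (t, x)) (t, x) :=
    (h.differentiable (by simp)).differentiableAt.hasFDerivAt
  have h2 : HasFDerivAt (fun y : Vec => (t, y)) (ContinuousLinearMap.inr ℝ ℝ Vec) x :=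
    hasFDerivAt_prodMk_right t x
  have h3 := h1.comp x h2
  have h4 : fderiv ℝ (f t) x = _ := h3.fderiv
  rw [h4]
  simp

lemma hasDerivAt_time {E : Type*} [NormedAddCommGroup E] [NormedSpace ℝ E] {f : ℝ → Vec → E}
    (h : ContDiff ℝ (⊤ : ℕ∞) (Function.uncurry f)) (t : ℝ) (x : Vec) :
    HasDerivAt (fun s => f s x) (fderiv ℝ (Function.uncurry f) (t, x) (1, 0)) t := by
  have h1 : HasFDerivAt (Function.uncurry f) (fderiv ℝ (Function.uncurry f) (t, x)) (t, x) :=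
    (h.differentiable (by simp)).differentiableAt.hasFDerivAt
  have h2 : HasDerivAt (fun s : ℝ => (s, x)) ((1:ℝ), (0:Vec)) t :=
    (hasDerivAt_id t).prodMk (hasDerivAt_const t x)
  exact h1.comp_hasDerivAt t h2

lemma tderiv_eq_uncurry {E : Type*} [NormedAddCommGroup E] [NormedSpace ℝ E] {f : ℝ → Vec → E}
    (h : ContDiff ℝ (⊤ : ℕ∞) (Function.uncurry f)) (t : ℝ) (x : Vec) :
    tderiv f t x = fderiv ℝ (Function.uncurry f) (t, x) (1, 0) :=
  (hasDerivAt_time h t x).deriv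

lemma TT.pd {T : ℝ} {f : ℝ → Vec → ℂ} (h : TT T f) (i : Fin 3) :
    TT T (fun t => PaperHelicity.pd i (f t)) := by
  refine ⟨?_, fun t => pd_per (h.2.1 t) i, ?_⟩
  · have e : Function.uncurry (fun t => PaperHelicity.pd i (f t)) = fun p : ℝ × Vec =>
        fderiv ℝ (Function.uncurry f) p (0, EuclideanSpace.single i (1:ℝ)) := by
      funext p
      exact pd_eq_uncurry h.1 i p.1 p.2
    rw [e]
    exact (h.1.fderiv_right (by simp)).clm_apply contDiff_const
  · obtain ⟨a, b, ha, hb, hab⟩ := h.2.2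
    refine ⟨a, b, ha, hb, fun t ht => ?_⟩
    funext x
    simp only [PaperHelicity.pd, hab t ht]
    simp

lemma TT.tderiv {T : ℝ} {f : ℝ → Vec → ℂ} (h : TT T f) :
    TT T (PaperHelicity.tderiv f) := by
  refine ⟨?_, fun t x n => ?_, ?_⟩
  · have e : Function.uncurry (PaperHelicity.tderiv f) = fun p : ℝ × Vec =>
        fderiv ℝ (Function.uncurry f) p (1, 0) := by
      funext p
      exact tderiv_eq_uncurry h.1 p.1 p.2
    rw [e]
    exact (h.1.fderiv_right (by simp)).clm_apply contDiff_const
  · unfold PaperHelicity.tderiv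
    simp only [h.2.1 _ x n]
  · obtain ⟨a, b, ha, hb, hab⟩ := h.2.2
    refine ⟨a, b, ha, hb, fun t ht => ?_⟩
    funext x
    have : (fun s => f s x) =ᶠ[𝓝 t] fun _ => 0 := by
      filter_upwards [isClosed_Icc.isOpen_compl.mem_nhds ht] with s hs
      rw [hab s hs]; rfl
    unfold PaperHelicity.tderiv
    rw [this.deriv_eq]
    simp

lemma TT.add {T : ℝ} {f g : ℝ → Vec → ℂ} (hf : TT T f) (hg : TT T g) :
    TT T (fun t x => f t x + g t x) := by
  refine ⟨hf.1.add hg.1, fun t x n => by simp only [hf.2.1 t x n, hg.2.1 t x n], ?_⟩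
  obtain ⟨a, b, ha, hb, hab⟩ := hf.2.2
  obtain ⟨a', b', ha', hb', hab'⟩ := hg.2.2
  refine ⟨min a a', max b b', lt_min ha ha', max_lt hb hb', fun t ht => ?_⟩
  have h1 : t ∉ Set.Icc a b := fun hc => ht ⟨(min_le_left _ _).trans hc.1, hc.2.trans (le_max_left _ _)⟩
  have h2 : t ∉ Set.Icc a' b' :=
    fun hc => ht ⟨(min_le_right _ _).trans hc.1, hc.2.trans (le_max_right _ _)⟩
  funext x
  simp [hab t h1, hab' t h2]

lemma TT.const_mul {T : ℝ} {f : ℝ → Vec → ℂ} (hf : TT T f) (c : ℂ) :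
    TT T (fun t x => c * f t x) := by
  refine ⟨contDiff_const.mul hf.1, fun t x n => by simp only [hf.2.1 t x n], ?_⟩
  obtain ⟨a, b, ha, hb, hab⟩ := hf.2.2
  refine ⟨a, b, ha, hb, fun t ht => ?_⟩
  funext x
  simp [hab t ht]

lemma TT.Lop {T : ℝ} {f : ℝ → Vec → ℂ} (hf : TT T f) :
    TT T (fun t => PaperHelicity.Lop (f t)) := by
  have := hf.add ((((hf.pd 0).pd 0).const_mul ((-(4 * Real.pi ^ 2)⁻¹ : ℝ) : ℂ)).add
    ((((hf.pd 1).pd 1).const_mul ((-(4 * Real.pi ^ 2)⁻¹ : ℝ) : ℂ)).add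
    (((hf.pd 2).pd 2).const_mul ((-(4 * Real.pi ^ 2)⁻¹ : ℝ) : ℂ))))
  convert this using 3
  simp only [PaperHelicity.Lop, Fin.sum_univ_three]
  ring

lemma TT.bounded {T : ℝ} {f : ℝ → Vec → ℂ} (h : TT T f) : ∃ C, ∀ t x, ‖f t x‖ ≤ C := by
  obtain ⟨a, b, ha, hb, hab⟩ := h.2.2
  obtain ⟨C, hC⟩ := ((isCompact_Icc (a := a) (b := b)).prod
    (isCompact_closedBall (0:Vec) 2)).exists_bound_of_continuousOn h.1.continuous.continuousOn
  refine ⟨max C 0, fun t x => ?_⟩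
  by_cases ht : t ∈ Set.Icc a b
  · rw [← per_sec_tau (h.2.1 t)]
    refine le_trans (hC (t, secT (tauT x)) ⟨ht, cube_bounded fun i => ?_⟩) (le_max_left _ _)
    have := (AddCircle.measurableEquivIco (1:ℝ) 0 ((tauT x) i)).2
    simpa [secT] using this
  · simp [hab t ht]

lemma TT.decay {T : ℝ} {f : ℝ → Vec → ℂ} (h : TT T f) :
    ∃ C, ∀ t n, (1 + latSq n) ^ 3 * ‖fc (f t) n‖ ≤ C := by
  obtain ⟨C, hC⟩ := h.Lop.Lop.Lop.bounded
  exact ⟨C, fun t n => fc_decay (h.2.1 t) (h.slice t) (hC t) n⟩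

lemma TT.hasDerivAt_fc {T : ℝ} {f : ℝ → Vec → ℂ} (h : TT T f) (n : Lat) (t : ℝ) :
    HasDerivAt (fun s => fc (f s) n) (fc (PaperHelicity.tderiv f t) n) t := by
  obtain ⟨C, hC⟩ := h.tderiv.bounded
  have hcc : Continuous fun x => (starRingEnd ℂ) (chr n x) :=
    Complex.continuous_conj.comp (chr_continuous n)
  have key := hasDerivAt_integral_of_dominated_loc_of_deriv_le (μ := μT) (𝕜 := ℝ)
    (F := fun s x => f s x * (starRingEnd ℂ) (chr n x))
    (F' := fun s x => PaperHelicity.tderiv f s x * (starRingEnd ℂ) (chr n x)) (x₀ := t)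
    (bound := fun _ => C) (s := Set.univ) Filter.univ_mem
    (Eventually.of_forall fun s => ((h.slice s).continuous.mul hcc).aestronglyMeasurable)
    (integrable_mul_chr (integrable_of_cont_per (h.2.1 t) (h.slice t).continuous) n)
    ((h.tderiv.slice t).continuous.mul hcc).aestronglyMeasurable
    (Eventually.of_forall fun x s _ => by simpa [chr_norm] using hC s x) (integrable_const _)
    (Eventually.of_forall fun x s _ => by
      have := (hasDerivAt_time h.1 s x).mul_const ((starRingEnd ℂ) (chr n x))
      rwa [← tderiv_eq_uncurry h.1 s x] at this)
  exact key.2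

lemma TT.continuous_fc {T : ℝ} {f : ℝ → Vec → ℂ} (h : TT T f) (n : Lat) :
    Continuous (fun s => fc (f s) n) :=
  continuous_iff_continuousAt.2 fun t => (h.hasDerivAt_fc n t).continuousAt

lemma TT.fc_supp {T : ℝ} {f : ℝ → Vec → ℂ} (h : TT T f) :
    ∃ a b : ℝ, 0 < a ∧ b < T ∧ ∀ t, t ∉ Set.Icc a b → ∀ n, fc (f t) n = 0 := by
  obtain ⟨a, b, ha, hb, hab⟩ := h.2.2
  refine ⟨a, b, ha, hb, fun t ht n => ?_⟩
  rw [hab t ht]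
  simp [fc]

lemma TT.ofReal {T : ℝ} (φ : TestFun T ℝ) : TT T (fun t x => (φ.f t x : ℂ)) := by
  refine ⟨Complex.ofRealCLM.contDiff.comp φ.smooth, fun t x n => by simp only [φ.periodic t x n], ?_⟩
  obtain ⟨a, b, ha, hb, hab⟩ := φ.compactIn
  refine ⟨a, b, ha, hb, fun t ht => ?_⟩
  funext x
  simp [hab t ht]

lemma TT.ofVec {T : ℝ} (φ : TestFun T Vec) (j : Fin 3) : TT T (fun t x => (φ.f t x j : ℂ)) := by
  refine ⟨Complex.ofRealCLM.contDiff.comp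
    ((EuclideanSpace.proj (𝕜 := ℝ) j : Vec →L[ℝ] ℝ).contDiff.comp φ.smooth),
    fun t x n => by simp only [φ.periodic t x n], ?_⟩
  obtain ⟨a, b, ha, hb, hab⟩ := φ.compactIn
  refine ⟨a, b, ha, hb, fun t ht => ?_⟩
  funext x
  simp [hab t ht]

lemma pd_ofReal {g : Vec → ℝ} (hg : ContDiff ℝ (⊤ : ℕ∞) g) (i : Fin 3) (x : Vec) :
    ((pd i g x : ℝ) : ℂ) = pd i (fun y => (g y : ℂ)) x := by
  unfold pd
  have h1 : HasFDerivAt g (fderiv ℝ g x) x :=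
    (hg.differentiable (by simp)).differentiableAt.hasFDerivAt
  have h2 := (Complex.ofRealCLM.hasFDerivAt (x := g x)).comp x h1
  have h3 : fderiv ℝ (fun y => (g y : ℂ)) x = _ := h2.fderiv
  rw [h3]; simp

lemma comp_contDiff {T : ℝ} (φ : TestFun T Vec) (t : ℝ) (j : Fin 3) :
    ContDiff ℝ (⊤ : ℕ∞) (fun y => φ.f t y j) :=
  (EuclideanSpace.proj (𝕜 := ℝ) j : Vec →L[ℝ] ℝ).contDiff.comp
    (φ.smooth.comp (contDiff_const.prodMk contDiff_id))

lemma scal_contDiff {T : ℝ} (φ : TestFun T ℝ) (t : ℝ) :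
    ContDiff ℝ (⊤ : ℕ∞) (φ.f t) :=
  φ.smooth.comp (contDiff_const.prodMk contDiff_id)

lemma lap_ofReal {g : Vec → ℝ} (hg : ContDiff ℝ (⊤ : ℕ∞) g) (x : Vec) :
    ((lap g x : ℝ) : ℂ) = ∑ i, pd i (pd i (fun y => (g y : ℂ))) x := by
  unfold lap
  push_cast
  refine Finset.sum_congr rfl fun i _ => ?_
  have e : (fun y => ((pd i g y : ℝ) : ℂ)) = pd i (fun y => (g y : ℂ)) := by
    funext y; exact pd_ofReal hg i y
  have := pd_ofReal (pd_contDiff hg i) i x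
  rw [e] at this
  exact this

lemma tderiv_ofVec {T : ℝ} (φ : TestFun T Vec) (j : Fin 3) (t : ℝ) (x : Vec) :
    ((tderiv φ.f t x j : ℝ) : ℂ) = tderiv (fun t x => (φ.f t x j : ℂ)) t x := by
  have h1 := hasDerivAt_time φ.smooth t x
  have h2 := (EuclideanSpace.proj (𝕜 := ℝ) j : Vec →L[ℝ] ℝ).hasFDerivAt.comp_hasDerivAt t h1
  have h3 := Complex.ofRealCLM.hasFDerivAt.comp_hasDerivAt t h2
  have h4 : tderiv (fun t x => (φ.f t x j : ℂ)) t x = _ := h3.deriv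
  rw [h4, tderiv_eq_uncurry φ.smooth]
  simp

/-! ### Reconstruction of functions from Fourier coefficients -/

def box (N : ℕ) : Finset Lat := Fintype.piFinset (fun _ => Finset.Icc (-(N:ℤ)) N)

lemma mem_box {N : ℕ} {n : Lat} : n ∈ box N ↔ ∀ i, |n i| ≤ N := by
  simp [box, Fintype.mem_piFinset, abs_le]

lemma box_neg {N : ℕ} {n : Lat} : -n ∈ box N ↔ n ∈ box N := by simp [mem_box]

lemma box_mono {M N : ℕ} (h : M ≤ N) : box M ⊆ box N := by
  intro n hn
  rw [mem_box] at *
  intro i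
  exact (hn i).trans (by exact_mod_cast h)

lemma latSq_of_not_mem_box {N : ℕ} {n : Lat} (h : n ∉ box N) : (N:ℝ) ^ 2 ≤ latSq n := by
  rw [mem_box] at h
  push Not at h
  obtain ⟨i, hi⟩ := h
  have h1 : (N:ℝ) < |(n i : ℝ)| := by exact_mod_cast hi
  calc (N:ℝ) ^ 2 ≤ |(n i : ℝ)| ^ 2 := by gcongr
    _ = (n i : ℝ) ^ 2 := sq_abs _
    _ ≤ latSq n := Finset.single_le_sum (f := fun i => (n i : ℝ) ^ 2) (fun i _ => sq_nonneg _)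
              (Finset.mem_univ i)

lemma exists_mem_box (n : Lat) : ∃ N, n ∈ box N := by
  refine ⟨∑ i, (n i).natAbs, mem_box.2 fun i => ?_⟩
  rw [Int.abs_eq_natAbs]
  exact_mod_cast Finset.single_le_sum (f := fun i => (n i).natAbs) (fun i _ => Nat.zero_le _)
    (Finset.mem_univ i)

def psum (c : Lat → ℂ) (s : Finset Lat) (x : Vec) : ℂ := ∑ n ∈ s, c n * chr n x

lemma psum_cont (c : Lat → ℂ) (s : Finset Lat) : Continuous (psum c s) :=
  continuous_finsetSum _ fun n _ => continuous_const.mul (chr_continuous n)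

lemma psum_per (c : Lat → ℂ) (s : Finset Lat) : Per (psum c s) := by
  intro x n
  simp only [psum, chr_per _ x n]

lemma fc_psum (c : Lat → ℂ) (s : Finset Lat) (n : Lat) :
    fc (psum c s) n = if n ∈ s then c n else 0 := by
  unfold psum
  rw [fc_sum _ (fun i _ => (integrable_of_cont_per (chr_per i) (chr_continuous i)).const_mul _)]
  simp only [fc_const_mul, fc_chr]
  simp

lemma psum_conj {c : Lat → ℂ} (hc : ∀ n, (starRingEnd ℂ) (c n) = c (-n)) (N : ℕ) (x : Vec) :
    (starRingEnd ℂ) (psum c (box N) x) = psum c (box N) x := by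
  unfold psum
  rw [map_sum]
  simp only [map_mul, hc, chr_conj]
  refine Finset.sum_nbij' (fun n => -n) (fun n => -n) ?_ ?_ ?_ ?_ ?_
  · intro n hn; exact box_neg.2 hn
  · intro n hn; exact box_neg.2 hn
  · intro n _; simp
  · intro n _; simp
  · intro n _; rfl

lemma psum_sub {c : Lat → ℂ} {s t : Finset Lat} (h : s ⊆ t) (x : Vec) :
    psum c t x - psum c s x = psum c (t \ s) x := by
  unfold psum
  rw [← Finset.sum_sdiff h]; ring

lemma eLpNorm_psum (c : Lat → ℂ) (s : Finset Lat) :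
    eLpNorm (psum c s) 2 μT ^ 2 = ∑ n ∈ s, ENNReal.ofReal (‖c n‖ ^ 2) := by
  rw [eLpNorm_sq_eq (memLp_cont_per (psum_per c s) (psum_cont c s))]
  rw [tsum_eq_sum (s := s)]
  · refine Finset.sum_congr rfl fun n hn => ?_
    rw [fc_psum, if_pos hn]
  · intro n hn
    rw [fc_psum, if_neg hn]; simp

lemma psum_diff_bound {c : Lat → ℂ} {H : ℝ}
    (hH : ∀ s : Finset Lat, ∑ n ∈ s, (1 + latSq n) * ‖c n‖ ^ 2 ≤ H) {N j k : ℕ}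
    (hj : N ≤ j) (hk : j ≤ k) :
    eLpNorm (psum c (box (2 ^ k)) - psum c (box (2 ^ j))) 2 μT
      ≤ ENNReal.ofReal (Real.sqrt H * (1/2) ^ N) := by
  have hsub : box (2 ^ j) ⊆ box (2 ^ k) := box_mono (Nat.pow_le_pow_right (by norm_num) hk)
  have e : psum c (box (2 ^ k)) - psum c (box (2 ^ j)) = psum c (box (2 ^ k) \ box (2 ^ j)) := by
    funext x; exact psum_sub hsub x
  have hH0 : 0 ≤ H := by simpa using hH ∅
  rw [e, ← ENNReal.pow_le_pow_left_iff (n := 2) (by norm_num), eLpNorm_psum,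
    ← ENNReal.ofReal_pow (by positivity), ← ENNReal.ofReal_sum_of_nonneg (fun n _ => by positivity)]
  refine ENNReal.ofReal_le_ofReal ?_
  rw [mul_pow, Real.sq_sqrt hH0]
  have h4 : (0:ℝ) < ((2:ℝ) ^ N) ^ 2 := by positivity
  have : ((1/2:ℝ) ^ N) ^ 2 = (((2:ℝ) ^ N) ^ 2)⁻¹ := by simp
  rw [this, ← div_eq_mul_inv, le_div_iff₀ h4, Finset.sum_mul]
  refine le_trans (Finset.sum_le_sum fun n hn => ?_) (hH (box (2 ^ k) \ box (2 ^ j)))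
  have h5 := latSq_of_not_mem_box (Finset.mem_sdiff.1 hn).2
  have h6 : ((2:ℝ) ^ N) ^ 2 ≤ (((2 ^ j : ℕ) : ℝ)) ^ 2 := by
    push_cast
    gcongr
    norm_num
  have : 0 ≤ ‖c n‖ ^ 2 := by positivity
  nlinarith

/-- Reconstruction. -/
def rcn (c : Lat → ℂ) (x : Vec) : ℝ := (limUnder atTop (fun j : ℕ => psum c (box (2 ^ j)) x)).re

lemma rcn_per (c : Lat → ℂ) : Per (rcn c) := by
  intro x n
  unfold rcn
  simp only [psum_per c _ x n]

lemma rcn_spec {c : Lat → ℂ} (hc : ∀ n, (starRingEnd ℂ) (c n) = c (-n)) {H : ℝ}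
    (hH : ∀ s : Finset Lat, ∑ n ∈ s, (1 + latSq n) * ‖c n‖ ^ 2 ≤ H) :
    MemLp (fun x => (rcn c x : ℂ)) 2 μT ∧ ∀ n, fc (fun x => (rcn c x : ℂ)) n = c n := by
  set f : ℕ → Vec → ℂ := fun j => psum c (box (2 ^ j)) with hf
  have hfL : ∀ j, MemLp (f j) 2 μT := fun j => memLp_cont_per (psum_per c _) (psum_cont c _)
  have hfm : ∀ j, AEStronglyMeasurable (f j) μT := fun j => (hfL j).1
  set B : ℕ → ℝ≥0∞ := fun N => ENNReal.ofReal ((Real.sqrt H + 1) * (1/2) ^ N) with hB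
  have hBs : ∑' i, B i ≠ ∞ := by
    have hs : Summable (fun N : ℕ => (Real.sqrt H + 1) * (1/2 : ℝ) ^ N) :=
      summable_geometric_two.mul_left _
    rw [hB, ← ENNReal.ofReal_tsum_of_nonneg (fun n => by positivity) hs]
    exact ENNReal.ofReal_ne_top
  have hcau : ∀ N n m : ℕ, N ≤ n → N ≤ m → eLpNorm (f n - f m) 2 μT < B N := by
    intro N n m hn hm
    have hlt : ENNReal.ofReal (Real.sqrt H * (1/2) ^ N) < B N := by
      rw [hB]
      refine (ENNReal.ofReal_lt_ofReal_iff (by positivity)).2 ?_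
      have : (0:ℝ) < (1/2) ^ N := by positivity
      nlinarith
    refine lt_of_le_of_lt ?_ hlt
    rcases le_total m n with h | h
    · exact psum_diff_bound hH hm h
    · rw [eLpNorm_sub_comm]
      exact psum_diff_bound hH hn h
  have hae := Lp.ae_tendsto_of_cauchy_eLpNorm hfm (by norm_num) hBs hcau
  have hlim : ∀ᵐ x ∂μT, Tendsto (fun j => f j x) atTop (𝓝 (rcn c x : ℂ)) := by
    filter_upwards [hae] with x hx
    have h1 : Tendsto (fun j => f j x) atTop (𝓝 (limUnder atTop (fun j => f j x))) :=
      tendsto_nhds_limUnder hx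
    have h2 : Tendsto (fun j => (starRingEnd ℂ) (f j x)) atTop
        (𝓝 ((starRingEnd ℂ) (limUnder atTop (fun j => f j x)))) :=
      (Complex.continuous_conj.tendsto _).comp h1
    have h3 : ∀ j, (starRingEnd ℂ) (f j x) = f j x := fun j => psum_conj hc _ x
    simp only [h3] at h2
    have h4 := tendsto_nhds_unique h1 h2
    have h5 : ((limUnder atTop (fun j => f j x)).re : ℂ) = limUnder atTop (fun j => f j x) :=
      Complex.conj_eq_iff_re.1 h4.symm
    have h6 : (rcn c x : ℂ) = limUnder atTop (fun j => f j x) := h5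
    rw [h6]; exact h1
  have hl2 := Lp.cauchy_tendsto_of_tendsto hfm _ hBs hcau hlim
  have hmem := Lp.memLp_of_cauchy_tendsto (by norm_num) hfL _
    (aestronglyMeasurable_of_tendsto_ae atTop hfm hlim) hl2
  refine ⟨hmem, fun n => ?_⟩
  have h1 : Tendsto (fun j => fc (f j) n) atTop (𝓝 (c n)) := by
    refine tendsto_const_nhds.congr' ?_
    obtain ⟨N, hN⟩ := exists_mem_box n
    filter_upwards [eventually_ge_atTop N] with j hj
    rw [hf]
    simp only [fc_psum]
    rw [if_pos (box_mono (le_trans hj Nat.lt_two_pow_self.le) hN)]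
  have h2 : Tendsto (fun j => fc (f j) n) atTop (𝓝 (fc (fun x => (rcn c x : ℂ)) n)) := by
    rw [tendsto_iff_norm_sub_tendsto_zero]
    have h3 : Tendsto (fun j => (eLpNorm (f j - fun x => (rcn c x : ℂ)) 2 μT).toReal) atTop (𝓝 0) := by
      have h30 := (ENNReal.tendsto_toReal (ENNReal.zero_ne_top)).comp hl2
      rwa [ENNReal.toReal_zero] at h30
    refine squeeze_zero (fun j => norm_nonneg _) (fun j => ?_) h3
    have hd : MemLp (f j - fun x => (rcn c x : ℂ)) 2 μT := (hfL j).sub hmem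
    have e : fc (f j) n - fc (fun x => (rcn c x : ℂ)) n = fc (f j - fun x => (rcn c x : ℂ)) n :=
      (fc_sub ((hfL j).integrable (by norm_num)) (hmem.integrable (by norm_num)) n).symm
    rw [e]
    have h4 := eLpNorm_sq_eq hd
    have h5 : ENNReal.ofReal (‖fc (f j - fun x => (rcn c x : ℂ)) n‖ ^ 2)
        ≤ eLpNorm (f j - fun x => (rcn c x : ℂ)) 2 μT ^ 2 := by
      rw [h4]
      exact ENNReal.le_tsum n
    rw [ENNReal.ofReal_pow (norm_nonneg _), ENNReal.pow_le_pow_left_iff (by norm_num)] at h5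
    rw [← ENNReal.ofReal_le_iff_le_toReal hd.2.ne]
    exact h5
  exact tendsto_nhds_unique h2 h1

lemma measurable_rcn {c : ℝ → Lat → ℂ} (hc : ∀ n, Measurable fun t => c t n) :
    Measurable (fun p : ℝ × Vec => rcn (c p.1) p.2) := by
  unfold rcn
  refine Complex.measurable_re.comp ?_
  refine StronglyMeasurable.measurable ?_
  refine StronglyMeasurable.limUnder fun j => Measurable.stronglyMeasurable ?_
  unfold psum
  refine Finset.measurable_sum _ fun n _ => ?_
  exact ((hc n).comp measurable_fst).mul ((chr_continuous n).measurable.comp measurable_snd)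

/-! ### Global solutions of finite-dimensional ODEs with an a-priori bound -/

lemma ode_exists {V : Type*} [NormedAddCommGroup V] [NormedSpace ℝ V] [FiniteDimensional ℝ V]
    (F : ℝ → V → V) (hF : ContDiff ℝ 1 (Function.uncurry F)) {T : ℝ} (hT : 0 < T) (x₀ : V) (R : ℝ)
    (hap : ∀ (χ : ℝ → ℝ) (y : ℝ → V), (∀ t, 0 ≤ χ t ∧ χ t ≤ 1) → y 0 = x₀ →
      (∀ t ∈ Set.Icc 0 T, HasDerivWithinAt y (χ t • F t (y t)) (Set.Icc 0 T) t) →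
      ∀ t ∈ Set.Icc 0 T, ‖y t‖ ≤ R) :
    ∃ y : ℝ → V, y 0 = x₀ ∧
      ∀ t ∈ Set.Icc 0 T, HasDerivWithinAt y (F t (y t)) (Set.Icc 0 T) t := by
  set R' : ℝ := max R 0 with hR'
  let c : ContDiffBump (0 : V) := ⟨R' + 1, R' + 2, by positivity, by linarith⟩
  set f : ℝ → V → V := fun t y => c y • F t y with hf
  have hfc : ContDiff ℝ 1 (Function.uncurry f) := by
    have h1 : ContDiff ℝ 1 (fun p : ℝ × V => c p.2) := c.contDiff.comp contDiff_snd
    exact h1.smul hF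
  have : ProperSpace V := FiniteDimensional.proper ℝ V
  obtain ⟨M, hM⟩ : ∃ M : ℝ, ∀ t ∈ Set.Icc 0 T, ∀ y, ‖f t y‖ ≤ M := by
    have hcomp : IsCompact (Set.Icc (0:ℝ) T ×ˢ Metric.closedBall (0:V) (R' + 2)) :=
      isCompact_Icc.prod (isCompact_closedBall _ _)
    obtain ⟨M, hM⟩ := hcomp.exists_bound_of_continuousOn (hfc.continuous.continuousOn)
    refine ⟨max M 0, fun t ht y => ?_⟩
    by_cases hy : ‖y‖ ≤ R' + 2
    · exact (hM (t, y) ⟨ht, by simpa using hy⟩).trans (le_max_left _ _)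
    · have : c y = 0 := c.zero_of_le_dist (by
        rw [dist_zero_right]; exact (not_le.1 hy).le)
      simp [hf, this]
  set M' : ℝ≥0 := ⟨max M 0, le_max_right _ _⟩ with hM'
  set T' : ℝ≥0 := ⟨T, hT.le⟩ with hT'
  set a : ℝ≥0 := M' * T' with ha
  obtain ⟨K, hK⟩ : ∃ K, LipschitzOnWith K (Function.uncurry f)
      (Set.Icc (0:ℝ) T ×ˢ Metric.closedBall x₀ a) :=
    hfc.contDiffOn.exists_lipschitzOnWith one_ne_zero
      ((convex_Icc _ _).prod (convex_closedBall _ _)) (isCompact_Icc.prod (isCompact_closedBall _ _))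
  have hPL : IsPicardLindelof f (⟨0, ⟨le_rfl, hT.le⟩⟩ : Set.Icc (0:ℝ) T) x₀ a 0 M' K := by
    refine ⟨fun t ht => ?_, fun x _ => ?_, fun t ht x _ => ?_, ?_⟩
    · intro x hx y hy
      have := hK (show (t, x) ∈ _ from ⟨ht, hx⟩) (show (t, y) ∈ _ from ⟨ht, hy⟩)
      simpa [Prod.edist_eq] using this
    · exact (hfc.continuous.comp (by fun_prop : Continuous fun t : ℝ => (t, x))).continuousOn
    · exact (hM t ht x).trans (le_max_left _ _)
    · simp only [sub_zero, sub_self, max_eq_left hT.le, NNReal.coe_zero, ha, NNReal.coe_mul]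
      exact le_rfl
  obtain ⟨y, hy0, hy⟩ := hPL.exists_eq_forall_mem_Icc_hasDerivWithinAt₀
  have hb := hap (fun t => c (y t)) y (fun t => ⟨c.nonneg, c.le_one⟩) hy0 hy
  refine ⟨y, hy0, fun t ht => ?_⟩
  have h1 : c (y t) = 1 := c.one_of_mem_closedBall (by
    rw [Metric.mem_closedBall, dist_zero_right]
    have := hb t ht
    have h2 : R ≤ R' := le_max_left _ _
    change ‖y t‖ ≤ R' + 1
    linarith)
  have := hy t ht
  simp only [hf, h1, one_smul] at this
  exact this

/-! ### Triple sums and the energy cancellation -/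

def TS (S : Finset Lat) (Φ : Lat → Lat → Lat → ℂ) : ℂ :=
  ∑ k ∈ S, ∑ l ∈ S, ∑ m ∈ S, if k + l + m = 0 then Φ k l m else 0

lemma TS_congr {S : Finset Lat} {Φ Ψ : Lat → Lat → Lat → ℂ}
    (h : ∀ k l m, k + l + m = 0 → Φ k l m = Ψ k l m) : TS S Φ = TS S Ψ := by
  unfold TS
  refine Finset.sum_congr rfl fun k _ => Finset.sum_congr rfl fun l _ =>
    Finset.sum_congr rfl fun m _ => ?_
  split_ifs with h0
  · exact h k l m h0
  · rfl

lemma TS_add (S : Finset Lat) (Φ Ψ : Lat → Lat → Lat → ℂ) :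
    TS S (fun k l m => Φ k l m + Ψ k l m) = TS S Φ + TS S Ψ := by
  unfold TS
  simp only [← Finset.sum_add_distrib]
  refine Finset.sum_congr rfl fun k _ => Finset.sum_congr rfl fun l _ =>
    Finset.sum_congr rfl fun m _ => ?_
  split_ifs <;> simp

lemma TS_mul (S : Finset Lat) (c : ℂ) (Φ : Lat → Lat → Lat → ℂ) :
    TS S (fun k l m => c * Φ k l m) = c * TS S Φ := by
  unfold TS
  simp only [Finset.mul_sum]
  refine Finset.sum_congr rfl fun k _ => Finset.sum_congr rfl fun l _ =>
    Finset.sum_congr rfl fun m _ => ?_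
  split_ifs <;> simp

lemma TS_swap23 (S : Finset Lat) (Φ : Lat → Lat → Lat → ℂ) :
    TS S (fun k l m => Φ k m l) = TS S Φ := by
  unfold TS
  refine Finset.sum_congr rfl fun k _ => ?_
  rw [Finset.sum_comm]
  refine Finset.sum_congr rfl fun l _ => Finset.sum_congr rfl fun m _ => ?_
  rw [add_right_comm]

lemma TS_swap12 (S : Finset Lat) (Φ : Lat → Lat → Lat → ℂ) :
    TS S (fun k l m => Φ l k m) = TS S Φ := by
  unfold TS
  rw [Finset.sum_comm]
  refine Finset.sum_congr rfl fun k _ => Finset.sum_congr rfl fun l _ =>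
    Finset.sum_congr rfl fun m _ => ?_
  rw [add_comm l k]

lemma TS_swap13 (S : Finset Lat) (Φ : Lat → Lat → Lat → ℂ) :
    TS S (fun k l m => Φ m l k) = TS S Φ := by
  rw [← TS_swap12 S Φ, ← TS_swap23 S (fun k l m => Φ l k m),
    ← TS_swap12 S (fun k l m => Φ m k l)]

lemma TS_zero_of {S : Finset Lat} {Φ Ψ : Lat → Lat → Lat → ℂ} (h1 : TS S Ψ = TS S Φ)
    (h2 : ∀ k l m, k + l + m = 0 → Φ k l m + Ψ k l m = 0) : TS S Φ = 0 := by
  have h3 : TS S Φ + TS S Ψ = 0 := by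
    rw [← TS_add, TS_congr (Ψ := fun _ _ _ => 0) h2]
    simp [TS]
  rw [h1] at h3
  linear_combination h3 / 2

lemma cast_rel {k l m : Lat} (h : k + l + m = 0) (i : Fin 3) :
    (m i : ℂ) = -(k i : ℂ) - (l i : ℂ) := by
  have : k i + l i + m i = 0 := congrFun h i
  have h2 : (k i : ℂ) + l i + m i = 0 := by exact_mod_cast this
  linear_combination h2

/-- Full integrand of the nonlinear energy rate, divided by `2πi`. -/
def PsiE (u b : Fin 3 → Lat → ℂ) (φ : Lat → ℂ) (k l m : Lat) : ℂ :=
  (∑ i, (m i : ℂ) * u i k) * (∑ j, u j l * u j m)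
  - (∑ i, (m i : ℂ) * (b i k + k i * φ k)) * (∑ j, (b j l + l j * φ l) * u j m)
  + (∑ i, (m i : ℂ) * u i k) * (∑ j, (b j l + l j * φ l) * b j m)
  - (∑ i, (m i : ℂ) * (b i k + k i * φ k)) * (∑ j, u j l * b j m)
  - (∑ i, (k i : ℂ) * k i) * φ k * (∑ j, (b j l + l j * φ l) * u j m)
  - (∑ i, (k i : ℂ) * k i) * φ k * (∑ j, u j l * b j m)

lemma TS_PsiE (S : Finset Lat) (u b : Fin 3 → Lat → ℂ) (φ : Lat → ℂ)
    (hu : ∀ k : Lat, ∑ i, (k i : ℂ) * u i k = 0) (hb : ∀ k : Lat, ∑ i, (k i : ℂ) * b i k = 0) :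
    TS S (PsiE u b φ) =
      - TS S (fun k l m => (∑ i, (k i : ℂ) * k i) * φ k * (∑ j, u j l * b j m)) := by
  -- the vanishing pieces
  have z1 : TS S (fun k l m => (∑ i, (m i : ℂ) * u i k) * (∑ j, u j l * u j m)) = 0 := by
    refine TS_zero_of (TS_swap23 S _) fun k l m h => ?_
    have h1 := hu k
    simp only [Fin.sum_univ_three, cast_rel h] at *
    linear_combination (-(u 0 l * u 0 m + u 1 l * u 1 m + u 2 l * u 2 m)) * h1
  have z2 : TS S (fun k l m => (∑ i, (m i : ℂ) * u i k) * (∑ j, b j l * b j m)) = 0 := by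
    refine TS_zero_of (TS_swap23 S _) fun k l m h => ?_
    have h1 := hu k
    simp only [Fin.sum_univ_three, cast_rel h] at *
    linear_combination (-(b 0 l * b 0 m + b 1 l * b 1 m + b 2 l * b 2 m)) * h1
  have z3 : TS S (fun k l m => (∑ i, (m i : ℂ) * b i k) * (∑ j, b j l * u j m)
      + (∑ i, (m i : ℂ) * b i k) * (∑ j, u j l * b j m)) = 0 := by
    refine TS_zero_of (TS_swap23 S _) fun k l m h => ?_
    have h1 := hb k
    simp only [Fin.sum_univ_three, cast_rel h] at *
    linear_combination (-(b 0 l * u 0 m + b 1 l * u 1 m + b 2 l * u 2 m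
      + u 0 l * b 0 m + u 1 l * b 1 m + u 2 l * b 2 m)) * h1
  have z4 : TS S (fun k l m => φ l * (∑ i, (m i : ℂ) * b i k) * (∑ j, (l j : ℂ) * u j m)
      - φ l * (∑ i, (m i : ℂ) * u i k) * (∑ j, (l j : ℂ) * b j m)) = 0 := by
    refine TS_zero_of (TS_swap13 S _) fun k l m h => ?_
    have h1 := hb k
    have h2 := hu k
    have h3 := hb m
    have h4 := hu m
    simp only [Fin.sum_univ_three, cast_rel h] at *
    linear_combination (φ l * ((l 0 : ℂ) * u 0 m + (l 1 : ℂ) * u 1 m + (l 2 : ℂ) * u 2 m)) * (-h1)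
      + (φ l * ((l 0 : ℂ) * b 0 m + (l 1 : ℂ) * b 1 m + (l 2 : ℂ) * b 2 m)) * h2
      + (φ l * ((l 0 : ℂ) * u 0 k + (l 1 : ℂ) * u 1 k + (l 2 : ℂ) * u 2 k)) * (-h3)
      + (φ l * ((l 0 : ℂ) * b 0 k + (l 1 : ℂ) * b 1 k + (l 2 : ℂ) * b 2 k)) * h4
  have z5 : TS S (fun k l m => φ k * φ l * ((∑ i, (m i : ℂ) * k i) + ∑ i, (k i : ℂ) * k i)
      * (∑ j, (l j : ℂ) * u j m)) = 0 := by
    refine TS_zero_of (TS_swap12 S _) fun k l m h => ?_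
    have h4 := hu m
    simp only [Fin.sum_univ_three, cast_rel h] at *
    linear_combination (φ k * φ l * ((l 0 : ℂ) * k 0 + (l 1 : ℂ) * k 1 + (l 2 : ℂ) * k 2)) * h4
  have z6 : TS S (fun k l m => φ k * ((∑ i, (m i : ℂ) * k i) + (∑ i, (k i : ℂ) * k i) / 2)
      * ((∑ j, b j l * u j m) + (∑ j, u j l * b j m))) = 0 := by
    refine TS_zero_of (TS_swap23 S _) fun k l m h => ?_
    simp only [Fin.sum_univ_three, cast_rel h] at *
    ring
  have z7 : TS S (fun k l m => (∑ i, (k i : ℂ) * k i) * φ k * ((∑ j, b j l * u j m)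
      - (∑ j, u j l * b j m))) = 0 := by
    refine TS_zero_of (TS_swap23 S _) fun k l m h => ?_
    simp only [Fin.sum_univ_three]
    ring
  have key : TS S (PsiE u b φ) = TS S (fun k l m =>
      ((((((((∑ i, (m i : ℂ) * u i k) * (∑ j, u j l * u j m)
      + (∑ i, (m i : ℂ) * u i k) * (∑ j, b j l * b j m))
      + (-1) * ((∑ i, (m i : ℂ) * b i k) * (∑ j, b j l * u j m)
      + (∑ i, (m i : ℂ) * b i k) * (∑ j, u j l * b j m)))
      + (-1) * (φ l * (∑ i, (m i : ℂ) * b i k) * (∑ j, (l j : ℂ) * u j m)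
      - φ l * (∑ i, (m i : ℂ) * u i k) * (∑ j, (l j : ℂ) * b j m)))
      + (-1) * (φ k * φ l * ((∑ i, (m i : ℂ) * k i) + ∑ i, (k i : ℂ) * k i)
      * (∑ j, (l j : ℂ) * u j m)))
      + (-1) * (φ k * ((∑ i, (m i : ℂ) * k i) + (∑ i, (k i : ℂ) * k i) / 2)
      * ((∑ j, b j l * u j m) + (∑ j, u j l * b j m))))
      + (-1/2) * ((∑ i, (k i : ℂ) * k i) * φ k * ((∑ j, b j l * u j m)
      - (∑ j, u j l * b j m))))
      + (-1) * ((∑ i, (k i : ℂ) * k i) * φ k * (∑ j, u j l * b j m)))) := by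
    refine TS_congr fun k l m h => ?_
    simp only [PsiE, Fin.sum_univ_three]
    ring
  rw [key, TS_add, TS_add, TS_add, TS_add, TS_add, TS_add, TS_add, TS_mul, TS_mul, TS_mul, TS_mul,
    TS_mul, TS_mul, z1, z2, z3, z4, z5, z6, z7]
  ring

/-! ### The nonlinear terms in Fourier variables -/

def NN (f g p q : Fin 3 → Lat → ℂ) (d : Lat → ℂ) (r : Fin 3 → Lat → ℂ) (j : Fin 3) (n : Lat) : ℂ :=
  -(∑ i, 2 * π * I * (n i : ℂ) * (cv (f i) (g j) n - cv (p i) (q j) n)) - cv d (r j) n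

lemma conj_two : (starRingEnd ℂ) (2:ℂ) = 2 := map_ofNat _ 2

/-- divergence of the gradient field with potential `φ` -/
def dd (φ : Lat → ℂ) (n : Lat) : ℂ := 2 * π * I * (latSq n : ℂ) * φ n

/-- full magnetic field -/
def Bf (w : Fin 2 → Fin 3 → Lat → ℂ) (φ : Lat → ℂ) (j : Fin 3) (n : Lat) : ℂ :=
  w 1 j n + (n j : ℂ) * φ n

def NL (w : Fin 2 → Fin 3 → Lat → ℂ) (φ : Lat → ℂ) (α : Fin 2) (j : Fin 3) (n : Lat) : ℂ :=
  if α = 0 then NN (w 0) (w 0) (Bf w φ) (Bf w φ) (dd φ) (Bf w φ) j n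
  else NN (w 0) (Bf w φ) (Bf w φ) (w 0) (dd φ) (w 0) j n

def RR (ν : Fin 2 → ℝ) (w : Fin 2 → Fin 3 → Lat → ℂ) (φ : Lat → ℂ) (α : Fin 2) (j : Fin 3)
    (n : Lat) : ℂ :=
  -((ν α * (4 * π ^ 2 * latSq n) : ℝ) : ℂ) * w α j n + NL w φ α j n

def lerayP (n : Lat) (v : Fin 3 → ℂ) (j : Fin 3) : ℂ :=
  v j - (n j : ℂ) * (∑ i, (n i : ℂ) * v i) / (latSq n : ℂ)

lemma latSq_cast (n : Lat) : (latSq n : ℂ) = ∑ i, (n i : ℂ) * n i := by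
  simp [latSq, sq]

lemma latSq_eq_zero {n : Lat} (h : latSq n = 0) : n = 0 := by
  unfold latSq at h
  rw [Finset.sum_eq_zero_iff_of_nonneg (fun i _ => sq_nonneg _)] at h
  funext i
  have := h i (Finset.mem_univ i)
  simpa using this

lemma lerayP_div (n : Lat) (v : Fin 3 → ℂ) : ∑ j, (n j : ℂ) * lerayP n v j = 0 := by
  by_cases h : latSq n = 0
  · rw [latSq_eq_zero h]; simp
  · have h' : (latSq n : ℂ) ≠ 0 := by exact_mod_cast h
    unfold lerayP
    have e := latSq_cast n
    simp only [Fin.sum_univ_three] at *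
    field_simp
    rw [e]; ring

lemma lerayP_of_div {n : Lat} {v : Fin 3 → ℂ} (h : ∑ i, (n i : ℂ) * v i = 0) (j : Fin 3) :
    lerayP n v j = v j := by
  simp [lerayP, h]

lemma lerayP_dot {n : Lat} {x : Fin 3 → ℂ} (h : ∑ i, (n i : ℂ) * x i = 0) (v : Fin 3 → ℂ) :
    ∑ j, x j * lerayP n v j = ∑ j, x j * v j := by
  unfold lerayP
  simp only [Fin.sum_univ_three] at *
  linear_combination (-((n 0 : ℂ) * v 0 + n 1 * v 1 + n 2 * v 2) / (latSq n : ℂ)) * h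

lemma lerayP_neg (n : Lat) (v : Fin 3 → ℂ) (j : Fin 3) : lerayP (-n) v j = lerayP n v j := by
  simp [lerayP, latSq_neg]

lemma lerayP_conj (n : Lat) (v : Fin 3 → ℂ) (j : Fin 3) :
    (starRingEnd ℂ) (lerayP n v j) = lerayP n (fun j => (starRingEnd ℂ) (v j)) j := by
  simp [lerayP, map_sum]

lemma cv_fin {S : Finset Lat} {f : Lat → ℂ} (hf : ∀ n, n ∉ S → f n = 0) (g : Lat → ℂ) (m : Lat) :
    cv f g m = ∑ k ∈ S, f k * g (m - k) := by
  unfold cv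
  exact tsum_eq_sum fun k hk => by rw [hf k hk, zero_mul]

lemma sum_cv {S : Finset Lat} {f g : Lat → ℂ} (hf : ∀ n, n ∉ S → f n = 0)
    (hg : ∀ n, n ∉ S → g n = 0) (x : Lat → ℂ) :
    ∑ m ∈ S, x m * cv f g (-m) = TS S (fun k l m => f k * g l * x m) := by
  unfold TS
  rw [Finset.sum_congr rfl fun k _ => Finset.sum_comm, Finset.sum_comm]
  refine Finset.sum_congr rfl fun m _ => ?_
  rw [cv_fin hf, Finset.mul_sum]
  refine Finset.sum_congr rfl fun k _ => ?_
  have e : ∀ l : Lat, (k + l + m = 0) ↔ (l = -m - k) := fun l => by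
    constructor
    · intro h; linear_combination h
    · rintro rfl; abel
  simp only [e, Finset.sum_ite_eq']
  split_ifs with h
  · ring
  · rw [hg _ h]; ring

lemma conj_cv {f g : Lat → ℂ} (hf : ∀ n, (starRingEnd ℂ) (f n) = f (-n))
    (hg : ∀ n, (starRingEnd ℂ) (g n) = g (-n)) (m : Lat) :
    (starRingEnd ℂ) (cv f g m) = cv f g (-m) := by
  unfold cv
  rw [Complex.conj_tsum, ← (Equiv.neg Lat).tsum_eq]
  refine tsum_congr fun k => ?_
  simp only [Equiv.neg_apply, map_mul, hf, hg]
  congr 2 <;> abel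

lemma conj_dd {φ : Lat → ℂ} (hφ : ∀ n, (starRingEnd ℂ) (φ n) = -φ (-n)) (n : Lat) :
    (starRingEnd ℂ) (dd φ n) = dd φ (-n) := by
  simp [dd, hφ, latSq_neg, conj_two]

lemma conj_Bf {w : Fin 2 → Fin 3 → Lat → ℂ} {φ : Lat → ℂ}
    (hw : ∀ α j n, (starRingEnd ℂ) (w α j n) = w α j (-n))
    (hφ : ∀ n, (starRingEnd ℂ) (φ n) = -φ (-n)) (j : Fin 3) (n : Lat) :
    (starRingEnd ℂ) (Bf w φ j n) = Bf w φ j (-n) := by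
  simp [Bf, hφ, hw]

lemma conj_NN {f g p q : Fin 3 → Lat → ℂ} {d : Lat → ℂ} {r : Fin 3 → Lat → ℂ}
    (hf : ∀ j n, (starRingEnd ℂ) (f j n) = f j (-n)) (hg : ∀ j n, (starRingEnd ℂ) (g j n) = g j (-n))
    (hp : ∀ j n, (starRingEnd ℂ) (p j n) = p j (-n)) (hq : ∀ j n, (starRingEnd ℂ) (q j n) = q j (-n))
    (hd : ∀ n, (starRingEnd ℂ) (d n) = d (-n)) (hr : ∀ j n, (starRingEnd ℂ) (r j n) = r j (-n))
    (j : Fin 3) (n : Lat) : (starRingEnd ℂ) (NN f g p q d r j n) = NN f g p q d r j (-n) := by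
  unfold NN
  simp only [map_sub, map_neg, map_sum, map_mul, conj_cv (hf _) (hg _), conj_cv (hp _) (hq _),
    conj_cv hd (hr _), Complex.conj_I, Complex.conj_ofReal, conj_two]
  simp

lemma conj_NL {w : Fin 2 → Fin 3 → Lat → ℂ} {φ : Lat → ℂ}
    (hw : ∀ α j n, (starRingEnd ℂ) (w α j n) = w α j (-n))
    (hφ : ∀ n, (starRingEnd ℂ) (φ n) = -φ (-n)) (α : Fin 2) (j : Fin 3) (n : Lat) :
    (starRingEnd ℂ) (NL w φ α j n) = NL w φ α j (-n) := by
  unfold NL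
  split_ifs
  · exact conj_NN (hw 0) (hw 0) (conj_Bf hw hφ) (conj_Bf hw hφ) (conj_dd hφ) (conj_Bf hw hφ) j n
  · exact conj_NN (hw 0) (conj_Bf hw hφ) (conj_Bf hw hφ) (hw 0) (conj_dd hφ) (hw 0) j n

lemma conj_RR {ν : Fin 2 → ℝ} {w : Fin 2 → Fin 3 → Lat → ℂ} {φ : Lat → ℂ}
    (hw : ∀ α j n, (starRingEnd ℂ) (w α j n) = w α j (-n))
    (hφ : ∀ n, (starRingEnd ℂ) (φ n) = -φ (-n)) (α : Fin 2) (j : Fin 3) (n : Lat) :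
    (starRingEnd ℂ) (RR ν w φ α j n) = RR ν w φ α j (-n) := by
  unfold RR
  rw [map_add, conj_NL hw hφ, map_mul, map_neg, Complex.conj_ofReal, hw, latSq_neg]

lemma NL_energy {S : Finset Lat} {w : Fin 2 → Fin 3 → Lat → ℂ} {φ : Lat → ℂ}
    (hs : ∀ α j n, n ∉ S → w α j n = 0) (hφ : ∀ n, n ∉ S → φ n = 0)
    (hdiv : ∀ α n, ∑ j, (n j : ℂ) * w α j n = 0) :
    ∑ m ∈ S, ∑ α, ∑ j, w α j m * NL w φ α j (-m)
      = - TS S (fun k l m => dd φ k * ∑ j, w 0 j l * w 1 j m) := by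
  have hB : ∀ j n, n ∉ S → Bf w φ j n = 0 := fun j n hn => by simp [Bf, hs _ _ _ hn, hφ _ hn]
  have hd : ∀ n, n ∉ S → dd φ n = 0 := fun n hn => by simp [dd, hφ _ hn]
  have key : ∀ (f g p q r : Fin 3 → Lat → ℂ) (x : Fin 3 → Lat → ℂ),
      (∀ j n, n ∉ S → f j n = 0) → (∀ j n, n ∉ S → g j n = 0) → (∀ j n, n ∉ S → p j n = 0) →
      (∀ j n, n ∉ S → q j n = 0) → (∀ j n, n ∉ S → r j n = 0) →
      ∑ m ∈ S, ∑ j, x j m * NN f g p q (dd φ) r j (-m)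
        = TS S (fun k l m => 2 * π * I * ((∑ i, (m i : ℂ) * f i k) * (∑ j, g j l * x j m)
          - (∑ i, (m i : ℂ) * p i k) * (∑ j, q j l * x j m)
          - (∑ i, (k i : ℂ) * k i) * φ k * (∑ j, r j l * x j m))) := by
    intro f g p q r x hf hg hp hq hr
    have e1 : ∀ m, ∑ j, x j m * NN f g p q (dd φ) r j (-m) = 
        (∑ j, ∑ i, (2 * π * I * (m i : ℂ) * x j m) * cv (f i) (g j) (-m))
        + (∑ j, ∑ i, (-(2 * π * I) * (m i : ℂ) * x j m) * cv (p i) (q j) (-m))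
        + ∑ j, (- x j m) * cv (dd φ) (r j) (-m) := by
      intro m
      unfold NN
      simp only [Fin.sum_univ_three, Pi.neg_apply, Int.cast_neg]
      ring
    simp only [e1, Finset.sum_add_distrib]
    rw [Finset.sum_comm, Finset.sum_congr rfl fun j _ => Finset.sum_comm,
      Finset.sum_comm (s := S), Finset.sum_congr rfl fun j _ => Finset.sum_comm (s := S),
      Finset.sum_comm (s := S)]
    simp only [sum_cv (hf _) (hg _), sum_cv (hp _) (hq _), sum_cv hd (hr _), Fin.sum_univ_three]
    simp only [← TS_add]
    refine TS_congr fun k l m _ => ?_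
    simp only [dd, latSq_cast, Fin.sum_univ_three]
    ring
  have e0 : ∀ m, ∑ α, ∑ j, w α j m * NL w φ α j (-m)
      = (∑ j, w 0 j m * NN (w 0) (w 0) (Bf w φ) (Bf w φ) (dd φ) (Bf w φ) j (-m))
      + ∑ j, w 1 j m * NN (w 0) (Bf w φ) (Bf w φ) (w 0) (dd φ) (w 0) j (-m) := by
    intro m
    simp [NL, Fin.sum_univ_two]
  simp only [e0, Finset.sum_add_distrib]
  rw [key _ _ _ _ _ _ (hs 0) (hs 0) hB hB hB, key _ _ _ _ _ _ (hs 0) hB hB (hs 0) (hs 0), ← TS_add]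
  have := TS_PsiE S (w 0) (w 1) φ (hdiv 0) (hdiv 1)
  calc _ = TS S (fun k l m => 2 * π * I * PsiE (w 0) (w 1) φ k l m) := by
        refine TS_congr fun k l m _ => ?_
        simp only [PsiE, Bf]
        ring
    _ = _ := by
        rw [TS_mul, this, mul_neg, ← TS_mul]
        congr 1
        refine TS_congr fun k l m _ => ?_
        rw [dd, latSq_cast]
        ring

lemma TS_bound (S : Finset Lat) (d : Lat → ℂ) (f g : Fin 3 → Lat → ℂ) :
    ‖TS S (fun k l m => d k * ∑ j, f j l * g j m)‖
      ≤ (∑ k ∈ S, ‖d k‖) * ((∑ n ∈ S, ∑ j, (‖f j n‖ ^ 2 + ‖g j n‖ ^ 2)) / 2) := by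
  unfold TS
  rw [Finset.sum_mul]
  refine (norm_sum_le _ _).trans (Finset.sum_le_sum fun k _ => ?_)
  have h1 : ∀ l m : Lat, ‖if k + l + m = 0 then d k * ∑ j, f j l * g j m else 0‖
      ≤ (if m = -k - l then ‖d k‖ * (∑ j, ‖f j l‖ ^ 2) / 2 else 0)
      + (if l = -k - m then ‖d k‖ * (∑ j, ‖g j m‖ ^ 2) / 2 else 0) := by
    intro l m
    by_cases h : k + l + m = 0
    · have e1 : m = -k - l := by linear_combination h
      have e2 : l = -k - m := by linear_combination h
      rw [if_pos h, if_pos e1, if_pos e2, norm_mul, ← add_div, ← mul_add, mul_div_assoc]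
      refine mul_le_mul_of_nonneg_left ?_ (norm_nonneg _)
      refine (norm_sum_le _ _).trans ?_
      rw [← Finset.sum_add_distrib, Finset.sum_div]
      refine Finset.sum_le_sum fun j _ => ?_
      rw [norm_mul]
      nlinarith [sq_nonneg (‖f j l‖ - ‖g j m‖)]
    · rw [if_neg h, norm_zero]
      positivity
  refine (norm_sum_le _ _).trans ((Finset.sum_le_sum fun l _ => norm_sum_le _ _).trans
    ((Finset.sum_le_sum fun l _ => Finset.sum_le_sum fun m _ => h1 l m).trans ?_))
  simp only [Finset.sum_add_distrib]
  rw [Finset.sum_comm (f := fun l m => if l = -k - m then ‖d k‖ * (∑ j, ‖g j m‖ ^ 2) / 2 else 0)]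
  simp only [Finset.sum_ite_eq']
  rw [add_div, mul_add, Finset.sum_div, Finset.sum_div, Finset.mul_sum, Finset.mul_sum]
  refine add_le_add (Finset.sum_le_sum fun l _ => ?_) (Finset.sum_le_sum fun l _ => ?_)
  all_goals
    split_ifs
    · rw [mul_div_assoc]
    · positivity

def EE (S : Finset Lat) (w : Fin 2 → Fin 3 → Lat → ℂ) : ℝ := ∑ n ∈ S, ∑ α, ∑ j, ‖w α j n‖ ^ 2

def DD (ν : Fin 2 → ℝ) (S : Finset Lat) (w : Fin 2 → Fin 3 → Lat → ℂ) : ℝ :=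
  ∑ n ∈ S, ∑ α, ∑ j, ν α * (4 * π ^ 2 * latSq n) * ‖w α j n‖ ^ 2

lemma energy_rate {ν : Fin 2 → ℝ} {S : Finset Lat} {w : Fin 2 → Fin 3 → Lat → ℂ} {φ : Lat → ℂ}
    (hS : ∀ n, -n ∈ S ↔ n ∈ S)
    (hs : ∀ α j n, n ∉ S → w α j n = 0) (hφs : ∀ n, n ∉ S → φ n = 0)
    (hdiv : ∀ α n, ∑ j, (n j : ℂ) * w α j n = 0)
    (hw : ∀ α j n, (starRingEnd ℂ) (w α j n) = w α j (-n)) :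
    ∑ n ∈ S, ∑ α, ∑ j, 2 * ((starRingEnd ℂ) (w α j n) * lerayP n (fun j => RR ν w φ α j n) j).re
      ≤ -2 * DD ν S w + (∑ k ∈ S, ‖dd φ k‖) * EE S w := by
  have e1 : ∀ n α, ∑ j, (starRingEnd ℂ) (w α j n) * lerayP n (fun j => RR ν w φ α j n) j
      = (-((∑ j, ν α * (4 * π ^ 2 * latSq n) * ‖w α j n‖ ^ 2 : ℝ) : ℂ))
        + ∑ j, w α j (-n) * NL w φ α j n := by
    intro n α
    rw [lerayP_dot]
    · simp only [RR, Fin.sum_univ_three]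
      have : ∀ j, (starRingEnd ℂ) (w α j n) * w α j n = ((‖w α j n‖ ^ 2 : ℝ) : ℂ) := fun j => by
        rw [Complex.conj_mul']; push_cast; rfl
      have h0 := this 0
      have h1 := this 1
      have h2 := this 2
      simp only [mul_add, ← hw]
      push_cast at *
      linear_combination (-(ν α * (4 * π ^ 2 * latSq n)) : ℂ) * (h0 + h1 + h2)
    · have := hdiv α (-n)
      simp only [Pi.neg_apply, Int.cast_neg, neg_mul, Finset.sum_neg_distrib, neg_eq_zero] at this
      simpa only [hw] using this
  have e2 : ∑ n ∈ S, ∑ α, ∑ j, w α j (-n) * NL w φ α j n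
      = - TS S (fun k l m => dd φ k * ∑ j, w 0 j l * w 1 j m) := by
    rw [← NL_energy hs hφs hdiv]
    refine Finset.sum_nbij' (fun n => -n) (fun n => -n) ?_ ?_ ?_ ?_ ?_
    · intro n hn; exact (hS n).2 hn
    · intro n hn; exact (hS n).2 hn
    · intro n _; simp
    · intro n _; simp
    · intro n _; simp
  have e3 : ∑ n ∈ S, ∑ α, ∑ j, 2 * ((starRingEnd ℂ) (w α j n)
      * lerayP n (fun j => RR ν w φ α j n) j).re
      = 2 * (∑ n ∈ S, ∑ α, ∑ j, (starRingEnd ℂ) (w α j n)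
      * lerayP n (fun j => RR ν w φ α j n) j).re := by
    simp only [Complex.re_sum, Finset.mul_sum]
  rw [e3]
  simp only [e1, Finset.sum_add_distrib, e2]
  have hb := TS_bound S (dd φ) (w 0) (w 1)
  have hr := Complex.abs_re_le_norm (TS S (fun k l m => dd φ k * ∑ j, w 0 j l * w 1 j m))
  have hE : ∑ n ∈ S, ∑ j, (‖w 0 j n‖ ^ 2 + ‖w 1 j n‖ ^ 2) = EE S w := by
    simp only [EE, Fin.sum_univ_two, Finset.sum_add_distrib]
  have hD : (∑ n ∈ S, ∑ α, -((∑ j, ν α * (4 * π ^ 2 * latSq n) * ‖w α j n‖ ^ 2 : ℝ) : ℂ)).re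
      = - DD ν S w := by
    simp only [DD, ← Complex.ofReal_neg, ← Complex.ofReal_sum, Complex.ofReal_re,
      Finset.sum_neg_distrib]
  rw [hE] at hb
  rw [Complex.add_re, hD, Complex.neg_re]
  have := neg_abs_le (TS S (fun k l m => dd φ k * ∑ j, w 0 j l * w 1 j m)).re
  nlinarith

/-! ### Galerkin approximations -/

lemma gron {T : ℝ} (hT : 0 < T) {E E' D g G : ℝ → ℝ} {Gm : ℝ}
    (hE : ∀ t ∈ Set.Icc 0 T, HasDerivWithinAt E (E' t) (Set.Icc 0 T) t)
    (hG : ∀ t, HasDerivAt G (g t) t) (hG0 : G 0 = 0) (hGm : ∀ t ∈ Set.Icc 0 T, G t ≤ Gm)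
    (hle : ∀ t ∈ Set.Icc 0 T, E' t ≤ -2 * D t + g t * E t) (hD : Continuous D)
    (hD0 : ∀ t, 0 ≤ D t) (hE0 : ∀ t ∈ Set.Icc 0 T, 0 ≤ E t) :
    (∀ t ∈ Set.Icc 0 T, E t ≤ E 0 * Real.exp (G t)) ∧
      2 * ∫ s in (0:ℝ)..T, D s ≤ E 0 * Real.exp Gm := by
  set Y : ℝ → ℝ := fun t => E t * Real.exp (-G t) + 2 * Real.exp (-Gm) * ∫ s in (0:ℝ)..t, D s with hY
  have hYd : ∀ t ∈ Set.Icc 0 T, HasDerivWithinAt Y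
      ((E' t * Real.exp (-G t) + E t * (Real.exp (-G t) * (-g t))) + 2 * Real.exp (-Gm) * D t)
      (Set.Icc 0 T) t := by
    intro t ht
    refine ((hE t ht).mul ((hG t).neg.exp).hasDerivWithinAt).add ?_
    exact ((intervalIntegral.integral_hasDerivAt_right (hD.intervalIntegrable _ _)
      hD.stronglyMeasurable.stronglyMeasurableAtFilter hD.continuousAt).const_mul _).hasDerivWithinAt
  have hanti : AntitoneOn Y (Set.Icc 0 T) := by
    refine antitoneOn_of_deriv_nonpos (convex_Icc _ _)
      (fun t ht => (hYd t ht).continuousWithinAt) ?_ ?_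
    · intro t ht
      exact ((hYd t (interior_subset ht)).mono interior_subset).differentiableWithinAt
    · intro t ht
      have h1 : HasDerivAt Y _ t := (hYd t (interior_subset ht)).hasDerivAt
        (mem_interior_iff_mem_nhds.1 ht)
      rw [h1.deriv]
      have ht' := interior_subset ht
      have h2 := hle t ht'
      have h3 : Real.exp (-Gm) ≤ Real.exp (-G t) := Real.exp_le_exp.2 (by linarith [hGm t ht'])
      have h4 := Real.exp_pos (-G t)
      have h5 := hD0 t
      nlinarith [mul_le_mul_of_nonneg_left h2 h4.le, mul_le_mul_of_nonneg_right h3 h5]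
  have hY0 : Y 0 = E 0 := by simp [hY, hG0]
  have h0 : (0:ℝ) ∈ Set.Icc 0 T := ⟨le_rfl, hT.le⟩
  have hIntg : ∀ t ∈ Set.Icc 0 T, 0 ≤ ∫ s in (0:ℝ)..t, D s := fun t ht =>
    intervalIntegral.integral_nonneg ht.1 fun s _ => hD0 s
  constructor
  · intro t ht
    have h1 := hanti h0 ht ht.1
    rw [hY0] at h1
    have h2 : E t * Real.exp (-G t) ≤ E 0 := by
      have : 0 ≤ 2 * Real.exp (-Gm) * ∫ s in (0:ℝ)..t, D s :=
        mul_nonneg (by positivity) (hIntg t ht)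
      simp only [hY] at h1
      linarith
    calc E t = E t * Real.exp (-G t) * Real.exp (G t) := by
          rw [mul_assoc, ← Real.exp_add]; simp
      _ ≤ _ := mul_le_mul_of_nonneg_right h2 (Real.exp_pos _).le
  · have hT' : T ∈ Set.Icc 0 T := ⟨hT.le, le_rfl⟩
    have h1 := hanti h0 hT' hT.le
    rw [hY0] at h1
    have h2 : 2 * Real.exp (-Gm) * ∫ s in (0:ℝ)..T, D s ≤ E 0 := by
      have : 0 ≤ E T * Real.exp (-G T) := mul_nonneg (hE0 T hT') (Real.exp_pos _).le
      simp only [hY] at h1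
      linarith
    calc 2 * ∫ s in (0:ℝ)..T, D s
        = (2 * Real.exp (-Gm) * ∫ s in (0:ℝ)..T, D s) * Real.exp Gm := by
          have : Real.exp (-Gm) * Real.exp Gm = 1 := by rw [← Real.exp_add]; simp
          linear_combination (-(2 * ∫ s in (0:ℝ)..T, D s)) * this
      _ ≤ _ := mul_le_mul_of_nonneg_right h2 (Real.exp_pos _).le

def lam (n : Lat) : ℝ := (1 + latSq n) ^ 3

lemma lam_pos (n : Lat) : 0 < lam n := by
  have := latSq_nonneg n
  unfold lam; positivity

def ph (φ : Lat → ℂ) (t : ℝ) (n : Lat) : ℂ := (Real.exp (-(lam n * t)) : ℂ) * φ n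

def tr (S : Finset Lat) (φ : Lat → ℂ) (n : Lat) : ℂ := if n ∈ S then φ n else 0

def GN (S : Finset Lat) (φ : Lat → ℂ) (t : ℝ) : ℝ :=
  ∑ n ∈ S, ‖dd φ n‖ * ((1 - Real.exp (-(lam n * t))) / lam n)

def GG (φ : Lat → ℂ) (t : ℝ) : ℝ := ∑' n, ‖dd φ n‖ * ((1 - Real.exp (-(lam n * t))) / lam n)

lemma GN_zero (S : Finset Lat) (φ : Lat → ℂ) : GN S φ 0 = 0 := by simp [GN]

lemma norm_dd_ph (φ : Lat → ℂ) (t : ℝ) (n : Lat) :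
    ‖dd (ph φ t) n‖ = ‖dd φ n‖ * Real.exp (-(lam n * t)) := by
  simp only [dd, ph, norm_mul, Complex.norm_real, Real.norm_eq_abs, Real.abs_exp]
  ring

lemma GN_deriv (S : Finset Lat) (φ : Lat → ℂ) (t : ℝ) :
    HasDerivAt (GN S φ) (∑ n ∈ S, ‖dd (tr S (ph φ t)) n‖) t := by
  unfold GN
  refine HasDerivAt.fun_sum fun n hn => ?_
  have e : dd (tr S (ph φ t)) n = dd (ph φ t) n := by simp [dd, tr, hn]
  rw [e, norm_dd_ph]
  refine HasDerivAt.const_mul _ ?_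
  have h1 : HasDerivAt (fun t => -(lam n * t)) (-(lam n * 1)) t :=
    ((hasDerivAt_id t).const_mul _).neg
  have := ((h1.exp).const_sub 1).div_const (lam n)
  convert this using 1
  have := (lam_pos n).ne'
  field_simp

lemma GG_term_nonneg (φ : Lat → ℂ) {t : ℝ} (ht : 0 ≤ t) (n : Lat) :
    0 ≤ ‖dd φ n‖ * ((1 - Real.exp (-(lam n * t))) / lam n) := by
  have h1 : Real.exp (-(lam n * t)) ≤ 1 := Real.exp_le_one_iff.2 (by
    have := mul_nonneg (lam_pos n).le ht
    linarith)
  have := lam_pos n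
  have : 0 ≤ 1 - Real.exp (-(lam n * t)) := by linarith
  positivity

lemma GG_term_le (φ : Lat → ℂ) {Kd : ℝ} (hK : ∀ n, ‖dd φ n‖ ≤ Kd) (t : ℝ) (n : Lat) :
    ‖dd φ n‖ * ((1 - Real.exp (-(lam n * t))) / lam n) ≤ Kd * ((1 + latSq n) ^ 3)⁻¹ := by
  have h2 := Real.exp_pos (-(lam n * t))
  have h3 := lam_pos n
  rw [div_eq_mul_inv]
  calc ‖dd φ n‖ * ((1 - Real.exp (-(lam n * t))) * (lam n)⁻¹)
      ≤ ‖dd φ n‖ * (1 * (lam n)⁻¹) := by gcongr; linarith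
    _ ≤ Kd * (1 * (lam n)⁻¹) := by gcongr; exact hK n
    _ = _ := by rw [one_mul]; rfl

lemma GG_summable (φ : Lat → ℂ) {Kd : ℝ} (hK : ∀ n, ‖dd φ n‖ ≤ Kd) {t : ℝ} (ht : 0 ≤ t) :
    Summable fun n => ‖dd φ n‖ * ((1 - Real.exp (-(lam n * t))) / lam n) :=
  Summable.of_nonneg_of_le (GG_term_nonneg φ ht) (GG_term_le φ hK t) (summable_lat3.mul_left Kd)

lemma GN_le_GG (S : Finset Lat) (φ : Lat → ℂ) {Kd : ℝ} (hK : ∀ n, ‖dd φ n‖ ≤ Kd) {t : ℝ}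
    (ht : 0 ≤ t) : GN S φ t ≤ GG φ t :=
  (GG_summable φ hK ht).sum_le_tsum _ fun n _ => GG_term_nonneg φ ht n

lemma GG_mono (φ : Lat → ℂ) {Kd : ℝ} (hK : ∀ n, ‖dd φ n‖ ≤ Kd) {s t : ℝ}
    (hs : 0 ≤ s) (hst : s ≤ t) : GG φ s ≤ GG φ t := by
  refine (GG_summable φ hK hs).tsum_le_tsum (fun n => ?_) (GG_summable φ hK (hs.trans hst))
  have h3 := lam_pos n
  gcongr

lemma GG_tendsto (φ : Lat → ℂ) {Kd : ℝ} (hK : ∀ n, ‖dd φ n‖ ≤ Kd) :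
    Tendsto (GG φ) (𝓝[>] 0) (𝓝 0) := by
  have h := tendsto_tsum_of_dominated_convergence (𝓕 := 𝓝[>] (0:ℝ))
    (f := fun t n => ‖dd φ n‖ * ((1 - Real.exp (-(lam n * t))) / lam n)) (g := fun _ => 0)
    (summable_lat3.mul_left Kd) (fun n => ?_) ?_
  · rw [tsum_zero] at h
    exact h
  · have : Tendsto (fun t : ℝ => ‖dd φ n‖ * ((1 - Real.exp (-(lam n * t))) / lam n)) (𝓝 0)
        (𝓝 (‖dd φ n‖ * ((1 - Real.exp (-(lam n * 0))) / lam n))) :=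
      Continuous.tendsto (by fun_prop) 0
    simp only [mul_zero, neg_zero, Real.exp_zero, sub_self, zero_div] at this
    exact this.mono_left nhdsWithin_le_nhds
  · filter_upwards [self_mem_nhdsWithin] with t ht n
    rw [Real.norm_of_nonneg (GG_term_nonneg φ (le_of_lt ht) n)]
    exact GG_term_le φ hK t n

lemma EE_deriv {S : Finset Lat} {w : ℝ → Fin 2 → Fin 3 → Lat → ℂ} {w' : Fin 2 → Fin 3 → Lat → ℂ}
    {c t : ℝ} {s : Set ℝ}
    (h : ∀ α j, ∀ n ∈ S, HasDerivWithinAt (fun t => w t α j n) ((c : ℂ) * w' α j n) s t) :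
    HasDerivWithinAt (fun t => EE S (w t))
      (c * ∑ n ∈ S, ∑ α, ∑ j, 2 * ((starRingEnd ℂ) (w t α j n) * w' α j n).re) s t := by
  unfold EE
  simp only [Finset.mul_sum]
  refine HasDerivWithinAt.fun_sum fun n hn => HasDerivWithinAt.fun_sum fun α _ =>
    HasDerivWithinAt.fun_sum fun j _ => ?_
  refine (h α j n hn).norm_sq.congr_deriv ?_
  rw [Complex.inner]
  have : (c * w' α j n) * (starRingEnd ℂ) (w t α j n)
      = (c : ℂ) * ((starRingEnd ℂ) (w t α j n) * w' α j n) := by ring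
  rw [this, Complex.re_ofReal_mul]
  ring

lemma contDiff_cv {P : Type*} [NormedAddCommGroup P] [NormedSpace ℝ P] {S : Finset Lat}
    {f g : P → Lat → ℂ} (hf : ∀ n, ContDiff ℝ 1 fun p => f p n) (hg : ∀ n, ContDiff ℝ 1 fun p => g p n)
    (hs : ∀ p n, n ∉ S → f p n = 0) (m : Lat) : ContDiff ℝ 1 fun p => cv (f p) (g p) m := by
  have : (fun p => cv (f p) (g p) m) = fun p => ∑ k ∈ S, f p k * g p (m - k) := by
    funext p; exact cv_fin (hs p) _ _
  rw [this]
  exact ContDiff.sum fun k _ => (hf k).mul (hg _)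

lemma contDiff_NN {P : Type*} [NormedAddCommGroup P] [NormedSpace ℝ P] {S : Finset Lat}
    {f g p q r : P → Fin 3 → Lat → ℂ} {d : P → Lat → ℂ}
    (hf : ∀ j n, ContDiff ℝ 1 fun x => f x j n) (hg : ∀ j n, ContDiff ℝ 1 fun x => g x j n)
    (hp : ∀ j n, ContDiff ℝ 1 fun x => p x j n) (hq : ∀ j n, ContDiff ℝ 1 fun x => q x j n)
    (hr : ∀ j n, ContDiff ℝ 1 fun x => r x j n) (hd : ∀ n, ContDiff ℝ 1 fun x => d x n)
    (hsf : ∀ x j n, n ∉ S → f x j n = 0) (hsp : ∀ x j n, n ∉ S → p x j n = 0)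
    (hsd : ∀ x n, n ∉ S → d x n = 0) (j : Fin 3) (n : Lat) :
    ContDiff ℝ 1 fun x => NN (f x) (g x) (p x) (q x) (d x) (r x) j n := by
  unfold NN
  refine ContDiff.sub (ContDiff.neg (ContDiff.sum fun i _ => contDiff_const.mul
    (ContDiff.sub ?_ ?_))) ?_
  · exact contDiff_cv (hf i) (hg j) (fun x => hsf x i) n
  · exact contDiff_cv (hp i) (hq j) (fun x => hsp x i) n
  · exact contDiff_cv hd (hr j) hsd n

lemma contDiff_RR {P : Type*} [NormedAddCommGroup P] [NormedSpace ℝ P] {S : Finset Lat}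
    {ν : Fin 2 → ℝ} {w : P → Fin 2 → Fin 3 → Lat → ℂ} {φ : P → Lat → ℂ}
    (hw : ∀ α j n, ContDiff ℝ 1 fun x => w x α j n) (hφ : ∀ n, ContDiff ℝ 1 fun x => φ x n)
    (hs : ∀ x α j n, n ∉ S → w x α j n = 0) (hφs : ∀ x n, n ∉ S → φ x n = 0)
    (α : Fin 2) (j : Fin 3) (n : Lat) : ContDiff ℝ 1 fun x => RR ν (w x) (φ x) α j n := by
  have hB : ∀ j n, ContDiff ℝ 1 fun x => Bf (w x) (φ x) j n := fun j n =>
    (hw 1 j n).add (contDiff_const.mul (hφ n))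
  have hsB : ∀ x j n, n ∉ S → Bf (w x) (φ x) j n = 0 := fun x j n hn => by
    simp [Bf, hs _ _ _ _ hn, hφs _ _ hn]
  have hd : ∀ n, ContDiff ℝ 1 fun x => dd (φ x) n := fun n => contDiff_const.mul (hφ n)
  have hsd : ∀ x n, n ∉ S → dd (φ x) n = 0 := fun x n hn => by simp [dd, hφs _ _ hn]
  unfold RR NL
  refine (contDiff_const.mul (hw α j n)).add ?_
  split_ifs
  · exact contDiff_NN (hw 0) (hw 0) hB hB hB hd (fun x => hs x 0) hsB hsd j n
  · exact contDiff_NN (hw 0) hB hB (hw 0) (hw 0) hd (fun x => hs x 0) hsB hsd j n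

/-! ### Existence of Galerkin solutions -/

abbrev XG (N : ℕ) := Fin 2 → Fin 3 → (box N) → ℂ

def extG {N : ℕ} (x : XG N) (α : Fin 2) (j : Fin 3) (n : Lat) : ℂ :=
  if h : n ∈ box N then x α j ⟨n, h⟩ else 0

def negG {N : ℕ} (n : box N) : box N := ⟨-n.1, box_neg.2 n.2⟩

/-- projection on conjugation-symmetric divergence-free fields -/
def PiG (N : ℕ) : XG N →ₗ[ℝ] XG N where
  toFun x α j n := lerayP n.1 (fun j => (x α j n + (starRingEnd ℂ) (x α j (negG n))) / 2) j
  map_add' x y := by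
    funext α j n
    simp only [lerayP, Pi.add_apply, map_add, Fin.sum_univ_three]
    ring
  map_smul' c x := by
    funext α j n
    simp only [lerayP, Pi.smul_apply, Complex.real_smul, map_mul, Complex.conj_ofReal,
      RingHom.id_apply, Fin.sum_univ_three]
    ring

lemma PiG_apply {N : ℕ} (x : XG N) (α : Fin 2) (j : Fin 3) (n : box N) : PiG N x α j n
    = lerayP n.1 (fun j => (x α j n + (starRingEnd ℂ) (x α j (negG n))) / 2) j := rfl

lemma negG_negG {N : ℕ} (n : box N) : negG (negG n) = n := by
  ext1; simp [negG]

lemma PiG_div {N : ℕ} (x : XG N) (α : Fin 2) (n : box N) :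
    ∑ j, (n.1 j : ℂ) * PiG N x α j n = 0 := lerayP_div _ _

lemma PiG_sym {N : ℕ} (x : XG N) (α : Fin 2) (j : Fin 3) (n : box N) :
    (starRingEnd ℂ) (PiG N x α j n) = PiG N x α j (negG n) := by
  rw [PiG_apply, PiG_apply, lerayP_conj]
  change _ = lerayP (-n.1) _ j
  rw [lerayP_neg]
  congr 1
  funext j
  rw [negG_negG]
  simp only [map_div₀, map_add, Complex.conj_conj, conj_two]
  rw [add_comm]

lemma PiG_of {N : ℕ} {x : XG N} (hs : ∀ α j n, (starRingEnd ℂ) (x α j n) = x α j (negG n)) :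
    PiG N x = fun α j n => lerayP n.1 (fun j => x α j n) j := by
  funext α j n
  rw [PiG_apply]
  congr 1
  funext j
  rw [← hs, Complex.conj_conj]
  ring

lemma PiG_idem {N : ℕ} (x : XG N) : PiG N (PiG N x) = PiG N x := by
  rw [PiG_of (PiG_sym x)]
  funext α j n
  exact lerayP_of_div (PiG_div x α n) j

lemma extG_supp {N : ℕ} (x : XG N) (α : Fin 2) (j : Fin 3) (n : Lat) (hn : n ∉ box N) :
    extG x α j n = 0 := dif_neg hn

lemma extG_div {N : ℕ} {x : XG N} (h : PiG N x = x) (α : Fin 2) (n : Lat) :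
    ∑ j, (n j : ℂ) * extG x α j n = 0 := by
  by_cases hn : n ∈ box N
  · simp only [extG, dif_pos hn]
    rw [← h]
    exact PiG_div x α ⟨n, hn⟩
  · simp [extG, hn]

lemma extG_sym {N : ℕ} {x : XG N} (h : PiG N x = x) (α : Fin 2) (j : Fin 3) (n : Lat) :
    (starRingEnd ℂ) (extG x α j n) = extG x α j (-n) := by
  by_cases hn : n ∈ box N
  · simp only [extG, dif_pos hn, dif_pos (box_neg.2 hn)]
    rw [← h]
    exact PiG_sym x α j ⟨n, hn⟩
  · simp [extG, hn, box_neg]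

lemma PiG_init {N : ℕ} {w0 : Fin 2 → Fin 3 → Lat → ℂ}
    (hsym : ∀ α j n, (starRingEnd ℂ) (w0 α j n) = w0 α j (-n))
    (hdiv : ∀ α n, ∑ j, (n j : ℂ) * w0 α j n = 0) :
    PiG N (fun α j n => w0 α j n.1) = fun α j n => w0 α j n.1 := by
  rw [PiG_of (x := fun α j n => w0 α j n.1) (fun α j n => hsym α j n.1)]
  funext α j n
  exact lerayP_of_div (hdiv α n.1) j

lemma conj_tr_ph {S : Finset Lat} (hS : ∀ n, -n ∈ S ↔ n ∈ S) {φ : Lat → ℂ}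
    (hφ : ∀ n, (starRingEnd ℂ) (φ n) = -φ (-n)) (t : ℝ) (n : Lat) :
    (starRingEnd ℂ) (tr S (ph φ t) n) = -tr S (ph φ t) (-n) := by
  unfold tr
  simp only [hS]
  split_ifs
  · simp only [ph, map_mul, Complex.conj_ofReal, hφ, lam, latSq_neg]
    ring
  · simp

set_option maxHeartbeats 1000000 in
lemma galerkin (ν : Fin 2 → ℝ) (hν : ∀ α, 0 < ν α) {T : ℝ} (hT : 0 < T) {φ : Lat → ℂ}
    (hφ : ∀ n, (starRingEnd ℂ) (φ n) = -φ (-n)) {Kd : ℝ} (hK : ∀ n, ‖dd φ n‖ ≤ Kd)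
    {w0 : Fin 2 → Fin 3 → Lat → ℂ} (hsym : ∀ α j n, (starRingEnd ℂ) (w0 α j n) = w0 α j (-n))
    (hdiv : ∀ α n, ∑ j, (n j : ℂ) * w0 α j n = 0) (N : ℕ) :
    ∃ w : ℝ → Fin 2 → Fin 3 → Lat → ℂ,
      (∀ α j n, Continuous fun t => w t α j n) ∧
      (∀ t α j n, n ∉ box N → w t α j n = 0) ∧
      (∀ t α j n, (starRingEnd ℂ) (w t α j n) = w t α j (-n)) ∧
      (∀ t α n, ∑ j, (n j : ℂ) * w t α j n = 0) ∧
      (∀ α j, ∀ n ∈ box N, w 0 α j n = w0 α j n) ∧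
      (∀ t ∈ Set.Icc 0 T, ∀ α j, ∀ n ∈ box N, HasDerivWithinAt (fun t => w t α j n)
        (lerayP n (fun j => RR ν (w t) (tr (box N) (ph φ t)) α j n) j) (Set.Icc 0 T) t) ∧
      (∀ t ∈ Set.Icc 0 T, EE (box N) (w t) ≤ EE (box N) w0 * Real.exp (GG φ t)) ∧
      2 * ∫ t in (0:ℝ)..T, DD ν (box N) (w t) ≤ EE (box N) w0 * Real.exp (GG φ T) := by
  have hS : ∀ n, -n ∈ box N ↔ n ∈ box N := fun n => box_neg
  set φN : ℝ → Lat → ℂ := fun t => tr (box N) (ph φ t) with hφN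
  have hφNs : ∀ t n, n ∉ box N → φN t n = 0 := fun t n hn => by simp [hφN, tr, hn]
  have hφNc : ∀ n, ContDiff ℝ 1 fun t => φN t n := by
    intro n
    simp only [hφN, tr, ph]
    split_ifs
    · exact (Complex.ofRealCLM.contDiff.comp (Real.contDiff_exp.comp (by fun_prop :
        ContDiff ℝ 1 fun t : ℝ => -(lam n * t)))).mul contDiff_const
    · exact contDiff_const
  set Q : XG N →L[ℝ] XG N := LinearMap.toContinuousLinearMap (PiG N) with hQ
  have hQe : ∀ x, Q x = PiG N x := fun x => rfl
  have hQi : ∀ x, Q (Q x) = Q x := fun x => PiG_idem x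
  clear_value Q
  set F0 : ℝ → XG N → XG N := fun t x α j n => RR ν (extG x) (φN t) α j n.1 with hF0
  have hextc : ∀ α j n, ContDiff ℝ 1 fun x : XG N => extG x α j n := by
    intro α j n
    unfold extG
    split_ifs with h
    · fun_prop
    · exact contDiff_const
  have hF0c : ContDiff ℝ 1 (fun p : ℝ × XG N => F0 p.1 p.2) := by
    rw [contDiff_pi]; intro α
    rw [contDiff_pi]; intro j
    rw [contDiff_pi]; intro n
    exact contDiff_RR (S := box N) (fun α j n => (hextc α j n).comp contDiff_snd)
      (fun n => (hφNc n).comp contDiff_fst) (fun x => extG_supp x.2) (fun x => hφNs x.1) α j n.1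
  clear_value F0
  set F : ℝ → XG N → XG N := fun t x => Q (F0 t (Q x)) with hF
  have hFc : ContDiff ℝ 1 (Function.uncurry F) := by
    have h1 : ContDiff ℝ 1 (fun p : ℝ × XG N => (p.1, Q p.2)) :=
      contDiff_fst.prodMk (Q.contDiff.comp contDiff_snd)
    have h2 : ContDiff ℝ 1 (fun p : ℝ × XG N => F0 p.1 (Q p.2)) := hF0c.comp h1
    exact Q.contDiff.comp h2
  set x₀ : XG N := fun α j n => w0 α j n.1 with hx₀
  have hQx₀ : Q x₀ = x₀ := by
    rw [hQe]
    exact PiG_init hsym hdiv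
  have hEx₀ : EE (box N) (extG x₀) = EE (box N) w0 := by
    unfold EE
    refine Finset.sum_congr rfl fun n hn => ?_
    simp [extG, hn, hx₀]
  -- invariance
  have hinv : ∀ (χ : ℝ → ℝ) (y : ℝ → XG N), y 0 = x₀ →
      (∀ t ∈ Set.Icc 0 T, HasDerivWithinAt y (χ t • F t (y t)) (Set.Icc 0 T) t) →
      ∀ t ∈ Set.Icc 0 T, Q (y t) = y t := by
    intro χ y hy0 hy t ht
    have hd : ∀ s ∈ Set.Icc 0 T, HasDerivWithinAt (fun s => Q (y s) - y s) 0 (Set.Icc 0 T) s := by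
      intro s hs
      have h1 := (Q.hasFDerivAt.comp_hasDerivWithinAt s (hy s hs)).sub (hy s hs)
      refine h1.congr_deriv ?_
      simp only [hF, map_smul, hQi, sub_self]
    have := constant_of_has_deriv_right_zero (fun s hs => (hd s hs).continuousWithinAt)
      (fun s hs => by
        have := hd s (Set.Ico_subset_Icc_self hs)
        exact this.mono_of_mem_nhdsWithin (Icc_mem_nhdsGE_of_mem hs)) t ht
    rw [hy0, hQx₀, sub_self] at this
    exact sub_eq_zero.1 this
  have hcoord : ∀ (χ : ℝ → ℝ) (y : ℝ → XG N), y 0 = x₀ →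
      (∀ t ∈ Set.Icc 0 T, HasDerivWithinAt y (χ t • F t (y t)) (Set.Icc 0 T) t) →
      ∀ t ∈ Set.Icc 0 T, ∀ α j, ∀ n ∈ box N, HasDerivWithinAt (fun t => extG (y t) α j n)
        ((χ t : ℂ) * lerayP n (fun j => RR ν (extG (y t)) (φN t) α j n) j) (Set.Icc 0 T) t := by
    intro χ y hy0 hy t ht α j n hn
    have h1 := hasDerivWithinAt_pi.1 (hasDerivWithinAt_pi.1 (hasDerivWithinAt_pi.1 (hy t ht) α) j)
      ⟨n, hn⟩
    have hP := hinv χ y hy0 hy t ht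
    have hP' : PiG N (y t) = y t := by rw [← hQe]; exact hP
    have e1 : (fun t => extG (y t) α j n) = fun t => y t α j ⟨n, hn⟩ := by
      funext t; simp [extG, hn]
    rw [e1]
    refine h1.congr_deriv ?_
    simp only [Pi.smul_apply, Complex.real_smul, hF, hP]
    congr 1
    have := PiG_of (N := N) (x := fun α j n => RR ν (extG (y t)) (φN t) α j n.1)
      (fun α j n => conj_RR (extG_sym hP') (conj_tr_ph hS hφ t) α j n.1)
    rw [hQe, hF0]
    exact congrFun (congrFun (congrFun this α) j) ⟨n, hn⟩
  have hrate : ∀ (χ : ℝ → ℝ) (y : ℝ → XG N), y 0 = x₀ →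
      (∀ t ∈ Set.Icc 0 T, HasDerivWithinAt y (χ t • F t (y t)) (Set.Icc 0 T) t) →
      ∀ t ∈ Set.Icc 0 T, HasDerivWithinAt (fun t => EE (box N) (extG (y t))) (χ t *
        ∑ n ∈ box N, ∑ α, ∑ j, 2 * ((starRingEnd ℂ) (extG (y t) α j n) *
          lerayP n (fun j => RR ν (extG (y t)) (φN t) α j n) j).re) (Set.Icc 0 T) t :=
    fun χ y hy0 hy t ht => EE_deriv (hcoord χ y hy0 hy t ht)
  have hle : ∀ (χ : ℝ → ℝ) (y : ℝ → XG N), y 0 = x₀ →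
      (∀ t ∈ Set.Icc 0 T, HasDerivWithinAt y (χ t • F t (y t)) (Set.Icc 0 T) t) →
      ∀ t ∈ Set.Icc 0 T, ∑ n ∈ box N, ∑ α, ∑ j, 2 * ((starRingEnd ℂ) (extG (y t) α j n) *
          lerayP n (fun j => RR ν (extG (y t)) (φN t) α j n) j).re
        ≤ -2 * DD ν (box N) (extG (y t)) + (∑ k ∈ box N, ‖dd (φN t) k‖) * EE (box N) (extG (y t)) := by
    intro χ y hy0 hy t ht
    have hP : PiG N (y t) = y t := by rw [← hQe]; exact hinv χ y hy0 hy t ht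
    exact energy_rate hS (extG_supp _) (hφNs t) (extG_div hP) (extG_sym hP)
  have hEn : ∀ w, 0 ≤ EE (box N) w := fun w => by unfold EE; positivity
  have hDn : ∀ w, 0 ≤ DD ν (box N) w := fun w => by
    unfold DD
    refine Finset.sum_nonneg fun n _ => Finset.sum_nonneg fun α _ => Finset.sum_nonneg fun j _ => ?_
    have := latSq_nonneg n
    have := (hν α).le
    positivity
  have hGm : ∀ t ∈ Set.Icc 0 T, GN (box N) φ t ≤ GG φ T := fun t ht =>
    (GN_le_GG _ φ hK ht.1).trans (GG_mono φ hK ht.1 ht.2)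
  -- apply the ODE lemma
  obtain ⟨y, hy0, hy⟩ := ode_exists F hFc hT x₀ (Real.sqrt (EE (box N) w0 * Real.exp (GG φ T))) (by
    intro χ y hχ hy0 hy t ht
    have h1 := (gron hT (D := fun _ => 0) (hrate χ y hy0 hy) (GN_deriv (box N) φ) (GN_zero _ _) hGm
      (fun s hs => by
        have h2 := hle χ y hy0 hy s hs
        have h3 := hDn (extG (y s))
        have h4 : 0 ≤ (∑ k ∈ box N, ‖dd (φN s) k‖) * EE (box N) (extG (y s)) :=
          mul_nonneg (Finset.sum_nonneg fun _ _ => norm_nonneg _) (hEn _)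
        have h5 := hχ s
        calc _ ≤ χ s * ((∑ k ∈ box N, ‖dd (φN s) k‖) * EE (box N) (extG (y s))) :=
              mul_le_mul_of_nonneg_left (by linarith) h5.1
          _ ≤ 1 * ((∑ k ∈ box N, ‖dd (φN s) k‖) * EE (box N) (extG (y s))) :=
              mul_le_mul_of_nonneg_right h5.2 h4
          _ = _ := by simp [hφN])
      continuous_const (fun _ => le_rfl) (fun s _ => hEn _)).1 t ht
    rw [hy0, hEx₀] at h1
    have h2 : EE (box N) (extG (y t)) ≤ EE (box N) w0 * Real.exp (GG φ T) :=
      h1.trans (mul_le_mul_of_nonneg_left (Real.exp_le_exp.2 (hGm t ht)) (hEn _))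
    refine (pi_norm_le_iff_of_nonneg (Real.sqrt_nonneg _)).2 fun α =>
      (pi_norm_le_iff_of_nonneg (Real.sqrt_nonneg _)).2 fun j =>
      (pi_norm_le_iff_of_nonneg (Real.sqrt_nonneg _)).2 fun n => ?_
    refine Real.le_sqrt_of_sq_le (le_trans ?_ h2)
    have e1 : y t α j n = extG (y t) α j n.1 := by simp [extG]
    rw [e1]
    unfold EE
    refine le_trans ?_ (Finset.single_le_sum (f := fun n => ∑ α, ∑ j, ‖extG (y t) α j n‖ ^ 2)
      (fun _ _ => by positivity) n.2)
    refine le_trans ?_ (Finset.single_le_sum (f := fun α => ∑ j, ‖extG (y t) α j n.1‖ ^ 2)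
      (fun _ _ => by positivity) (Finset.mem_univ α))
    exact Finset.single_le_sum (f := fun j => ‖extG (y t) α j n.1‖ ^ 2)
      (fun _ _ => by positivity) (Finset.mem_univ j))
  have hy' : ∀ t ∈ Set.Icc 0 T, HasDerivWithinAt y (((fun _ => 1 : ℝ → ℝ) t) • F t (y t))
      (Set.Icc 0 T) t := fun t ht => by simpa using hy t ht
  set pr : ℝ → ℝ := fun t => Set.projIcc 0 T hT.le t with hpr
  have hprm : ∀ t, pr t ∈ Set.Icc 0 T := fun t => (Set.projIcc 0 T hT.le t).2
  have hpr1 : ∀ t ∈ Set.Icc 0 T, pr t = t := fun t ht => by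
    simp only [hpr, Set.projIcc_of_mem hT.le ht]
  have hyc : Continuous fun t => y (pr t) := by
    have h1 : ContinuousOn y (Set.Icc 0 T) := fun t ht => (hy t ht).continuousWithinAt
    exact h1.comp_continuous (continuous_subtype_val.comp continuous_projIcc) hprm
  have hwc : ∀ α j n, Continuous fun t => extG (y (pr t)) α j n := fun α j n =>
    (hextc α j n).continuous.comp hyc
  have h0 : (0:ℝ) ∈ Set.Icc 0 T := ⟨le_rfl, hT.le⟩
  have hDc : Continuous fun t => DD ν (box N) (extG (y (pr t))) := by
    unfold DD
    refine continuous_finsetSum _ fun n _ => continuous_finsetSum _ fun α _ =>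
      continuous_finsetSum _ fun j _ => continuous_const.mul ((hwc α j n).norm.pow 2)
  have hEd := gron hT (D := fun t => DD ν (box N) (extG (y (pr t)))) (hrate _ y hy0 hy')
    (GN_deriv (box N) φ) (GN_zero _ _) hGm (fun s hs => by
      have h2 := hle _ y hy0 hy' s hs
      rw [hpr1 s hs, one_mul]
      exact h2) hDc (fun _ => hDn _) (fun _ _ => hEn _)
  rw [hy0, hEx₀] at hEd
  have hP : ∀ t, PiG N (y (pr t)) = y (pr t) := fun t => by
    rw [← hQe]; exact hinv _ y hy0 hy' _ (hprm t)
  refine ⟨fun t => extG (y (pr t)), hwc, fun t => extG_supp _, fun t => extG_sym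
    (hP t), fun t => extG_div (hP t), ?_, ?_, ?_, hEd.2⟩
  · intro α j n hn
    simp only [hpr1 0 h0, hy0, extG, hn, dif_pos, hx₀]
  · intro t ht α j n hn
    have h1 := hcoord _ y hy0 hy' t ht α j n hn
    rw [Complex.ofReal_one, one_mul] at h1
    beta_reduce
    rw [hpr1 t ht]
    exact h1.congr (fun s hs => by rw [hpr1 s hs]) (by rw [hpr1 t ht])
  · intro t ht
    have h1 := hEd.1 t ht
    beta_reduce
    rw [hpr1 t ht]
    exact h1.trans (mul_le_mul_of_nonneg_left (Real.exp_le_exp.2 (GN_le_GG _ φ hK ht.1)) (hEn _))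

/-! ### Convergence of convolutions -/

def L2b (K : ℝ) (f : Lat → ℂ) : Prop := ∀ s : Finset Lat, ∑ n ∈ s, ‖f n‖ ^ 2 ≤ K

lemma L2b.nonneg {K : ℝ} {f : Lat → ℂ} (h : L2b K f) : 0 ≤ K := by simpa using h ∅

lemma L2b.summable {K : ℝ} {f : Lat → ℂ} (h : L2b K f) : Summable fun n => ‖f n‖ ^ 2 :=
  summable_of_sum_le (fun _ => by positivity) h

lemma L2b.tsum_le {K : ℝ} {f : Lat → ℂ} (h : L2b K f) : ∑' n, ‖f n‖ ^ 2 ≤ K :=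
  Real.tsum_le_of_sum_le (fun _ => by positivity) h

lemma L2b.norm_sq_le {K : ℝ} {f : Lat → ℂ} (h : L2b K f) (n : Lat) : ‖f n‖ ^ 2 ≤ K := by
  simpa using h {n}

lemma L2b.norm_le {K : ℝ} {f : Lat → ℂ} (h : L2b K f) (n : Lat) : ‖f n‖ ≤ Real.sqrt K :=
  Real.le_sqrt_of_sq_le (h.norm_sq_le n)

lemma L2b.etsum_le {K : ℝ} {f : Lat → ℂ} (h : L2b K f) :
    ∑' n, ENNReal.ofReal (‖f n‖ ^ 2) ≤ ENNReal.ofReal K := by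
  rw [ENNReal.tsum_eq_iSup_sum]
  refine iSup_le fun s => ?_
  rw [← ENNReal.ofReal_sum_of_nonneg fun _ _ => by positivity]
  exact ENNReal.ofReal_le_ofReal (h s)

lemma L2b.mono {K : ℝ} {f g : Lat → ℂ} (h : L2b K g) (hfg : ∀ n, ‖f n‖ ≤ ‖g n‖) : L2b K f :=
  fun s => (Finset.sum_le_sum fun n _ => by have := hfg n; gcongr).trans (h s)

lemma L2b.mono' {K K' : ℝ} {f : Lat → ℂ} (h : L2b K f) (hfg : K ≤ K') : L2b K' f :=
  fun s => (h s).trans hfg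

lemma L2b.add {K K' : ℝ} {f g : Lat → ℂ} (hf : L2b K f) (hg : L2b K' g) :
    L2b (2 * K + 2 * K') (fun n => f n + g n) := by
  intro s
  calc ∑ n ∈ s, ‖f n + g n‖ ^ 2 ≤ ∑ n ∈ s, (2 * ‖f n‖ ^ 2 + 2 * ‖g n‖ ^ 2) := by
        refine Finset.sum_le_sum fun n _ => ?_
        have := norm_add_le (f n) (g n)
        have h0 := norm_nonneg (f n + g n)
        nlinarith [sq_nonneg (‖f n‖ - ‖g n‖)]
    _ = 2 * ∑ n ∈ s, ‖f n‖ ^ 2 + 2 * ∑ n ∈ s, ‖g n‖ ^ 2 := by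
        rw [Finset.sum_add_distrib, Finset.mul_sum, Finset.mul_sum]
    _ ≤ _ := by linarith [hf s, hg s]

lemma cv_bound_term (f g : Lat → ℂ) (m k : Lat) :
    ‖f k * g (m - k)‖ ≤ (‖f k‖ ^ 2 + ‖g (m - k)‖ ^ 2) / 2 := by
  rw [norm_mul]
  nlinarith [sq_nonneg (‖f k‖ - ‖g (m - k)‖)]

lemma shift_summable {K : ℝ} {g : Lat → ℂ} (hg : L2b K g) (m : Lat) :
    Summable fun k => ‖g (m - k)‖ ^ 2 :=
  (Equiv.subLeft m).summable_iff.2 hg.summable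

lemma cv_bound_summable {K K' : ℝ} {f g : Lat → ℂ} (hf : L2b K f) (hg : L2b K' g) (m : Lat) :
    Summable fun k => (‖f k‖ ^ 2 + ‖g (m - k)‖ ^ 2) / 2 :=
  (hf.summable.add (shift_summable hg m)).div_const 2

lemma cv_summable {K K' : ℝ} {f g : Lat → ℂ} (hf : L2b K f) (hg : L2b K' g) (m : Lat) :
    Summable fun k => f k * g (m - k) :=
  Summable.of_norm_bounded (cv_bound_summable hf hg m) (cv_bound_term f g m)

lemma norm_cv_le {K K' : ℝ} {f g : Lat → ℂ} (hf : L2b K f) (hg : L2b K' g) (m : Lat) :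
    ‖cv f g m‖ ≤ (K + K') / 2 := by
  unfold cv
  refine (tsum_of_norm_bounded (cv_bound_summable hf hg m).hasSum (cv_bound_term f g m)).trans ?_
  rw [tsum_div_const, (hf.summable).tsum_add (shift_summable hg m)]
  have h1 : ∑' k, ‖g (m - k)‖ ^ 2 = ∑' k, ‖g k‖ ^ 2 := (Equiv.subLeft m).tsum_eq fun k => ‖g k‖ ^ 2
  rw [h1]
  linarith [hf.tsum_le, hg.tsum_le]

lemma cv_add_right {K K' K'' : ℝ} {f g h : Lat → ℂ} (hf : L2b K f) (hg : L2b K' g) (hh : L2b K'' h)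
    (m : Lat) : cv f (fun n => g n + h n) m = cv f g m + cv f h m := by
  unfold cv
  rw [← (cv_summable hf hg m).tsum_add (cv_summable hf hh m)]
  exact tsum_congr fun k => by ring

lemma cv_tail {K K' : ℝ} {f g : Lat → ℂ} (hf : L2b K f) (hg : L2b K' g) (m : Lat) {M : ℕ}
    (hM : 0 < M) : ‖cv f g m - ∑ k ∈ box M, f k * g (m - k)‖ₑ ≤ ENNReal.ofReal (1 / M) *
      ((∑' k, ENNReal.ofReal (latSq k * ‖f k‖ ^ 2)) + ENNReal.ofReal K') := by
  have hs := cv_summable hf hg m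
  have e1 : cv f g m - ∑ k ∈ box M, f k * g (m - k)
      = ∑' k, if k ∈ box M then 0 else f k * g (m - k) := by
    have h1 : Summable fun k => if k ∈ box M then f k * g (m - k) else 0 :=
      summable_of_ne_finset_zero (s := box M) fun k hk => by simp [hk]
    have h2 : ∑' k, (if k ∈ box M then f k * g (m - k) else 0) = ∑ k ∈ box M, f k * g (m - k) := by
      rw [tsum_eq_sum (s := box M) fun k hk => by simp [hk]]
      exact Finset.sum_congr rfl fun k hk => by simp [hk]
    rw [← h2]
    unfold cv
    rw [← hs.tsum_sub h1]
    exact tsum_congr fun k => by split_ifs <;> simp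
  have hle : ∀ k, ‖if k ∈ box M then 0 else f k * g (m - k)‖ₑ ≤ ENNReal.ofReal (1 / M) *
      (ENNReal.ofReal (latSq k * ‖f k‖ ^ 2) + ENNReal.ofReal (‖g (m - k)‖ ^ 2)) := by
    intro k
    have hl := latSq_nonneg k
    split_ifs with h
    · simp
    · rw [← ENNReal.ofReal_add (by positivity) (by positivity),
        ← ENNReal.ofReal_mul (by positivity), ← ofReal_norm]
      refine ENNReal.ofReal_le_ofReal ?_
      rw [norm_mul]
      have h2 := latSq_of_not_mem_box h
      have hM' : (0:ℝ) < M := by exact_mod_cast hM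
      rw [div_mul_eq_mul_div, one_mul, le_div_iff₀ hM']
      have h3 : (M:ℝ) ^ 2 * ‖f k‖ ^ 2 ≤ latSq k * ‖f k‖ ^ 2 := by gcongr
      nlinarith [sq_nonneg ((M:ℝ) * ‖f k‖ - ‖g (m - k)‖), norm_nonneg (f k), norm_nonneg (g (m - k)),
        mul_nonneg (norm_nonneg (f k)) (norm_nonneg (g (m - k)))]
  rw [e1]
  refine (enorm_tsum_le_tsum_enorm).trans ((ENNReal.tsum_le_tsum hle).trans ?_)
  rw [ENNReal.tsum_mul_left, ENNReal.tsum_add]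
  have h1 : ∑' k, ENNReal.ofReal (‖g (m - k)‖ ^ 2) = ∑' k, ENNReal.ofReal (‖g k‖ ^ 2) :=
    (Equiv.subLeft m).tsum_eq fun k => ENNReal.ofReal (‖g k‖ ^ 2)
  rw [h1]
  gcongr
  exact hg.etsum_le

structure Good (T K : ℝ) (H : ℝ≥0∞) (f : ℝ → Lat → ℂ) : Prop where
  meas : ∀ n, Measurable fun t => f t n
  l2 : ∀ t ∈ Set.Ioo 0 T, L2b K (f t)
  h1 : ∫⁻ t in Set.Ioo 0 T, ∑' n, ENNReal.ofReal (latSq n * ‖f t n‖ ^ 2) ≤ H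

lemma Good.mono {T K : ℝ} {H : ℝ≥0∞} {f g : ℝ → Lat → ℂ} (hg : Good T K H g)
    (hm : ∀ n, Measurable fun t => f t n) (h : ∀ t ∈ Set.Ioo 0 T, ∀ n, ‖f t n‖ ≤ ‖g t n‖) :
    Good T K H f := by
  refine ⟨hm, fun t ht => (hg.l2 t ht).mono (h t ht), le_trans ?_ hg.h1⟩
  refine setLIntegral_mono' measurableSet_Ioo fun t ht => ENNReal.tsum_le_tsum fun n =>
    ENNReal.ofReal_le_ofReal ?_
  have := h t ht n
  have := latSq_nonneg n
  gcongr

lemma Good.mono' {T K K' : ℝ} {H H' : ℝ≥0∞} {f : ℝ → Lat → ℂ} (hg : Good T K H f)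
    (hK : K ≤ K') (hH : H ≤ H') : Good T K' H' f :=
  ⟨hg.meas, fun t ht => (hg.l2 t ht).mono' hK, hg.h1.trans hH⟩

lemma Good.add {T K K' : ℝ} {H H' : ℝ≥0∞} {f g : ℝ → Lat → ℂ} (hf : Good T K H f)
    (hg : Good T K' H' g) : Good T (2 * K + 2 * K') (2 * H + 2 * H') (fun t n => f t n + g t n) := by
  refine ⟨fun n => (hf.meas n).add (hg.meas n), fun t ht => (hf.l2 t ht).add (hg.l2 t ht), ?_⟩
  have hm : ∀ {f : ℝ → Lat → ℂ}, (∀ n, Measurable fun t => f t n) →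
      Measurable fun t => ∑' n, ENNReal.ofReal (latSq n * ‖f t n‖ ^ 2) := fun h =>
    Measurable.tsum fun n => ((((h n).norm).pow_const 2).const_mul _).ennreal_ofReal
  calc ∫⁻ t in Set.Ioo 0 T, ∑' n, ENNReal.ofReal (latSq n * ‖f t n + g t n‖ ^ 2)
      ≤ ∫⁻ t in Set.Ioo 0 T, (2 * (∑' n, ENNReal.ofReal (latSq n * ‖f t n‖ ^ 2))
        + 2 * ∑' n, ENNReal.ofReal (latSq n * ‖g t n‖ ^ 2)) := by
        refine lintegral_mono fun t => ?_
        rw [← ENNReal.tsum_mul_left, ← ENNReal.tsum_mul_left, ← ENNReal.tsum_add]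
        refine ENNReal.tsum_le_tsum fun n => ?_
        have hl := latSq_nonneg n
        have e2 : (2:ℝ≥0∞) = ENNReal.ofReal 2 := by simp
        rw [e2, ← ENNReal.ofReal_mul (by norm_num), ← ENNReal.ofReal_mul (by norm_num),
          ← ENNReal.ofReal_add (by positivity) (by positivity)]
        refine ENNReal.ofReal_le_ofReal ?_
        have h2 : ‖f t n + g t n‖ ^ 2 ≤ 2 * ‖f t n‖ ^ 2 + 2 * ‖g t n‖ ^ 2 := by
          have := norm_add_le (f t n) (g t n)
          have h0 := norm_nonneg (f t n + g t n)
          nlinarith [sq_nonneg (‖f t n‖ - ‖g t n‖)]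
        nlinarith [mul_le_mul_of_nonneg_left h2 hl]
    _ = 2 * (∫⁻ t in Set.Ioo 0 T, ∑' n, ENNReal.ofReal (latSq n * ‖f t n‖ ^ 2))
        + 2 * ∫⁻ t in Set.Ioo 0 T, ∑' n, ENNReal.ofReal (latSq n * ‖g t n‖ ^ 2) := by
        rw [lintegral_add_left ((hm hf.meas).const_mul _), lintegral_const_mul _ (hm hf.meas),
          lintegral_const_mul _ (hm hg.meas)]
    _ ≤ _ := by gcongr; exacts [hf.h1, hg.h1]

/-- measurability (on the interval) of convolutions -/
lemma Good.aesm_cv {T K K' : ℝ} {H H' : ℝ≥0∞} {f g : ℝ → Lat → ℂ} (hf : Good T K H f)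
    (hg : Good T K' H' g) (m : Lat) :
    AEStronglyMeasurable (fun t => cv (f t) (g t) m) (volume.restrict (Set.Ioo 0 T)) := by
  refine aestronglyMeasurable_of_tendsto_ae (u := (atTop : Filter (Finset Lat)))
    (f := fun s t => ∑ k ∈ s, f t k * g t (m - k)) (fun s => ?_) ?_
  · exact (Finset.measurable_fun_sum s fun k _ =>
      (hf.meas k).mul (hg.meas (m - k))).aestronglyMeasurable
  · filter_upwards [ae_restrict_mem measurableSet_Ioo] with t ht
    exact (cv_summable (hf.l2 t ht) (hg.l2 t ht) m).hasSum

lemma Good.int_cv {T K K' : ℝ} {H H' : ℝ≥0∞} {f g : ℝ → Lat → ℂ} (hf : Good T K H f)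
    (hg : Good T K' H' g) (m : Lat) :
    IntegrableOn (fun t => cv (f t) (g t) m) (Set.Ioo 0 T) := by
  refine ⟨hf.aesm_cv hg m, HasFiniteIntegral.of_bounded (C := (K + K') / 2) ?_⟩
  filter_upwards [ae_restrict_mem measurableSet_Ioo] with t ht
  exact norm_cv_le (hf.l2 t ht) (hg.l2 t ht) m

lemma Good.tail {T K K' : ℝ} {H H' : ℝ≥0∞} {f g : ℝ → Lat → ℂ} (hf : Good T K H f)
    (hg : Good T K' H' g) (m : Lat) {M : ℕ} (hM : 0 < M) :
    ∫⁻ t in Set.Ioo 0 T, ‖cv (f t) (g t) m - ∑ k ∈ box M, f t k * g t (m - k)‖ₑ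
      ≤ ENNReal.ofReal (1 / M) * (H + ENNReal.ofReal K' * ENNReal.ofReal T) := by
  calc _ ≤ ∫⁻ t in Set.Ioo 0 T, ENNReal.ofReal (1 / M) *
      ((∑' k, ENNReal.ofReal (latSq k * ‖f t k‖ ^ 2)) + ENNReal.ofReal K') :=
        setLIntegral_mono' measurableSet_Ioo fun t ht => cv_tail (hf.l2 t ht) (hg.l2 t ht) m hM
    _ = ENNReal.ofReal (1 / M) * ((∫⁻ t in Set.Ioo 0 T,
        (∑' k, ENNReal.ofReal (latSq k * ‖f t k‖ ^ 2))) + ENNReal.ofReal K' * ENNReal.ofReal T) := by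
        have hm : Measurable fun t => ∑' n, ENNReal.ofReal (latSq n * ‖f t n‖ ^ 2) :=
          Measurable.tsum fun n =>
            ((((hf.meas n).norm).pow_const 2).const_mul _).ennreal_ofReal
        rw [lintegral_const_mul' _ _ ENNReal.ofReal_ne_top, lintegral_add_left hm]
        simp
    _ ≤ _ := by gcongr; exact hf.h1

lemma cv_L1 {T K : ℝ} {H : ℝ≥0∞} (hH : H ≠ ∞) {f g : ℝ → Lat → ℂ}
    {fN gN : ℕ → ℝ → Lat → ℂ} (hf : Good T K H f) (hg : Good T K H g)
    (hfN : ∀ N, Good T K H (fN N)) (hgN : ∀ N, Good T K H (gN N))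
    (hfl : ∀ t ∈ Set.Ioo 0 T, ∀ n, Tendsto (fun N => fN N t n) atTop (𝓝 (f t n)))
    (hgl : ∀ t ∈ Set.Ioo 0 T, ∀ n, Tendsto (fun N => gN N t n) atTop (𝓝 (g t n))) (m : Lat) :
    Tendsto (fun N => ∫⁻ t in Set.Ioo 0 T, ‖cv (fN N t) (gN N t) m - cv (f t) (g t) m‖ₑ) atTop
      (𝓝 0) := by
  set C : ℝ≥0∞ := H + ENNReal.ofReal K * ENNReal.ofReal T with hC
  have hCt : C ≠ ∞ := by simp [hC, hH, ENNReal.mul_eq_top]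
  -- finite part
  have hmid : ∀ M : ℕ, Tendsto (fun N => ∫⁻ t in Set.Ioo 0 T,
      ‖∑ k ∈ box M, fN N t k * gN N t (m - k) - ∑ k ∈ box M, f t k * g t (m - k)‖ₑ) atTop (𝓝 0) := by
    intro M
    have h0 : (0:ℝ≥0∞) = ∫⁻ t in Set.Ioo 0 T, (0:ℝ≥0∞) := by simp
    rw [h0]
    refine tendsto_lintegral_of_dominated_convergence'
      (fun _ => ENNReal.ofReal (∑ k ∈ box M, (K + K))) (fun N => ?_) (fun N => ?_) ?_ ?_
    · refine Measurable.aemeasurable (Measurable.enorm (Measurable.sub ?_ ?_))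
      · exact Finset.measurable_fun_sum _ fun k _ => ((hfN N).meas k).mul ((hgN N).meas _)
      · exact Finset.measurable_fun_sum _ fun k _ => (hf.meas k).mul (hg.meas _)
    · filter_upwards [ae_restrict_mem measurableSet_Ioo] with t ht
      rw [← ofReal_norm]
      refine ENNReal.ofReal_le_ofReal ?_
      rw [← Finset.sum_sub_distrib]
      refine (norm_sum_le _ _).trans (Finset.sum_le_sum fun k _ => ?_)
      refine (norm_sub_le _ _).trans (add_le_add ?_ ?_)
      · refine (cv_bound_term _ _ _ _).trans ?_
        linarith [((hfN N).l2 t ht).norm_sq_le k, ((hgN N).l2 t ht).norm_sq_le (m - k)]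
      · refine (cv_bound_term _ _ _ _).trans ?_
        linarith [(hf.l2 t ht).norm_sq_le k, (hg.l2 t ht).norm_sq_le (m - k)]
    · simp [ENNReal.mul_eq_top]
    · filter_upwards [ae_restrict_mem measurableSet_Ioo] with t ht
      have h1 : Tendsto (fun N => ∑ k ∈ box M, fN N t k * gN N t (m - k)
          - ∑ k ∈ box M, f t k * g t (m - k)) atTop (𝓝 0) := by
        have := (tendsto_finsetSum (box M) fun k _ => (hfl t ht k).mul (hgl t ht (m - k))).sub_const
          (∑ k ∈ box M, f t k * g t (m - k))
        simpa using this
      have := h1.enorm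
      simpa using this
  rw [ENNReal.tendsto_nhds_zero]
  intro ε hε
  -- choose M
  have hM0 : Tendsto (fun M : ℕ => ENNReal.ofReal (1 / M) * C) atTop (𝓝 0) := by
    have h1 : Tendsto (fun M : ℕ => ENNReal.ofReal (1 / (M:ℝ))) atTop (𝓝 0) := by
      have := ENNReal.tendsto_ofReal (tendsto_one_div_atTop_nhds_zero_nat (𝕜 := ℝ))
      simpa using this
    have := ENNReal.Tendsto.mul_const h1 (Or.inr hCt)
    simpa using this
  have hε3 : 0 < ε / 3 := ENNReal.div_pos hε.ne' (by norm_num)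
  obtain ⟨M, hM, hMpos⟩ := ((ENNReal.tendsto_nhds_zero.1 hM0 (ε / 3) hε3).and
    (eventually_gt_atTop 0)).exists
  filter_upwards [ENNReal.tendsto_nhds_zero.1 (hmid M) (ε / 3) hε3] with N hN
  set P : ℝ → ℂ := fun t => ∑ k ∈ box M, f t k * g t (m - k) with hP
  set PN : ℝ → ℂ := fun t => ∑ k ∈ box M, fN N t k * gN N t (m - k) with hPN
  have hmP : Measurable P := Finset.measurable_fun_sum _ fun k _ => (hf.meas k).mul (hg.meas _)
  have hmPN : Measurable PN :=
    Finset.measurable_fun_sum _ fun k _ => ((hfN N).meas k).mul ((hgN N).meas _)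
  calc ∫⁻ t in Set.Ioo 0 T, ‖cv (fN N t) (gN N t) m - cv (f t) (g t) m‖ₑ
      ≤ ∫⁻ t in Set.Ioo 0 T, (‖PN t - P t‖ₑ + (‖cv (fN N t) (gN N t) m - PN t‖ₑ
        + ‖cv (f t) (g t) m - P t‖ₑ)) := by
        refine lintegral_mono fun t => ?_
        have e : cv (fN N t) (gN N t) m - cv (f t) (g t) m = (PN t - P t)
          + ((cv (fN N t) (gN N t) m - PN t) - (cv (f t) (g t) m - P t)) := by ring
        rw [e]
        exact (enorm_add_le _ _).trans (add_le_add_right (enorm_sub_le) _)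
    _ = (∫⁻ t in Set.Ioo 0 T, ‖PN t - P t‖ₑ) + ((∫⁻ t in Set.Ioo 0 T,
        ‖cv (fN N t) (gN N t) m - PN t‖ₑ) + ∫⁻ t in Set.Ioo 0 T, ‖cv (f t) (g t) m - P t‖ₑ) := by
        have m1 : Measurable fun t => ‖PN t - P t‖ₑ := (hmPN.sub hmP).enorm
        have m2 : AEMeasurable (fun t => ‖cv (f t) (g t) m - P t‖ₑ)
            (volume.restrict (Set.Ioo 0 T)) :=
          ((hf.aesm_cv hg m).sub hmP.aestronglyMeasurable).enorm
        rw [lintegral_add_left m1, lintegral_add_right' _ m2]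
    _ ≤ ε / 3 + (ε / 3 + ε / 3) :=
        add_le_add hN (add_le_add (((hfN N).tail (hgN N) m hMpos).trans hM)
          ((hf.tail hg m hMpos).trans hM))
    _ = ε := by rw [← add_assoc]; exact ENNReal.add_thirds ε

lemma cv_weak {T K : ℝ} {H : ℝ≥0∞} (hH : H ≠ ∞) {f g : ℝ → Lat → ℂ}
    {fN gN : ℕ → ℝ → Lat → ℂ} (hf : Good T K H f) (hg : Good T K H g)
    (hfN : ∀ N, Good T K H (fN N)) (hgN : ∀ N, Good T K H (gN N))
    (hfl : ∀ t ∈ Set.Ioo 0 T, ∀ n, Tendsto (fun N => fN N t n) atTop (𝓝 (f t n)))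
    (hgl : ∀ t ∈ Set.Ioo 0 T, ∀ n, Tendsto (fun N => gN N t n) atTop (𝓝 (g t n))) (m : Lat)
    {θ : ℝ → ℂ} (hθ : Continuous θ) {C : ℝ} (hC : ∀ t, ‖θ t‖ ≤ C) :
    Tendsto (fun N => ∫ t in Set.Ioo 0 T, cv (fN N t) (gN N t) m * θ t) atTop
      (𝓝 (∫ t in Set.Ioo 0 T, cv (f t) (g t) m * θ t)) := by
  refine tendsto_integral_of_L1 _ ?_ (Eventually.of_forall fun N => ?_) ?_
  · exact (hf.aesm_cv hg m).mul hθ.aestronglyMeasurable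
  · exact Integrable.mul_bdd ((hfN N).int_cv (hgN N) m) hθ.aestronglyMeasurable (Eventually.of_forall hC)
  · have h1 := ENNReal.Tendsto.mul_const (cv_L1 hH hf hg hfN hgN hfl hgl m)
      (Or.inr (ENNReal.ofReal_ne_top (r := C)))
    rw [zero_mul] at h1
    refine tendsto_of_tendsto_of_tendsto_of_le_of_le tendsto_const_nhds h1 (fun N => zero_le) ?_
    intro N
    beta_reduce
    rw [← lintegral_mul_const' _ _ ENNReal.ofReal_ne_top]
    refine lintegral_mono fun t => ?_
    rw [← sub_mul, enorm_mul]
    gcongr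
    rw [← ofReal_norm]
    exact ENNReal.ofReal_le_ofReal (hC t)

/-! ### Diagonal extraction -/

lemma arzela {I : Type*} [Countable I] {T : ℝ} (hT : 0 ≤ T) (y : ℕ → I → ℝ → ℂ) (M C : I → ℝ)
    (hM : ∀ N i, ∀ t ∈ Set.Icc 0 T, ‖y N i t‖ ≤ M i)
    (hL : ∀ N i, ∀ s ∈ Set.Icc 0 T, ∀ t ∈ Set.Icc 0 T, ‖y N i s - y N i t‖ ≤ C i * |s - t|) :
    ∃ σ : ℕ → ℕ, StrictMono σ ∧ ∃ z : I → ℝ → ℂ, ∀ i, ∀ t ∈ Set.Icc 0 T,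
      Tendsto (fun N => y (σ N) i t) atTop (𝓝 (z i t)) := by
  let pr : ℝ → ℝ := fun q => (Set.projIcc 0 T hT q : ℝ)
  have hpr : ∀ q, pr q ∈ Set.Icc 0 T := fun q => (Set.projIcc 0 T hT q).2
  have hcomp : IsCompact (Set.univ.pi fun p : I × ℚ => Metric.closedBall (0:ℂ) (M p.1)) :=
    isCompact_univ_pi fun p => isCompact_closedBall _ _
  let x : ℕ → (I × ℚ → ℂ) := fun N p => y N p.1 (pr p.2)
  have hx : ∀ N, x N ∈ Set.univ.pi fun p : I × ℚ => Metric.closedBall (0:ℂ) (M p.1) := by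
    intro N p _
    rw [mem_closedBall_zero_iff]
    exact hM N p.1 _ (hpr _)
  obtain ⟨a, -, σ, hσ, hlim⟩ := hcomp.tendsto_subseq hx
  have hlim' : ∀ p, Tendsto (fun N => y (σ N) p.1 (pr p.2)) atTop (𝓝 (a p)) := fun p =>
    (tendsto_pi_nhds.1 hlim) p
  have key : ∀ i, ∀ t ∈ Set.Icc 0 T, ∃ z, Tendsto (fun N => y (σ N) i t) atTop (𝓝 z) := by
    intro i t ht
    refine cauchySeq_tendsto_of_complete ?_
    rw [Metric.cauchySeq_iff']
    intro ε hε
    have hC : 0 < |C i| + 1 := by positivity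
    obtain ⟨q, hq1, hq2⟩ := exists_rat_btwn (show t < t + ε / (4 * (|C i| + 1)) by
      have : 0 < ε / (4 * (|C i| + 1)) := by positivity
      linarith)
    have hd : |t - pr q| ≤ ε / (4 * (|C i| + 1)) := by
      have h1 : |pr t - pr q| ≤ |t - q| := by
        have := (LipschitzWith.projIcc hT).dist_le_mul t (q:ℝ)
        simpa [Real.dist_eq, Subtype.dist_eq] using this
      have h2 : pr t = t := by
        simp only [pr]; rw [Set.projIcc_of_mem hT ht]
      rw [h2] at h1
      refine h1.trans ?_
      rw [abs_le]; constructor <;> linarith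
    have hLq : ∀ N, ‖y N i t - y N i (pr q)‖ ≤ ε / 4 := by
      intro N
      refine (hL N i t ht _ (hpr _)).trans ?_
      calc C i * |t - pr q| ≤ (|C i| + 1) * (ε / (4 * (|C i| + 1))) := by
            have := le_abs_self (C i)
            gcongr
            linarith
        _ = ε / 4 := by field_simp
    obtain ⟨N0, hN0⟩ := Metric.cauchySeq_iff'.1 (hlim' (i, q)).cauchySeq (ε / 4) (by positivity)
    refine ⟨N0, fun N hN => ?_⟩
    have h1 := hN0 N hN
    rw [dist_eq_norm] at h1 ⊢
    have e : y (σ N) i t - y (σ N0) i t = (y (σ N) i t - y (σ N) i (pr q))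
      + (y (σ N) i (pr q) - y (σ N0) i (pr q)) - (y (σ N0) i t - y (σ N0) i (pr q)) := by ring
    rw [e]
    have := norm_sub_le ((y (σ N) i t - y (σ N) i (pr q))
      + (y (σ N) i (pr q) - y (σ N0) i (pr q))) (y (σ N0) i t - y (σ N0) i (pr q))
    have := norm_add_le (y (σ N) i t - y (σ N) i (pr q)) (y (σ N) i (pr q) - y (σ N0) i (pr q))
    linarith [hLq (σ N), hLq (σ N0)]
  classical
  refine ⟨σ, hσ, fun i t => if h : t ∈ Set.Icc 0 T then (key i t h).choose else 0, ?_⟩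
  intro i t ht
  simp only [ht, dif_pos]
  exact (key i t ht).choose_spec

/-! ### Uniform bounds -/

lemma abs_coord_le (n : Lat) (j : Fin 3) : |(n j : ℝ)| ≤ latSq n := by
  have h1 : |(n j : ℝ)| ≤ (n j : ℝ) ^ 2 := by
    have : |n j| ≤ (n j) ^ 2 := by
      rw [← sq_abs]
      have := abs_nonneg (n j)
      rcases this.eq_or_lt with h | h
      · rw [← h]; norm_num
      · nlinarith
    exact_mod_cast this
  exact h1.trans (Finset.single_le_sum (f := fun i => (n i : ℝ) ^ 2) (fun i _ => sq_nonneg _)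
    (Finset.mem_univ j))

lemma sq_coord_le (n : Lat) (j : Fin 3) : (n j : ℝ) ^ 2 ≤ latSq n :=
  Finset.single_le_sum (f := fun i => (n i : ℝ) ^ 2) (fun i _ => sq_nonneg _) (Finset.mem_univ j)

lemma norm_dd (φ : Lat → ℂ) (n : Lat) : ‖dd φ n‖ = 2 * π * latSq n * ‖φ n‖ := by
  have := latSq_nonneg n
  simp [dd, abs_of_nonneg Real.pi_pos.le, abs_of_nonneg this]

lemma latSq_mul_le_dd (φ : Lat → ℂ) (n : Lat) : latSq n * ‖φ n‖ ≤ ‖dd φ n‖ := by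
  rw [norm_dd]
  have := latSq_nonneg n
  have := Real.pi_gt_three
  have : 0 ≤ latSq n * ‖φ n‖ := by positivity
  nlinarith

lemma norm_coord (n : Lat) (j : Fin 3) : ‖(n j : ℂ)‖ = |(n j : ℝ)| := by
  rw [← Complex.ofReal_intCast, Complex.norm_real, Real.norm_eq_abs]

lemma norm_grad_le (φ : Lat → ℂ) (j : Fin 3) (n : Lat) : ‖(n j : ℂ) * φ n‖ ≤ ‖dd φ n‖ := by
  rw [norm_mul, norm_coord]
  refine le_trans ?_ (latSq_mul_le_dd φ n)
  have := abs_coord_le n j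
  gcongr

lemma latSq_norm_grad_le (φ : Lat → ℂ) (j : Fin 3) (n : Lat) :
    latSq n * ‖(n j : ℂ) * φ n‖ ^ 2 ≤ ‖dd φ n‖ ^ 2 := by
  rw [norm_mul, norm_coord, mul_pow, sq_abs]
  have h1 := sq_coord_le n j
  have h2 := latSq_mul_le_dd φ n
  have h0 := latSq_nonneg n
  calc latSq n * ((n j : ℝ) ^ 2 * ‖φ n‖ ^ 2) ≤ latSq n * (latSq n * ‖φ n‖ ^ 2) := by gcongr
    _ = (latSq n * ‖φ n‖) ^ 2 := by ring
    _ ≤ _ := by gcongr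

lemma norm_dd_ph_le (φ : Lat → ℂ) {t : ℝ} (ht : 0 ≤ t) (n : Lat) : ‖dd (ph φ t) n‖ ≤ ‖dd φ n‖ := by
  rw [norm_dd_ph]
  have h1 : Real.exp (-(lam n * t)) ≤ 1 := Real.exp_le_one_iff.2 (by
    have := mul_nonneg (lam_pos n).le ht
    linarith)
  nlinarith [norm_nonneg (dd φ n)]

lemma measurable_ph (φ : Lat → ℂ) (n : Lat) : Measurable fun t => ph φ t n := by
  unfold ph
  fun_prop

lemma good_h {φ : Lat → ℂ} {Kd T : ℝ} (hd : L2b Kd (dd φ)) (j : Fin 3) :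
    Good T Kd (ENNReal.ofReal Kd * ENNReal.ofReal T) (fun t n => (n j : ℂ) * ph φ t n) := by
  refine ⟨fun n => (measurable_ph φ n).const_mul _, fun t ht => ?_, ?_⟩
  · exact hd.mono fun n => (norm_grad_le (ph φ t) j n).trans (norm_dd_ph_le φ ht.1.le n)
  · calc _ ≤ ∫⁻ t in Set.Ioo 0 T, ENNReal.ofReal Kd := by
          refine setLIntegral_mono' measurableSet_Ioo fun t ht => ?_
          refine le_trans (ENNReal.tsum_le_tsum fun n => ENNReal.ofReal_le_ofReal ?_) hd.etsum_le
          refine (latSq_norm_grad_le (ph φ t) j n).trans ?_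
          have := norm_dd_ph_le φ ht.1.le n
          gcongr
      _ = _ := by simp

lemma exp_int_le (n : Lat) (T : ℝ) :
    ∫⁻ t in Set.Ioo 0 T, ENNReal.ofReal (latSq n * Real.exp (-(lam n * t)) ^ 2) ≤ 1 := by
  have hl := lam_pos n
  have hq := latSq_nonneg n
  have e : ∀ t, latSq n * Real.exp (-(lam n * t)) ^ 2
      = latSq n * Real.exp ((-(2 * lam n)) * t) := by
    intro t
    rw [sq, ← Real.exp_add]; ring_nf
  simp only [e]
  calc _ ≤ ∫⁻ t in Set.Ioi 0, ENNReal.ofReal (latSq n * Real.exp ((-(2 * lam n)) * t)) :=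
        lintegral_mono_set Set.Ioo_subset_Ioi_self
    _ = ENNReal.ofReal (∫ t in Set.Ioi (0:ℝ), latSq n * Real.exp ((-(2 * lam n)) * t)) := by
        rw [ofReal_integral_eq_lintegral_ofReal]
        · exact (integrableOn_exp_mul_Ioi (by linarith) 0).const_mul _
        · exact Eventually.of_forall fun t => by positivity
    _ ≤ 1 := by
        rw [integral_const_mul, integral_exp_mul_Ioi (by linarith)]
        rw [ENNReal.ofReal_le_one]
        simp only [mul_zero, Real.exp_zero]
        rw [neg_div_neg_eq, mul_one_div, div_le_one (by positivity)]
        unfold lam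
        nlinarith [sq_nonneg (latSq n), mul_nonneg hq (sq_nonneg (latSq n))]

lemma good_d {φ : Lat → ℂ} {Kd T : ℝ} (hd : L2b Kd (dd φ)) :
    Good T Kd (ENNReal.ofReal Kd) (fun t => dd (ph φ t)) := by
  refine ⟨fun n => ?_, fun t ht => ?_, ?_⟩
  · unfold dd
    exact (measurable_ph φ n).const_mul _
  · exact hd.mono fun n => norm_dd_ph_le φ ht.1.le n
  · rw [lintegral_tsum]
    · refine le_trans (ENNReal.tsum_le_tsum fun n => ?_) hd.etsum_le
      have e : ∀ t, ENNReal.ofReal (latSq n * ‖dd (ph φ t) n‖ ^ 2) = ENNReal.ofReal (‖dd φ n‖ ^ 2) *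
          ENNReal.ofReal (latSq n * Real.exp (-(lam n * t)) ^ 2) := by
        intro t
        rw [norm_dd_ph, ← ENNReal.ofReal_mul (by positivity)]
        ring_nf
      simp only [e]
      rw [lintegral_const_mul' _ _ ENNReal.ofReal_ne_top]
      exact mul_le_of_le_one_right' (exp_int_le n T)
    · intro n
      refine Measurable.aemeasurable ?_
      unfold dd
      exact (((((measurable_ph φ n).const_mul _).norm).pow_const 2).const_mul _).ennreal_ofReal

lemma norm_tr_le (S : Finset Lat) (φ : Lat → ℂ) (n : Lat) : ‖tr S φ n‖ ≤ ‖φ n‖ := by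
  unfold tr; split_ifs <;> simp

lemma measurable_tr (S : Finset Lat) {φ : ℝ → Lat → ℂ} (n : Lat) (h : Measurable fun t => φ t n) :
    Measurable fun t => tr S (φ t) n := by
  unfold tr; split_ifs
  · exact h
  · exact measurable_const

lemma good_h_tr {φ : Lat → ℂ} {Kd T : ℝ} (hd : L2b Kd (dd φ)) (j : Fin 3) (S : Finset Lat) :
    Good T Kd (ENNReal.ofReal Kd * ENNReal.ofReal T) (fun t n => (n j : ℂ) * tr S (ph φ t) n) :=
  (good_h hd j).mono (fun n => (measurable_tr S n (measurable_ph φ n)).const_mul _) fun t _ n => by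
    rw [norm_mul, norm_mul]
    have := norm_tr_le S (ph φ t) n
    gcongr

lemma good_d_tr {φ : Lat → ℂ} {Kd T : ℝ} (hd : L2b Kd (dd φ)) (S : Finset Lat) :
    Good T Kd (ENNReal.ofReal Kd) (fun t => dd (tr S (ph φ t))) :=
  (good_d hd).mono (fun n => by
    unfold dd
    exact (measurable_tr S n (measurable_ph φ n)).const_mul _) fun t _ n => by
    rw [norm_dd, norm_dd]
    have := norm_tr_le S (ph φ t) n
    have := latSq_nonneg n
    gcongr

lemma norm_lerayP_le (n : Lat) (v : Fin 3 → ℂ) (j : Fin 3) {C : ℝ} (hv : ∀ i, ‖v i‖ ≤ C) :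
    ‖lerayP n v j‖ ≤ 4 * C := by
  have hC : 0 ≤ C := (norm_nonneg _).trans (hv 0)
  unfold lerayP
  have h2 : ‖(n j : ℂ) * (∑ i, (n i : ℂ) * v i) / (latSq n : ℂ)‖ ≤ 3 * C := by
    rw [Finset.mul_sum, Finset.sum_div]
    refine (norm_sum_le _ _).trans ?_
    have h3 : ∀ i, ‖(n j : ℂ) * ((n i : ℂ) * v i) / (latSq n : ℂ)‖ ≤ C := by
      intro i
      rw [norm_div, norm_mul, norm_mul, norm_coord, norm_coord, Complex.norm_real,
        Real.norm_eq_abs, abs_of_nonneg (latSq_nonneg n)]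
      refine div_le_of_le_mul₀ (latSq_nonneg n) hC ?_
      have h4 : |(n j : ℝ)| * |(n i : ℝ)| ≤ latSq n := by
        have a := sq_coord_le n j
        have b := sq_coord_le n i
        rw [← sq_abs] at a b
        nlinarith [sq_nonneg (|(n j : ℝ)| - |(n i : ℝ)|)]
      calc |(n j : ℝ)| * (|(n i : ℝ)| * ‖v i‖) = (|(n j : ℝ)| * |(n i : ℝ)|) * ‖v i‖ := by ring
        _ ≤ latSq n * C := by
          have := hv i
          have := latSq_nonneg n
          gcongr
        _ = C * latSq n := mul_comm _ _
    calc _ ≤ ∑ i : Fin 3, C := Finset.sum_le_sum fun i _ => h3 i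
      _ = 3 * C := by simp
  have := norm_sub_le (v j) ((n j : ℂ) * (∑ i, (n i : ℂ) * v i) / (latSq n : ℂ))
  linarith [hv j]

lemma norm_NN_le {K : ℝ} {f g p q : Fin 3 → Lat → ℂ} {d : Lat → ℂ} {r : Fin 3 → Lat → ℂ}
    (hf : ∀ i, L2b K (f i)) (hg : ∀ i, L2b K (g i)) (hp : ∀ i, L2b K (p i)) (hq : ∀ i, L2b K (q i))
    (hd : L2b K d) (hr : ∀ i, L2b K (r i)) (j : Fin 3) (n : Lat) :
    ‖NN f g p q d r j n‖ ≤ 12 * π * K * latSq n + K := by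
  have hK : 0 ≤ K := hd.nonneg
  unfold NN
  refine (norm_sub_le _ _).trans (add_le_add ?_ ?_)
  · rw [norm_neg]
    refine (norm_sum_le _ _).trans ?_
    calc _ ≤ ∑ i : Fin 3, 4 * π * K * latSq n := by
          refine Finset.sum_le_sum fun i _ => ?_
          rw [norm_mul, norm_mul, norm_coord]
          have h1 : ‖cv (f i) (g j) n - cv (p i) (q j) n‖ ≤ 2 * K := by
            refine (norm_sub_le _ _).trans ?_
            have := norm_cv_le (hf i) (hg j) n
            have := norm_cv_le (hp i) (hq j) n
            linarith
          have h2 := abs_coord_le n i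
          have h3 : ‖(2 * π * I : ℂ)‖ = 2 * π := by simp [abs_of_nonneg Real.pi_pos.le]
          rw [h3]
          calc 2 * π * |(n i : ℝ)| * _ ≤ 2 * π * latSq n * (2 * K) := by
                have := Real.pi_pos
                have := latSq_nonneg n
                gcongr
            _ = _ := by ring
      _ = _ := by simp; ring
  · have := norm_cv_le hd (hr j) n
    linarith

lemma norm_NL_le {K : ℝ} {w : Fin 2 → Fin 3 → Lat → ℂ} {φ : Lat → ℂ}
    (hw : ∀ i, L2b K (w 0 i)) (hB : ∀ i, L2b K (Bf w φ i)) (hd : L2b K (dd φ)) (α : Fin 2)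
    (j : Fin 3) (n : Lat) : ‖NL w φ α j n‖ ≤ 12 * π * K * latSq n + K := by
  unfold NL
  split_ifs
  · exact norm_NN_le hw hw hB hB hd hB j n
  · exact norm_NN_le hw hB hB hw hd hw j n

lemma norm_RR_le {K : ℝ} {ν : Fin 2 → ℝ} {w : Fin 2 → Fin 3 → Lat → ℂ} {φ : Lat → ℂ}
    (hw : ∀ α i, L2b K (w α i)) (hB : ∀ i, L2b K (Bf w φ i)) (hd : L2b K (dd φ)) (α : Fin 2)
    (j : Fin 3) (n : Lat) : ‖RR ν w φ α j n‖
      ≤ |ν α| * (4 * π ^ 2 * latSq n) * Real.sqrt K + (12 * π * K * latSq n + K) := by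
  unfold RR
  refine (norm_add_le _ _).trans (add_le_add ?_ (norm_NL_le (hw 0) hB hd α j n))
  rw [norm_mul, norm_neg, Complex.norm_real, Real.norm_eq_abs, abs_mul]
  have h0 := latSq_nonneg n
  rw [abs_of_nonneg (show (0:ℝ) ≤ 4 * π ^ 2 * latSq n by positivity)]
  have := (hw α j).norm_le n
  gcongr

/-! ### Passage to the limit: tools -/

lemma Good.limit {T K : ℝ} {H : ℝ≥0∞} {f : ℝ → Lat → ℂ} {fN : ℕ → ℝ → Lat → ℂ}
    (hfN : ∀ N, Good T K H (fN N)) (hm : ∀ n, Measurable fun t => f t n)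
    (hfl : ∀ t ∈ Set.Ioo 0 T, ∀ n, Tendsto (fun N => fN N t n) atTop (𝓝 (f t n))) :
    Good T K H f := by
  refine ⟨hm, fun t ht s => ?_, ?_⟩
  · exact le_of_tendsto' (tendsto_finsetSum s fun n _ => ((hfl t ht n).norm.pow 2))
      fun N => (hfN N).l2 t ht s
  · have hmN : ∀ N, Measurable fun t => ∑' n, ENNReal.ofReal (latSq n * ‖fN N t n‖ ^ 2) := fun N =>
      Measurable.tsum fun n => (((((hfN N).meas n).norm).pow_const 2).const_mul _).ennreal_ofReal
    calc _ ≤ ∫⁻ t in Set.Ioo 0 T,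
          liminf (fun N => ∑' n, ENNReal.ofReal (latSq n * ‖fN N t n‖ ^ 2)) atTop := by
          refine setLIntegral_mono' measurableSet_Ioo fun t ht => ?_
          rw [ENNReal.tsum_eq_iSup_sum]
          refine iSup_le fun s => ?_
          have h1 : Tendsto (fun N => ∑ n ∈ s, ENNReal.ofReal (latSq n * ‖fN N t n‖ ^ 2)) atTop
              (𝓝 (∑ n ∈ s, ENNReal.ofReal (latSq n * ‖f t n‖ ^ 2))) :=
            tendsto_finsetSum s fun n _ => ENNReal.tendsto_ofReal
              (((hfl t ht n).norm.pow 2).const_mul _)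
          rw [← h1.liminf_eq]
          exact liminf_le_liminf (Eventually.of_forall fun N => ENNReal.sum_le_tsum s)
      _ ≤ liminf (fun N => ∫⁻ t in Set.Ioo 0 T,
          ∑' n, ENNReal.ofReal (latSq n * ‖fN N t n‖ ^ 2)) atTop := lintegral_liminf_le hmN
      _ ≤ H := by
          refine liminf_le_of_le ?_ ?_
          · isBoundedDefault
          · intro b hb
            obtain ⟨N, hN⟩ := hb.exists
            exact hN.trans (hfN N).h1

structure GoodS (T K : ℝ) (H : ℝ≥0∞) (w : ℝ → Fin 2 → Fin 3 → Lat → ℂ) (φ : ℝ → Lat → ℂ) :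
    Prop where
  gw : ∀ α j, Good T K H (fun t => w t α j)
  gB : ∀ j, Good T K H (fun t => Bf (w t) (φ t) j)
  gd : Good T K H (fun t => dd (φ t))

lemma Good.int_coef {T K : ℝ} {H : ℝ≥0∞} {f : ℝ → Lat → ℂ} (hf : Good T K H f) (n : Lat) :
    IntegrableOn (fun t => f t n) (Set.Ioo 0 T) := by
  refine ⟨(hf.meas n).aestronglyMeasurable, HasFiniteIntegral.of_bounded (C := Real.sqrt K) ?_⟩
  filter_upwards [ae_restrict_mem measurableSet_Ioo] with t ht
  exact (hf.l2 t ht).norm_le n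

lemma coef_weak {T K : ℝ} {H : ℝ≥0∞} {f : ℝ → Lat → ℂ} {fN : ℕ → ℝ → Lat → ℂ}
    (hfN : ∀ N, Good T K H (fN N))
    (hfl : ∀ t ∈ Set.Ioo 0 T, ∀ n, Tendsto (fun N => fN N t n) atTop (𝓝 (f t n))) (n : Lat)
    {θ : ℝ → ℂ} (hθ : Continuous θ) {C : ℝ} (hC : ∀ t, ‖θ t‖ ≤ C) :
    Tendsto (fun N => ∫ t in Set.Ioo 0 T, fN N t n * θ t) atTop
      (𝓝 (∫ t in Set.Ioo 0 T, f t n * θ t)) := by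
  refine tendsto_integral_of_dominated_convergence (fun _ => Real.sqrt K * C) (fun N => ?_) ?_
    (fun N => ?_) ?_
  · exact (((hfN N).meas n).aestronglyMeasurable).mul hθ.aestronglyMeasurable
  · exact integrable_const _
  · filter_upwards [ae_restrict_mem measurableSet_Ioo] with t ht
    rw [norm_mul]
    have h1 := ((hfN N).l2 t ht).norm_le n
    have h2 := hC t
    gcongr
  · filter_upwards [ae_restrict_mem measurableSet_Ioo] with t ht
    exact (hfl t ht n).mul_const _

lemma NN_mul (f g p q : Fin 3 → Lat → ℂ) (d : Lat → ℂ) (r : Fin 3 → Lat → ℂ) (j : Fin 3) (n : Lat)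
    (x : ℂ) : NN f g p q d r j n * x = -(∑ i, 2 * π * I * (n i : ℂ) *
      (cv (f i) (g j) n * x - cv (p i) (q j) n * x)) - cv d (r j) n * x := by
  unfold NN
  rw [sub_mul, neg_mul, Finset.sum_mul]
  congr 2
  exact Finset.sum_congr rfl fun i _ => by ring

lemma int_NN {T K : ℝ} {H : ℝ≥0∞} {f g p q : ℝ → Fin 3 → Lat → ℂ} {d : ℝ → Lat → ℂ}
    {r : ℝ → Fin 3 → Lat → ℂ} (hf : ∀ i, Good T K H (fun t => f t i))
    (hg : ∀ i, Good T K H (fun t => g t i)) (hp : ∀ i, Good T K H (fun t => p t i))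
    (hq : ∀ i, Good T K H (fun t => q t i)) (hd : Good T K H d)
    (hr : ∀ i, Good T K H (fun t => r t i)) (j : Fin 3) (n : Lat) :
    IntegrableOn (fun t => NN (f t) (g t) (p t) (q t) (d t) (r t) j n) (Set.Ioo 0 T) := by
  unfold NN
  refine Integrable.sub (Integrable.neg (integrable_finsetSum _ fun i _ => ?_))
    (hd.int_cv (hr j) n)
  exact (((hf i).int_cv (hg j) n).sub ((hp i).int_cv (hq j) n)).const_mul _

lemma int_NL {T K : ℝ} {H : ℝ≥0∞} {w : ℝ → Fin 2 → Fin 3 → Lat → ℂ} {φ : ℝ → Lat → ℂ}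
    (h : GoodS T K H w φ) (α : Fin 2) (j : Fin 3) (n : Lat) :
    IntegrableOn (fun t => NL (w t) (φ t) α j n) (Set.Ioo 0 T) := by
  unfold NL
  split_ifs
  · exact int_NN (h.gw 0) (h.gw 0) h.gB h.gB h.gd h.gB j n
  · exact int_NN (h.gw 0) h.gB h.gB (h.gw 0) h.gd (h.gw 0) j n

lemma int_RR {T K : ℝ} {H : ℝ≥0∞} {w : ℝ → Fin 2 → Fin 3 → Lat → ℂ} {φ : ℝ → Lat → ℂ}
    (h : GoodS T K H w φ) (ν : Fin 2 → ℝ) (α : Fin 2) (j : Fin 3) (n : Lat) :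
    IntegrableOn (fun t => RR ν (w t) (φ t) α j n) (Set.Ioo 0 T) := by
  unfold RR
  exact (((h.gw α j).int_coef n).const_mul _).add (int_NL h α j n)

lemma int_mul_bdd {T : ℝ} {f : ℝ → ℂ} (hf : IntegrableOn f (Set.Ioo 0 T)) {θ : ℝ → ℂ}
    (hθ : Continuous θ) {C : ℝ} (hC : ∀ t, ‖θ t‖ ≤ C) :
    IntegrableOn (fun t => f t * θ t) (Set.Ioo 0 T) :=
  Integrable.mul_bdd hf hθ.aestronglyMeasurable (Eventually.of_forall hC)

lemma NN_weak {T K : ℝ} {H : ℝ≥0∞} (hH : H ≠ ∞) {f g p q : ℝ → Fin 3 → Lat → ℂ} {d : ℝ → Lat → ℂ}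
    {r : ℝ → Fin 3 → Lat → ℂ} {f' g' p' q' : ℕ → ℝ → Fin 3 → Lat → ℂ} {d' : ℕ → ℝ → Lat → ℂ}
    {r' : ℕ → ℝ → Fin 3 → Lat → ℂ}
    (hf : ∀ i, Good T K H (fun t => f t i)) (hg : ∀ i, Good T K H (fun t => g t i))
    (hp : ∀ i, Good T K H (fun t => p t i)) (hq : ∀ i, Good T K H (fun t => q t i))
    (hd : Good T K H d) (hr : ∀ i, Good T K H (fun t => r t i))
    (hf' : ∀ N i, Good T K H (fun t => f' N t i)) (hg' : ∀ N i, Good T K H (fun t => g' N t i))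
    (hp' : ∀ N i, Good T K H (fun t => p' N t i)) (hq' : ∀ N i, Good T K H (fun t => q' N t i))
    (hd' : ∀ N, Good T K H (d' N)) (hr' : ∀ N i, Good T K H (fun t => r' N t i))
    (lf : ∀ i, ∀ t ∈ Set.Ioo 0 T, ∀ n, Tendsto (fun N => f' N t i n) atTop (𝓝 (f t i n)))
    (lg : ∀ i, ∀ t ∈ Set.Ioo 0 T, ∀ n, Tendsto (fun N => g' N t i n) atTop (𝓝 (g t i n)))
    (lp : ∀ i, ∀ t ∈ Set.Ioo 0 T, ∀ n, Tendsto (fun N => p' N t i n) atTop (𝓝 (p t i n)))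
    (lq : ∀ i, ∀ t ∈ Set.Ioo 0 T, ∀ n, Tendsto (fun N => q' N t i n) atTop (𝓝 (q t i n)))
    (ld : ∀ t ∈ Set.Ioo 0 T, ∀ n, Tendsto (fun N => d' N t n) atTop (𝓝 (d t n)))
    (lr : ∀ i, ∀ t ∈ Set.Ioo 0 T, ∀ n, Tendsto (fun N => r' N t i n) atTop (𝓝 (r t i n)))
    (j : Fin 3) (n : Lat) {θ : ℝ → ℂ} (hθ : Continuous θ) {C : ℝ} (hC : ∀ t, ‖θ t‖ ≤ C) :
    Tendsto (fun N => ∫ t in Set.Ioo 0 T,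
        NN (f' N t) (g' N t) (p' N t) (q' N t) (d' N t) (r' N t) j n * θ t) atTop
      (𝓝 (∫ t in Set.Ioo 0 T, NN (f t) (g t) (p t) (q t) (d t) (r t) j n * θ t)) := by
  have e : ∀ {f g p q : ℝ → Fin 3 → Lat → ℂ} {d : ℝ → Lat → ℂ} {r : ℝ → Fin 3 → Lat → ℂ},
      (∀ i, Good T K H (fun t => f t i)) → (∀ i, Good T K H (fun t => g t i)) →
      (∀ i, Good T K H (fun t => p t i)) → (∀ i, Good T K H (fun t => q t i)) →
      Good T K H d → (∀ i, Good T K H (fun t => r t i)) →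
      ∫ t in Set.Ioo 0 T, NN (f t) (g t) (p t) (q t) (d t) (r t) j n * θ t
      = -(∑ i, 2 * π * I * (n i : ℂ) * ((∫ t in Set.Ioo 0 T, cv (f t i) (g t j) n * θ t)
        - ∫ t in Set.Ioo 0 T, cv (p t i) (q t j) n * θ t))
        - ∫ t in Set.Ioo 0 T, cv (d t) (r t j) n * θ t := by
    intro f g p q d r hf hg hp hq hd hr
    have i1 := fun i => int_mul_bdd ((hf i).int_cv (hg j) n) hθ hC
    have i2 := fun i => int_mul_bdd ((hp i).int_cv (hq j) n) hθ hC
    have i3 := int_mul_bdd (hd.int_cv (hr j) n) hθ hC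
    simp only [NN_mul]
    rw [integral_sub, integral_neg, integral_finsetSum]
    · congr 2
      refine Finset.sum_congr rfl fun i _ => ?_
      rw [integral_const_mul, integral_sub (i1 i) (i2 i)]
    · exact fun i _ => ((i1 i).sub (i2 i)).const_mul _
    · exact (integrable_finsetSum _ fun i _ => ((i1 i).sub (i2 i)).const_mul _).neg
    · exact i3
  rw [e hf hg hp hq hd hr]
  simp only [fun N => e (hf' N) (hg' N) (hp' N) (hq' N) (hd' N) (hr' N)]
  refine Tendsto.sub (Tendsto.neg (tendsto_finsetSum _ fun i _ => Tendsto.const_mul _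
    (Tendsto.sub ?_ ?_))) ?_
  · exact cv_weak hH (hf i) (hg j) (fun N => hf' N i) (fun N => hg' N j) (lf i) (lg j) n hθ hC
  · exact cv_weak hH (hp i) (hq j) (fun N => hp' N i) (fun N => hq' N j) (lp i) (lq j) n hθ hC
  · exact cv_weak hH hd (hr j) hd' (fun N => hr' N j) ld (lr j) n hθ hC

lemma RR_weak {T K : ℝ} {H : ℝ≥0∞} (hH : H ≠ ∞) {w : ℝ → Fin 2 → Fin 3 → Lat → ℂ}
    {φ : ℝ → Lat → ℂ} {w' : ℕ → ℝ → Fin 2 → Fin 3 → Lat → ℂ} {φ' : ℕ → ℝ → Lat → ℂ}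
    (h : GoodS T K H w φ) (h' : ∀ N, GoodS T K H (w' N) (φ' N))
    (lw : ∀ α j, ∀ t ∈ Set.Ioo 0 T, ∀ n, Tendsto (fun N => w' N t α j n) atTop (𝓝 (w t α j n)))
    (lφ : ∀ t ∈ Set.Ioo 0 T, ∀ n, Tendsto (fun N => φ' N t n) atTop (𝓝 (φ t n)))
    (ν : Fin 2 → ℝ) (α : Fin 2) (j : Fin 3) (n : Lat) {θ : ℝ → ℂ} (hθ : Continuous θ) {C : ℝ}
    (hC : ∀ t, ‖θ t‖ ≤ C) :
    Tendsto (fun N => ∫ t in Set.Ioo 0 T, RR ν (w' N t) (φ' N t) α j n * θ t) atTop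
      (𝓝 (∫ t in Set.Ioo 0 T, RR ν (w t) (φ t) α j n * θ t)) := by
  have lB : ∀ j, ∀ t ∈ Set.Ioo 0 T, ∀ n, Tendsto (fun N => Bf (w' N t) (φ' N t) j n) atTop
      (𝓝 (Bf (w t) (φ t) j n)) := fun j t ht n =>
    (lw 1 j t ht n).add ((lφ t ht n).const_mul _)
  have ld : ∀ t ∈ Set.Ioo 0 T, ∀ n, Tendsto (fun N => dd (φ' N t) n) atTop
      (𝓝 (dd (φ t) n)) := fun t ht n => (lφ t ht n).const_mul _
  have hNL : Tendsto (fun N => ∫ t in Set.Ioo 0 T, NL (w' N t) (φ' N t) α j n * θ t) atTop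
      (𝓝 (∫ t in Set.Ioo 0 T, NL (w t) (φ t) α j n * θ t)) := by
    unfold NL
    split_ifs
    · exact NN_weak hH (h.gw 0) (h.gw 0) h.gB h.gB h.gd h.gB (fun N => (h' N).gw 0)
        (fun N => (h' N).gw 0) (fun N => (h' N).gB) (fun N => (h' N).gB) (fun N => (h' N).gd)
        (fun N => (h' N).gB) (lw 0) (lw 0) lB lB ld lB j n hθ hC
    · exact NN_weak hH (h.gw 0) h.gB h.gB (h.gw 0) h.gd (h.gw 0) (fun N => (h' N).gw 0)
        (fun N => (h' N).gB) (fun N => (h' N).gB) (fun N => (h' N).gw 0) (fun N => (h' N).gd)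
        (fun N => (h' N).gw 0) (lw 0) lB lB (lw 0) ld (lw 0) j n hθ hC
  have e : ∀ {w : ℝ → Fin 2 → Fin 3 → Lat → ℂ} {φ : ℝ → Lat → ℂ}, GoodS T K H w φ →
      ∫ t in Set.Ioo 0 T, RR ν (w t) (φ t) α j n * θ t
      = -((ν α * (4 * π ^ 2 * latSq n) : ℝ) : ℂ) * (∫ t in Set.Ioo 0 T, w t α j n * θ t)
        + ∫ t in Set.Ioo 0 T, NL (w t) (φ t) α j n * θ t := by
    intro w φ h
    have i1 := int_mul_bdd ((h.gw α j).int_coef n) hθ hC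
    have i2 := int_mul_bdd (int_NL h α j n) hθ hC
    rw [← integral_const_mul, ← integral_add (i1.const_mul _) i2]
    exact integral_congr_ae (Eventually.of_forall fun t => by simp only [RR]; ring)
  rw [e h]
  simp only [fun N => e (h' N)]
  exact ((coef_weak (fun N => (h' N).gw α j) (lw α j) n hθ hC).const_mul _).add hNL

/-! ### Compactness of the Galerkin sequence -/

lemma L2b_of_EE {S : Finset Lat} {w : Fin 2 → Fin 3 → Lat → ℂ}
    (hsupp : ∀ α j n, n ∉ S → w α j n = 0) {E : ℝ} (hE : EE S w ≤ E) (α : Fin 2) (j : Fin 3) :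
    L2b E (w α j) := by
  intro s
  refine le_trans ?_ hE
  calc ∑ n ∈ s, ‖w α j n‖ ^ 2 ≤ ∑ n ∈ s ∪ S, ‖w α j n‖ ^ 2 :=
        Finset.sum_le_sum_of_subset_of_nonneg Finset.subset_union_left fun _ _ _ => by positivity
    _ = ∑ n ∈ S, ‖w α j n‖ ^ 2 := by
        refine (Finset.sum_subset Finset.subset_union_right fun n _ hn => ?_).symm
        rw [hsupp α j n hn]; simp
    _ ≤ EE S w := by
        refine Finset.sum_le_sum fun n _ => ?_
        refine le_trans ?_ (Finset.single_le_sum (f := fun α => ∑ j, ‖w α j n‖ ^ 2)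
          (fun _ _ => Finset.sum_nonneg fun _ _ => by positivity) (Finset.mem_univ α))
        exact Finset.single_le_sum (f := fun j => ‖w α j n‖ ^ 2) (fun _ _ => by positivity)
          (Finset.mem_univ j)

lemma good_galerkin {ν : Fin 2 → ℝ} (hν : ∀ α, 0 < ν α) {T E : ℝ} (hT : 0 < T) {S : Finset Lat}
    {w : ℝ → Fin 2 → Fin 3 → Lat → ℂ} (hc : ∀ α j n, Continuous fun t => w t α j n)
    (hsupp : ∀ t α j n, n ∉ S → w t α j n = 0) (hE : ∀ t ∈ Set.Icc 0 T, EE S (w t) ≤ E)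
    (hD : 2 * ∫ t in (0:ℝ)..T, DD ν S (w t) ≤ E) (α : Fin 2) (j : Fin 3) :
    Good T E (ENNReal.ofReal (E / (8 * π ^ 2 * ν α))) (fun t => w t α j) := by
  refine ⟨fun n => (hc α j n).measurable, fun t ht =>
    L2b_of_EE (hsupp t) (hE t ⟨ht.1.le, ht.2.le⟩) α j, ?_⟩
  have hπ := Real.pi_pos
  have hα := hν α
  have hDc : Continuous fun t => DD ν S (w t) := by
    unfold DD
    refine continuous_finsetSum _ fun n _ => continuous_finsetSum _ fun α _ =>
      continuous_finsetSum _ fun j _ => continuous_const.mul ((hc α j n).norm.pow 2)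
  have hD0 : ∀ t, 0 ≤ DD ν S (w t) := fun t => Finset.sum_nonneg fun n _ => Finset.sum_nonneg
    fun α _ => Finset.sum_nonneg fun j _ => by
      have := latSq_nonneg n
      have := hν α
      positivity
  have hDle : ∀ t, ∑' n, ENNReal.ofReal (latSq n * ‖w t α j n‖ ^ 2)
      ≤ ENNReal.ofReal (DD ν S (w t) / (4 * π ^ 2 * ν α)) := by
    intro t
    rw [tsum_eq_sum (s := S) fun n hn => by rw [hsupp t α j n hn]; simp]
    rw [← ENNReal.ofReal_sum_of_nonneg fun n _ => mul_nonneg (latSq_nonneg n) (by positivity)]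
    refine ENNReal.ofReal_le_ofReal ?_
    rw [le_div_iff₀ (by positivity), Finset.sum_mul]
    refine Finset.sum_le_sum fun n _ => ?_
    have hn := latSq_nonneg n
    have hp : ∀ α j, 0 ≤ ν α * (4 * π ^ 2 * latSq n) * ‖w t α j n‖ ^ 2 := fun α j => by
      have := hν α
      positivity
    refine le_trans ?_ (Finset.single_le_sum (f := fun α => ∑ j, ν α * (4 * π ^ 2 * latSq n)
      * ‖w t α j n‖ ^ 2) (fun α _ => Finset.sum_nonneg fun j _ => hp α j) (Finset.mem_univ α))
    refine le_trans (le_of_eq ?_) (Finset.single_le_sum (f := fun j => ν α * (4 * π ^ 2 * latSq n)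
      * ‖w t α j n‖ ^ 2) (fun j _ => hp α j) (Finset.mem_univ j))
    ring
  calc _ ≤ ∫⁻ t in Set.Ioo 0 T, ENNReal.ofReal (DD ν S (w t) / (4 * π ^ 2 * ν α)) :=
        lintegral_mono fun t => hDle t
    _ = ENNReal.ofReal (∫ t in Set.Ioo 0 T, DD ν S (w t) / (4 * π ^ 2 * ν α)) := by
        rw [ofReal_integral_eq_lintegral_ofReal]
        · exact ((hDc.div_const _).continuousOn.integrableOn_Icc (a := 0) (b := T)).mono_set
            Set.Ioo_subset_Icc_self
        · exact Eventually.of_forall fun t => div_nonneg (hD0 t) (by positivity)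
    _ ≤ _ := by
        refine ENNReal.ofReal_le_ofReal ?_
        rw [integral_div, ← integral_Ioc_eq_integral_Ioo, ← intervalIntegral.integral_of_le hT.le]
        rw [div_le_div_iff₀ (by positivity) (by positivity)]
        have : 0 ≤ 4 * π ^ 2 * ν α := by positivity
        nlinarith [mul_le_mul_of_nonneg_right hD this]

/-- outcome of the compactness argument -/
structure Extr (ν : Fin 2 → ℝ) (T K : ℝ) (H : ℝ≥0∞) (φ : Lat → ℂ) (w0 : Fin 2 → Fin 3 → Lat → ℂ)
    (M : ℕ → ℕ) (wN : ℕ → ℝ → Fin 2 → Fin 3 → Lat → ℂ) (w : ℝ → Fin 2 → Fin 3 → Lat → ℂ) :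
    Prop where
  mono : StrictMono M
  cont : ∀ N α j n, Continuous fun t => wN N t α j n
  symN : ∀ N t α j n, (starRingEnd ℂ) (wN N t α j n) = wN N t α j (-n)
  divN : ∀ N t α n, ∑ j, (n j : ℂ) * wN N t α j n = 0
  atZero : ∀ N α j, ∀ n ∈ box (M N), wN N 0 α j n = w0 α j n
  der : ∀ N, ∀ t ∈ Set.Icc 0 T, ∀ α j, ∀ n ∈ box (M N), HasDerivWithinAt (fun t => wN N t α j n)
        (lerayP n (fun j => RR ν (wN N t) (tr (box (M N)) (ph φ t)) α j n) j) (Set.Icc 0 T) t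
  en : ∀ N, ∀ t ∈ Set.Icc 0 T, EE (box (M N)) (wN N t) ≤ EE (box (M N)) w0 * Real.exp (GG φ t)
  supp : ∀ N t α j n, n ∉ box (M N) → wN N t α j n = 0
  good : ∀ N, GoodS T K H (wN N) (fun t => tr (box (M N)) (ph φ t))
  lip : ∀ α j n, ∃ C, ∀ N, ∀ t ∈ Set.Icc 0 T, ‖wN N t α j n - wN N 0 α j n‖ ≤ C * t
  lim : ∀ α j n, ∀ t ∈ Set.Icc 0 T, Tendsto (fun N => wN N t α j n) atTop (𝓝 (w t α j n))
  out : ∀ t, t ∉ Set.Icc 0 T → w t = 0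

lemma extract (ν : Fin 2 → ℝ) (hν : ∀ α, 0 < ν α) {T : ℝ} (hT : 0 < T) {φ : Lat → ℂ}
    (hφ : ∀ n, (starRingEnd ℂ) (φ n) = -φ (-n)) {Kd : ℝ} (hd : L2b Kd (dd φ))
    {w0 : Fin 2 → Fin 3 → Lat → ℂ} (hsym : ∀ α j n, (starRingEnd ℂ) (w0 α j n) = w0 α j (-n))
    (hdiv : ∀ α n, ∑ j, (n j : ℂ) * w0 α j n = 0) {E0 : ℝ} (hE0 : ∀ S, EE S w0 ≤ E0) :
    ∃ K H M wN w, H ≠ ∞ ∧ Extr ν T K H φ w0 M wN w := by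
  have hK := fun n => hd.norm_le n
  choose wG hc hsupp hsymG hdivG hinit hder hen hdis using galerkin ν hν hT hφ hK hsym hdiv
  set E : ℝ := E0 * Real.exp (GG φ T) with hE
  have hE00 : 0 ≤ E0 := by simpa [EE] using hE0 ∅
  have hEpos : 0 ≤ E := by positivity
  have hKd := hd.nonneg
  have henE : ∀ N, ∀ t ∈ Set.Icc 0 T, EE (box N) (wG N t) ≤ E := by
    intro N t ht
    refine (hen N t ht).trans ?_
    have h1 := hE0 (box N)
    have h2 := GG_mono φ hK ht.1 ht.2
    rw [hE]; gcongr
  have hdE : ∀ N, 2 * ∫ t in (0:ℝ)..T, DD ν (box N) (wG N t) ≤ E := by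
    intro N
    refine (hdis N).trans ?_
    have h1 := hE0 (box N)
    rw [hE]; gcongr
  have hg0 := fun N => good_galerkin hν hT (hc N) (hsupp N) (henE N) (hdE N)
  set H1 : ℝ≥0∞ := ∑ α, ENNReal.ofReal (E / (8 * π ^ 2 * ν α)) with hH1
  have hH1t : H1 ≠ ∞ := by simp [hH1]
  have hg1 : ∀ N α j, Good T E H1 (fun t => wG N t α j) := fun N α j =>
    (hg0 N α j).mono' le_rfl (Finset.single_le_sum (f := fun α =>
      ENNReal.ofReal (E / (8 * π ^ 2 * ν α))) (fun _ _ => zero_le) (Finset.mem_univ α))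
  set K : ℝ := 2 * E + 2 * Kd with hKdef
  set H2 : ℝ≥0∞ := ENNReal.ofReal Kd * ENNReal.ofReal T with hH2
  set H : ℝ≥0∞ := (2 * H1 + 2 * H2) + ENNReal.ofReal Kd with hH
  have hHt : H ≠ ∞ := by
    simp [hH, hH1t, hH2, ENNReal.mul_eq_top]
  have hgood : ∀ N, GoodS T K H (wG N) (fun t => tr (box N) (ph φ t)) := by
    intro N
    refine ⟨fun α j => (hg1 N α j).mono' (by linarith) ?_, fun j => ?_, ?_⟩
    · calc H1 ≤ 2 * H1 := by rw [two_mul]; exact le_self_add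
        _ ≤ 2 * H1 + 2 * H2 := le_self_add
        _ ≤ H := le_self_add
    · exact ((hg1 N 1 j).add (good_h_tr hd j (box N))).mono' le_rfl le_self_add
    · exact (good_d_tr hd (box N)).mono' (by linarith) le_add_self
  -- uniform Lipschitz bounds
  have hlw : ∀ N, ∀ t ∈ Set.Icc 0 T, ∀ α j, L2b E (wG N t α j) := fun N t ht α j =>
    L2b_of_EE (hsupp N t) (henE N t ht) α j
  let CC : Fin 2 × Fin 3 × Lat → ℝ := fun p => 4 * (|ν p.1| * (4 * π ^ 2 * latSq p.2.2) *
    Real.sqrt K + (12 * π * K * latSq p.2.2 + K))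
  have hKpos : 0 ≤ K := by positivity
  have hCC : ∀ p, 0 ≤ CC p := fun p => by
    have := latSq_nonneg p.2.2
    have := Real.pi_pos
    simp only [CC]; positivity
  have hdb : ∀ N, ∀ t ∈ Set.Icc 0 T, ∀ α j n,
      ‖lerayP n (fun j => RR ν (wG N t) (tr (box N) (ph φ t)) α j n) j‖ ≤ CC (α, j, n) := by
    intro N t ht α j n
    have hdt : L2b Kd (dd (tr (box N) (ph φ t))) := hd.mono fun n => by
      refine le_trans ?_ (norm_dd_ph_le φ ht.1 n)
      rw [norm_dd, norm_dd]
      have := norm_tr_le (box N) (ph φ t) n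
      have := latSq_nonneg n
      have := Real.pi_pos
      gcongr
    refine norm_lerayP_le _ _ _ fun i => norm_RR_le ?_ ?_ ?_ α i n
    · exact fun α i => (hlw N t ht α i).mono' (by linarith)
    · intro i
      exact (hlw N t ht 1 i).add (hdt.mono fun n => norm_grad_le _ i n)
    · exact hdt.mono' (by linarith)
  have hlip : ∀ N (p : Fin 2 × Fin 3 × Lat), ∀ s ∈ Set.Icc 0 T, ∀ t ∈ Set.Icc 0 T,
      ‖wG N s p.1 p.2.1 p.2.2 - wG N t p.1 p.2.1 p.2.2‖ ≤ CC p * |s - t| := by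
    rintro N ⟨α, j, n⟩ s hs t ht
    by_cases hn : n ∈ box N
    · have := (convex_Icc (0:ℝ) T).norm_image_sub_le_of_norm_hasDerivWithin_le
        (fun x hx => hder N x hx α j n hn) (fun x hx => hdb N x hx α j n) ht hs
      simpa [Real.norm_eq_abs] using this
    · simp only [hsupp N _ α j n hn, sub_self, norm_zero]
      exact mul_nonneg (hCC _) (abs_nonneg _)
  obtain ⟨σ, hσ, z, hz⟩ := arzela hT.le (fun N (p : Fin 2 × Fin 3 × Lat) t => wG N t p.1 p.2.1 p.2.2)
    (fun _ => Real.sqrt E) CC (fun N p t ht => (hlw N t ht p.1 p.2.1).norm_le p.2.2) hlip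
  refine ⟨K, H, σ, fun N => wG (σ N), fun t α j n => (Set.Icc 0 T).indicator (z (α, j, n)) t, hHt,
    ⟨hσ, fun N => hc _, fun N => hsymG _, fun N => hdivG _, fun N => hinit _, fun N => hder _,
    fun N => hen _, fun N => hsupp _, fun N => hgood _, ?_, ?_, ?_⟩⟩
  · intro α j n
    refine ⟨CC (α, j, n), fun N t ht => ?_⟩
    have := hlip (σ N) (α, j, n) t ht 0 ⟨le_rfl, hT.le⟩
    simpa [abs_of_nonneg ht.1] using this
  · intro α j n t ht
    rw [Set.indicator_of_mem ht]
    exact hz (α, j, n) t ht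
  · intro t ht
    funext α j n
    rw [Set.indicator_of_notMem ht]; rfl

/-! ### The limit in Fourier variables -/

lemma Extr.meas {ν : Fin 2 → ℝ} {T K : ℝ} {H : ℝ≥0∞} {φ : Lat → ℂ} {w0 : Fin 2 → Fin 3 → Lat → ℂ}
    {M : ℕ → ℕ} {wN : ℕ → ℝ → Fin 2 → Fin 3 → Lat → ℂ} {w : ℝ → Fin 2 → Fin 3 → Lat → ℂ}
    (h : Extr ν T K H φ w0 M wN w) (α : Fin 2) (j : Fin 3) (n : Lat) :
    Measurable fun t => w t α j n := by
  refine measurable_of_tendsto_metrizable (f := fun N => (Set.Icc 0 T).indicator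
    (fun t => wN N t α j n)) (fun N => (h.cont N α j n).measurable.indicator measurableSet_Icc) ?_
  rw [tendsto_pi_nhds]
  intro t
  by_cases ht : t ∈ Set.Icc 0 T
  · simp only [Set.indicator_of_mem ht]
    exact h.lim α j n t ht
  · simp only [Set.indicator_of_notMem ht, h.out t ht]
    exact tendsto_const_nhds

lemma Extr.lim_tr {M : ℕ → ℕ} (hM : StrictMono M) (φ : Lat → ℂ) (n : Lat) :
    Tendsto (fun N => tr (box (M N)) φ n) atTop (𝓝 (φ n)) := by
  obtain ⟨N0, hN0⟩ := exists_mem_box n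
  refine tendsto_const_nhds.congr' ?_
  filter_upwards [eventually_ge_atTop N0] with N hN
  have : n ∈ box (M N) := box_mono (hN.trans hM.le_apply) hN0
  simp [tr, this]

lemma Extr.limGood {ν : Fin 2 → ℝ} {T K : ℝ} {H : ℝ≥0∞} {φ : Lat → ℂ}
    {w0 : Fin 2 → Fin 3 → Lat → ℂ}
    {M : ℕ → ℕ} {wN : ℕ → ℝ → Fin 2 → Fin 3 → Lat → ℂ} {w : ℝ → Fin 2 → Fin 3 → Lat → ℂ}
    (h : Extr ν T K H φ w0 M wN w) : GoodS T K H w (ph φ) := by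
  have hl : ∀ α j n, ∀ t ∈ Set.Ioo 0 T, Tendsto (fun N => wN N t α j n) atTop (𝓝 (w t α j n)) :=
    fun α j n t ht => h.lim α j n t ⟨ht.1.le, ht.2.le⟩
  refine ⟨fun α j => Good.limit (fun N => (h.good N).gw α j) (h.meas α j)
    fun t ht n => hl α j n t ht, fun j => Good.limit (fun N => (h.good N).gB j)
    (fun n => (h.meas 1 j n).add ((measurable_ph φ n).const_mul _))
    fun t ht n => (hl 1 j n t ht).add ((Extr.lim_tr h.mono (ph φ t) n).const_mul _),
    Good.limit (fun N => (h.good N).gd) (fun n => (measurable_ph φ n).const_mul _)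
    fun t ht n => (Extr.lim_tr h.mono (ph φ t) n).const_mul _⟩

lemma Extr.sym {ν : Fin 2 → ℝ} {T K : ℝ} {H : ℝ≥0∞} {φ : Lat → ℂ} {w0 : Fin 2 → Fin 3 → Lat → ℂ}
    {M : ℕ → ℕ} {wN : ℕ → ℝ → Fin 2 → Fin 3 → Lat → ℂ} {w : ℝ → Fin 2 → Fin 3 → Lat → ℂ}
    (h : Extr ν T K H φ w0 M wN w) (t : ℝ) (α : Fin 2) (j : Fin 3) (n : Lat) :
    (starRingEnd ℂ) (w t α j n) = w t α j (-n) := by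
  by_cases ht : t ∈ Set.Icc 0 T
  · refine tendsto_nhds_unique ((Complex.continuous_conj.tendsto _).comp (h.lim α j n t ht)) ?_
    refine (h.lim α j (-n) t ht).congr fun N => ?_
    exact (h.symN N t α j n).symm
  · simp [h.out t ht]

lemma Extr.div {ν : Fin 2 → ℝ} {T K : ℝ} {H : ℝ≥0∞} {φ : Lat → ℂ} {w0 : Fin 2 → Fin 3 → Lat → ℂ}
    {M : ℕ → ℕ} {wN : ℕ → ℝ → Fin 2 → Fin 3 → Lat → ℂ} {w : ℝ → Fin 2 → Fin 3 → Lat → ℂ}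
    (h : Extr ν T K H φ w0 M wN w) (t : ℝ) (α : Fin 2) (n : Lat) :
    ∑ j, (n j : ℂ) * w t α j n = 0 := by
  by_cases ht : t ∈ Set.Icc 0 T
  · refine tendsto_nhds_unique (tendsto_finsetSum _ fun j _ => (h.lim α j n t ht).const_mul _) ?_
    simp only [h.divN]
    exact tendsto_const_nhds
  · simp [h.out t ht]

lemma Extr.weak {ν : Fin 2 → ℝ} {T K : ℝ} (hT : 0 < T) {H : ℝ≥0∞} (hH : H ≠ ∞) {φ : Lat → ℂ}
    {w0 : Fin 2 → Fin 3 → Lat → ℂ}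
    {M : ℕ → ℕ} {wN : ℕ → ℝ → Fin 2 → Fin 3 → Lat → ℂ} {w : ℝ → Fin 2 → Fin 3 → Lat → ℂ}
    (h : Extr ν T K H φ w0 M wN w) (α : Fin 2) (n : Lat) {θ θ' : ℝ → Fin 3 → ℂ}
    (hθ' : ∀ j, Continuous fun t => θ' t j) (hθ : ∀ t j, HasDerivAt (fun t => θ t j) (θ' t j) t)
    (h0 : θ 0 = 0) (h1 : θ T = 0) (hdiv : ∀ t, ∑ j, (n j : ℂ) * θ t j = 0) {C : ℝ}
    (hC : ∀ t j, ‖θ t j‖ ≤ C) (hC' : ∀ t j, ‖θ' t j‖ ≤ C) :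
    ∫ t in Set.Ioo 0 T, ∑ j, (w t α j n * θ' t j + RR ν (w t) (ph φ t) α j n * θ t j) = 0 := by
  have hθc : ∀ j, Continuous fun t => θ t j := fun j =>
    continuous_iff_continuousAt.2 fun t => (hθ t j).continuousAt
  have e : ∀ {w : ℝ → Fin 2 → Fin 3 → Lat → ℂ} {φ : ℝ → Lat → ℂ}, GoodS T K H w φ →
      ∫ t in Set.Ioo 0 T, ∑ j, (w t α j n * θ' t j + RR ν (w t) (φ t) α j n * θ t j)
      = ∑ j, ((∫ t in Set.Ioo 0 T, w t α j n * θ' t j)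
        + ∫ t in Set.Ioo 0 T, RR ν (w t) (φ t) α j n * θ t j) := by
    intro w φ hg
    have i1 := fun j => int_mul_bdd ((hg.gw α j).int_coef n) (hθ' j) (fun t => hC' t j)
    have i2 := fun j => int_mul_bdd (int_RR hg ν α j n) (hθc j) (fun t => hC t j)
    rw [integral_finsetSum]
    swap
    · exact fun j _ => (i1 j).add (i2 j)
    exact Finset.sum_congr rfl fun j _ => integral_add (i1 j) (i2 j)
  have hl : ∀ α j, ∀ t ∈ Set.Ioo 0 T, ∀ n, Tendsto (fun N => wN N t α j n) atTop (𝓝 (w t α j n)) :=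
    fun α j t ht n => h.lim α j n t ⟨ht.1.le, ht.2.le⟩
  have hlim : Tendsto (fun N => ∫ t in Set.Ioo 0 T, ∑ j, (wN N t α j n * θ' t j
      + RR ν (wN N t) (tr (box (M N)) (ph φ t)) α j n * θ t j)) atTop (𝓝 (∫ t in Set.Ioo 0 T,
        ∑ j, (w t α j n * θ' t j + RR ν (w t) (ph φ t) α j n * θ t j))) := by
    rw [e h.limGood]
    simp only [fun N => e (h.good N)]
    refine tendsto_finsetSum _ fun j _ => Tendsto.add ?_ ?_
    · exact coef_weak (fun N => (h.good N).gw α j) (hl α j) n (hθ' j) (fun t => hC' t j)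
    · exact RR_weak hH h.limGood h.good hl (fun t ht n => Extr.lim_tr h.mono (ph φ t) n) ν α j n
        (hθc j) (fun t => hC t j)
  refine tendsto_nhds_unique hlim (tendsto_const_nhds.congr' ?_)
  obtain ⟨N0, hN0⟩ := exists_mem_box n
  filter_upwards [eventually_ge_atTop N0] with N hN
  have hn : n ∈ box (M N) := box_mono (hN.trans h.mono.le_apply) hN0
  have i1 := fun j => int_mul_bdd (((h.good N).gw α j).int_coef n) (hθ' j) (fun t => hC' t j)
  have i2 := fun j => int_mul_bdd (int_RR (h.good N) ν α j n) (hθc j) (fun t => hC t j)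
  have hIntg : IntegrableOn (fun t => ∑ j, (wN N t α j n * θ' t j
      + RR ν (wN N t) (tr (box (M N)) (ph φ t)) α j n * θ t j)) (Set.Ioo 0 T) :=
    integrable_finsetSum _ fun j _ => (i1 j).add (i2 j)
  rw [← integral_Ioc_eq_integral_Ioo, ← intervalIntegral.integral_of_le hT.le]
  rw [intervalIntegral.integral_eq_sub_of_hasDerivAt_of_le hT.le
    (f := fun t => ∑ j, wN N t α j n * θ t j)]
  · simp [h0, h1]
  · exact Continuous.continuousOn (continuous_finsetSum _ fun j _ => (h.cont N α j n).mul (hθc j))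
  · intro t ht
    have hd : ∀ j, HasDerivAt (fun t => wN N t α j n)
        (lerayP n (fun j => RR ν (wN N t) (tr (box (M N)) (ph φ t)) α j n) j) t := fun j =>
      (h.der N t ⟨ht.1.le, ht.2.le⟩ α j n hn).hasDerivAt (Icc_mem_nhds ht.1 ht.2)
    have hs := HasDerivAt.fun_sum (u := Finset.univ) fun j (_ : j ∈ Finset.univ) =>
      (hd j).mul (hθ t j)
    refine hs.congr_deriv ?_
    have hp := lerayP_dot (hdiv t) (fun j => RR ν (wN N t) (tr (box (M N)) (ph φ t)) α j n)
    rw [Finset.sum_add_distrib, Finset.sum_add_distrib, add_comm]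
    congr 1
    calc _ = ∑ j, θ t j * lerayP n (fun j => RR ν (wN N t) (tr (box (M N)) (ph φ t)) α j n) j :=
          Finset.sum_congr rfl fun j _ => mul_comm _ _
      _ = _ := by
          rw [hp]
          exact Finset.sum_congr rfl fun j _ => mul_comm _ _
  · rw [intervalIntegrable_iff_integrableOn_Ioo_of_le hT.le]
    exact hIntg

lemma EE_mono {s S : Finset Lat} (h : s ⊆ S) (w : Fin 2 → Fin 3 → Lat → ℂ) : EE s w ≤ EE S w :=
  Finset.sum_le_sum_of_subset_of_nonneg h fun _ _ _ =>
    Finset.sum_nonneg fun _ _ => Finset.sum_nonneg fun _ _ => by positivity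

lemma Extr.energy {ν : Fin 2 → ℝ} {T K : ℝ} {H : ℝ≥0∞} {φ : Lat → ℂ}
    {w0 : Fin 2 → Fin 3 → Lat → ℂ}
    {M : ℕ → ℕ} {wN : ℕ → ℝ → Fin 2 → Fin 3 → Lat → ℂ} {w : ℝ → Fin 2 → Fin 3 → Lat → ℂ}
    (h : Extr ν T K H φ w0 M wN w) {E0 : ℝ} (hE0 : ∀ S, EE S w0 ≤ E0) {t : ℝ}
    (ht : t ∈ Set.Icc 0 T) (s : Finset Lat) : EE s (w t) ≤ E0 * Real.exp (GG φ t) := by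
  have hl : Tendsto (fun N => EE s (wN N t)) atTop (𝓝 (EE s (w t))) :=
    tendsto_finsetSum _ fun n _ => tendsto_finsetSum _ fun α _ => tendsto_finsetSum _ fun j _ =>
      ((h.lim α j n t ht).norm.pow 2)
  refine le_of_tendsto' hl fun N => ?_
  calc EE s (wN N t) ≤ EE (s ∪ box (M N)) (wN N t) := EE_mono Finset.subset_union_left _
    _ = EE (box (M N)) (wN N t) := by
        refine (Finset.sum_subset Finset.subset_union_right fun n _ hn => ?_).symm
        simp [h.supp N t _ _ n hn]
    _ ≤ EE (box (M N)) w0 * Real.exp (GG φ t) := h.en N t ht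
    _ ≤ _ := by have := hE0 (box (M N)); gcongr

lemma Extr.coef_tendsto {ν : Fin 2 → ℝ} {T K : ℝ} (hT : 0 < T) {H : ℝ≥0∞} {φ : Lat → ℂ}
    {w0 : Fin 2 → Fin 3 → Lat → ℂ}
    {M : ℕ → ℕ} {wN : ℕ → ℝ → Fin 2 → Fin 3 → Lat → ℂ} {w : ℝ → Fin 2 → Fin 3 → Lat → ℂ}
    (h : Extr ν T K H φ w0 M wN w) (α : Fin 2) (j : Fin 3) (n : Lat) :
    Tendsto (fun t => w t α j n) (𝓝[>] 0) (𝓝 (w0 α j n)) := by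
  obtain ⟨C, hC⟩ := h.lip α j n
  have hw00 : w 0 α j n = w0 α j n := by
    refine tendsto_nhds_unique (h.lim α j n 0 ⟨le_rfl, hT.le⟩) (tendsto_const_nhds.congr' ?_)
    obtain ⟨N0, hN0⟩ := exists_mem_box n
    filter_upwards [eventually_ge_atTop N0] with N hN
    exact (h.atZero N α j n (box_mono (hN.trans h.mono.le_apply) hN0)).symm
  rw [← hw00, tendsto_iff_norm_sub_tendsto_zero]
  have hb : Tendsto (fun t : ℝ => C * t) (𝓝[>] 0) (𝓝 0) := by
    have : Tendsto (fun t : ℝ => C * t) (𝓝 0) (𝓝 (C * 0)) := (continuous_const.mul continuous_id).tendsto 0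
    rw [mul_zero] at this
    exact this.mono_left nhdsWithin_le_nhds
  refine squeeze_zero' (Eventually.of_forall fun _ => norm_nonneg _) ?_ hb
  filter_upwards [Ioo_mem_nhdsGT hT] with t ht
  have ht' : t ∈ Set.Icc 0 T := ⟨ht.1.le, ht.2.le⟩
  exact le_of_tendsto' ((h.lim α j n t ht').sub (h.lim α j n 0 ⟨le_rfl, hT.le⟩)).norm
    fun N => hC N t ht'

lemma Extr.init_strong {ν : Fin 2 → ℝ} {T K : ℝ} (hT : 0 < T) {H : ℝ≥0∞} {φ : Lat → ℂ} {Kd : ℝ}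
    (hd : L2b Kd (dd φ)) {w0 : Fin 2 → Fin 3 → Lat → ℂ}
    {M : ℕ → ℕ} {wN : ℕ → ℝ → Fin 2 → Fin 3 → Lat → ℂ} {w : ℝ → Fin 2 → Fin 3 → Lat → ℂ}
    (h : Extr ν T K H φ w0 M wN w) (hw0 : Summable fun n => ∑ α, ∑ j, ‖w0 α j n‖ ^ 2)
    {ε : ℝ} (hε : 0 < ε) :
    ∀ᶠ t in 𝓝[>] (0:ℝ), ∀ s, EE s (fun α j n => w t α j n - w0 α j n) ≤ ε := by
  set E0 : ℝ := ∑' n, ∑ α, ∑ j, ‖w0 α j n‖ ^ 2 with hE0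
  have hnn : ∀ n, 0 ≤ ∑ α, ∑ j, ‖w0 α j n‖ ^ 2 := fun n =>
    Finset.sum_nonneg fun _ _ => Finset.sum_nonneg fun _ _ => by positivity
  have hEle : ∀ S, EE S w0 ≤ E0 := fun S => hw0.sum_le_tsum S fun n _ => hnn n
  obtain ⟨S, hS⟩ : ∃ S, E0 - ε / 8 < EE S w0 :=
    ((hw0.hasSum.eventually_const_lt (show E0 - ε / 8 < E0 by linarith))).exists
  have l1 : Tendsto (fun t => EE S (fun α j n => w t α j n - w0 α j n)) (𝓝[>] 0) (𝓝 0) := by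
    have : Tendsto (fun t => EE S (fun α j n => w t α j n - w0 α j n)) (𝓝[>] 0)
        (𝓝 (∑ n ∈ S, ∑ α, ∑ j, ‖w0 α j n - w0 α j n‖ ^ 2)) :=
      tendsto_finsetSum _ fun n _ => tendsto_finsetSum _ fun α _ => tendsto_finsetSum _ fun j _ =>
        (((h.coef_tendsto hT α j n).sub_const _).norm.pow 2)
    simpa using this
  have l2 : Tendsto (fun t => E0 * Real.exp (GG φ t) - EE S (w t)) (𝓝[>] 0)
      (𝓝 (E0 * Real.exp 0 - EE S w0)) :=
    (((Real.continuous_exp.tendsto 0).comp (GG_tendsto φ fun n => hd.norm_le n)).const_mul E0).sub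
      (tendsto_finsetSum _ fun n _ => tendsto_finsetSum _ fun α _ => tendsto_finsetSum _ fun j _ =>
        ((h.coef_tendsto hT α j n).norm.pow 2))
  rw [Real.exp_zero, mul_one] at l2
  filter_upwards [l1.eventually_lt_const (show 0 < ε / 4 by linarith),
    l2.eventually_lt_const (show E0 - EE S w0 < ε / 8 by linarith), Ioo_mem_nhdsGT hT] with t h1 h2 ht s
  have hdis : ∀ v : Fin 2 → Fin 3 → Lat → ℂ, EE (s ∪ S) v = EE S v + EE (s \ S) v := by
    intro v
    unfold EE
    rw [← Finset.sdiff_union_self_eq_union, Finset.sum_union Finset.sdiff_disjoint, add_comm]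
  have a1 := h.energy hEle ⟨ht.1.le, ht.2.le⟩ (s ∪ S)
  have a2 := hEle (s ∪ S)
  rw [hdis] at a1 a2
  have a3 : EE (s \ S) (fun α j n => w t α j n - w0 α j n)
      ≤ 2 * EE (s \ S) (w t) + 2 * EE (s \ S) w0 := by
    unfold EE
    rw [Finset.mul_sum, Finset.mul_sum, ← Finset.sum_add_distrib]
    refine Finset.sum_le_sum fun n _ => ?_
    rw [Finset.mul_sum, Finset.mul_sum, ← Finset.sum_add_distrib]
    refine Finset.sum_le_sum fun α _ => ?_
    rw [Finset.mul_sum, Finset.mul_sum, ← Finset.sum_add_distrib]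
    refine Finset.sum_le_sum fun j _ => ?_
    have := norm_sub_le (w t α j n) (w0 α j n)
    have h0 := norm_nonneg (w t α j n - w0 α j n)
    nlinarith [sq_nonneg (‖w t α j n‖ - ‖w0 α j n‖)]
  have a4 := hdis (fun α j n => w t α j n - w0 α j n)
  have a5 := EE_mono (Finset.subset_union_left (s₁ := s) (s₂ := S))
    (fun α j n => w t α j n - w0 α j n)
  linarith

/-! ### Part E1: initial data -/

lemma pd_re {g : Vec → ℂ} (hg : ContDiff ℝ (⊤ : ℕ∞) g) (i : Fin 3) (x : Vec) :
    pd i (fun y => (g y).re) x = (pd i g x).re := by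
  unfold pd
  have h := (Complex.reCLM.hasFDerivAt (x := g x)).comp x
    ((hg.differentiable (by simp)) x).hasFDerivAt
  have h2 : HasFDerivAt (fun y => (g y).re) (Complex.reCLM.comp (fderiv ℝ g x)) x := h
  rw [h2.fderiv]
  rfl

lemma pd_im {g : Vec → ℂ} (hg : ContDiff ℝ (⊤ : ℕ∞) g) (i : Fin 3) (x : Vec) :
    pd i (fun y => (g y).im) x = (pd i g x).im := by
  unfold pd
  have h := (Complex.imCLM.hasFDerivAt (x := g x)).comp x
    ((hg.differentiable (by simp)) x).hasFDerivAt
  have h2 : HasFDerivAt (fun y => (g y).im) (Complex.imCLM.comp (fderiv ℝ g x)) x := h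
  rw [h2.fderiv]
  rfl

lemma fc_of_weakdiv {f : Vec → ℝ} {F : Fin 3 → Vec → ℝ}
    (hf : Integrable (fun x => (f x : ℂ)) μT) (hF : ∀ j, Integrable (fun x => (F j x : ℂ)) μT)
    (h : ∀ g : SpTest ℝ, (∫ x in cube, (f x * g.f x + ∑ j, F j x * pd j g.f x)) = 0) (n : Lat) :
    fc (fun x => (f x : ℂ)) n = 2 * π * I * ∑ j, (n j : ℂ) * fc (fun x => (F j x : ℂ)) n := by
  have hs := chr_contDiff (-n)
  have hI : Integrable (fun x => (f x : ℂ) * chr (-n) x + ∑ j, (F j x : ℂ) * pd j (chr (-n)) x) μT := by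
    have i1 : Integrable (fun x => (f x : ℂ) * chr (-n) x) μT := by
      have := integrable_mul_chr hf n
      simpa only [chr_conj] using this
    have i2 : ∀ j, Integrable (fun x => (F j x : ℂ) * pd j (chr (-n)) x) μT := by
      intro j
      have := (integrable_mul_chr (hF j) n).const_mul (2 * π * I * ((-n) j : ℂ))
      simp only [chr_conj] at this
      refine this.congr (Eventually.of_forall fun x => ?_)
      simp only [pd_chr]
      simp
      ring
    exact i1.add (integrable_finsetSum _ fun j _ => i2 j)
  have h0 : ∫ x, ((f x : ℂ) * chr (-n) x + ∑ j, (F j x : ℂ) * pd j (chr (-n)) x) ∂μT = 0 := by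
    apply Complex.ext
    · have e := (Complex.reCLM.integral_comp_comm hI)
      simp only [Complex.reCLM_apply] at e
      rw [← e]
      have := h ⟨fun x => (chr (-n) x).re, Complex.reCLM.contDiff.comp hs,
        fun x m => by simp only [chr_per _ x m]⟩
      simp only [pd_re hs] at this
      rw [Complex.zero_re, ← this]
      show _ = ∫ x, _ ∂μT
      congr 1
      funext x
      simp
    · have e := (Complex.imCLM.integral_comp_comm hI)
      simp only [Complex.imCLM_apply] at e
      rw [← e]
      have := h ⟨fun x => (chr (-n) x).im, Complex.imCLM.contDiff.comp hs,
        fun x m => by simp only [chr_per _ x m]⟩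
      simp only [pd_im hs] at this
      rw [Complex.zero_im, ← this]
      show _ = ∫ x, _ ∂μT
      congr 1
      funext x
      simp
  have e1 : ∀ j, ∫ x, (F j x : ℂ) * pd j (chr (-n)) x ∂μT
      = - (2 * π * I * ((n j : ℂ) * fc (fun x => (F j x : ℂ)) n)) := by
    intro j
    rw [fc_eq]
    simp only [chr_conj, pd_chr]
    rw [← integral_const_mul, ← integral_const_mul, ← integral_neg]
    congr 1
    funext x
    simp
    ring
  rw [integral_add, integral_finsetSum] at h0
  · simp only [e1] at h0
    rw [fc_eq]
    simp only [chr_conj]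
    rw [Finset.sum_neg_distrib, ← Finset.mul_sum] at h0
    exact sub_eq_zero.mp (by rw [sub_eq_add_neg]; exact h0)
  all_goals
    have i2 : ∀ j, Integrable (fun x => (F j x : ℂ) * pd j (chr (-n)) x) μT := by
      intro j
      have := (integrable_mul_chr (hF j) n).const_mul (2 * π * I * ((-n) j : ℂ))
      simp only [chr_conj] at this
      refine this.congr (Eventually.of_forall fun x => ?_)
      simp only [pd_chr]
      simp
      ring
  · exact fun j _ => i2 j
  · have := integrable_mul_chr hf n
    simpa only [chr_conj] using this
  · exact integrable_finsetSum _ fun j _ => i2 j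

lemma memLp_comp {u : Vec → Vec} (hm : Measurable u) (hu : eLpNorm u 2 μT < ∞) (j : Fin 3) :
    MemLp (fun x => (u x j : ℂ)) 2 μT := by
  have h : MemLp u 2 μT := ⟨hm.aestronglyMeasurable, hu⟩
  have hc : Continuous (fun v : Vec => (v j : ℂ)) := by fun_prop
  refine h.mono (hc.measurable.comp hm).aestronglyMeasurable (Eventually.of_forall fun x => ?_)
  simpa using PiLp.norm_apply_le (u x) j

lemma memLp_scal {f : Vec → ℝ} (hm : Measurable f) (hu : eLpNorm f 2 μT < ∞) :
    MemLp (fun x => (f x : ℂ)) 2 μT := by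
  have h : MemLp f 2 μT := ⟨hm.aestronglyMeasurable, hu⟩
  exact h.ofReal

lemma L2b_of_memLp {f : Vec → ℂ} (hf : MemLp f 2 μT) : ∃ K, L2b K (fc f) :=
  ⟨_, fun s => sum_le_hasSum s (fun _ _ => by positivity) (parseval_sq hf)⟩

/-- Fourier data of the initial fields. -/
structure Init (u₀ B₀ : Vec → Vec) (dB₀ : Vec → ℝ) (φ : Lat → ℂ)
    (w0 : Fin 2 → Fin 3 → Lat → ℂ) : Prop where
  hu : ∀ j n, w0 0 j n = fc (fun x => (u₀ x j : ℂ)) n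
  hB : ∀ j n, Bf w0 φ j n = fc (fun x => (B₀ x j : ℂ)) n
  hd : ∀ n, dd φ n = fc (fun x => (dB₀ x : ℂ)) n
  cφ : ∀ n, (starRingEnd ℂ) (φ n) = - φ (-n)
  cw : ∀ α j n, (starRingEnd ℂ) (w0 α j n) = w0 α j (-n)
  dw : ∀ α n, ∑ j, (n j : ℂ) * w0 α j n = 0
  sw : Summable fun n => ∑ α, ∑ j, ‖w0 α j n‖ ^ 2

lemma exists_init {u₀ B₀ : Vec → Vec} {dB₀ : Vec → ℝ}
    (hu : ∀ j, MemLp (fun x => (u₀ x j : ℂ)) 2 μT)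
    (hB : ∀ j, MemLp (fun x => (B₀ x j : ℂ)) 2 μT)
    (hd : MemLp (fun x => (dB₀ x : ℂ)) 2 μT)
    (hdiv : ∀ g : SpTest ℝ,
      (∫ x in cube, (dB₀ x * g.f x + ∑ j, B₀ x j * pd j g.f x)) = 0)
    (hudiv : ∀ g : SpTest ℝ, (∫ x in cube, ∑ j, u₀ x j * pd j g.f x) = 0) :
    ∃ φ w0, Init u₀ B₀ dB₀ φ w0 := by
  set b : Fin 3 → Lat → ℂ := fun j => fc (fun x => (B₀ x j : ℂ)) with hb
  set a : Fin 3 → Lat → ℂ := fun j => fc (fun x => (u₀ x j : ℂ)) with ha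
  have hIntg : ∀ {f : Vec → ℂ}, MemLp f 2 μT → Integrable f μT := fun h => h.integrable (by norm_num)
  have H1 : ∀ n, fc (fun x => (dB₀ x : ℂ)) n = 2 * π * I * ∑ j, (n j : ℂ) * b j n :=
    fc_of_weakdiv (F := fun j x => B₀ x j) (hIntg hd) (fun j => hIntg (hB j)) hdiv
  have H2 : ∀ n, ∑ j, (n j : ℂ) * a j n = 0 := by
    intro n
    have := fc_of_weakdiv (f := fun _ => 0) (F := fun j x => u₀ x j) (by simp)
      (fun j => hIntg (hu j)) (fun g => by simpa using hudiv g) n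
    have h0 : fc (fun _ => ((0:ℝ) : ℂ)) n = 0 := by simp [fc]
    rw [h0] at this
    have h2 : (2 * π * I : ℂ) ≠ 0 := by simp [Real.pi_ne_zero]
    exact (mul_eq_zero.mp this.symm).resolve_left h2
  set φ : Lat → ℂ := fun n => (∑ j, (n j : ℂ) * b j n) / (latSq n : ℂ) with hφ
  have cb : ∀ j n, (starRingEnd ℂ) (b j n) = b j (-n) := fun j n => fc_real_conj _ n
  have hdd : ∀ n, dd φ n = fc (fun x => (dB₀ x : ℂ)) n := by
    intro n
    rw [H1, dd]
    by_cases h : latSq n = 0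
    · have := latSq_eq_zero h
      subst this
      simp [h]
    · have h' : (latSq n : ℂ) ≠ 0 := by exact_mod_cast h
      simp only [hφ]
      field_simp
  refine ⟨φ, ![a, fun j n => lerayP n (fun j => b j n) j], ?_, ?_, hdd, ?_, ?_, ?_, ?_⟩
  · intro j n; simp [ha]
  · intro j n
    simp [Bf, lerayP, hφ, hb]
    ring
  · intro n
    simp only [hφ, map_div₀, map_sum, map_mul, cb, latSq_neg, Complex.conj_ofReal]
    rw [← neg_div, ← Finset.sum_neg_distrib]
    congr 1
    refine Finset.sum_congr rfl fun j _ => ?_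
    simp
  · intro α j n
    fin_cases α
    · exact fc_real_conj _ n
    · show (starRingEnd ℂ) (lerayP n (fun j => b j n) j) = lerayP (-n) (fun j => b j (-n)) j
      rw [lerayP_neg, lerayP_conj]
      simp only [cb]
  · intro α n
    fin_cases α
    · exact H2 n
    · exact lerayP_div _ _
  · simp only [Fin.sum_univ_two]
    refine Summable.add (summable_sum fun j _ => (parseval_sq (hu j)).summable)
      (summable_sum fun j _ => ?_)
    refine Summable.of_nonneg_of_le (fun n => by positivity) (fun n => ?_)
      (((parseval_sq (hB j)).summable.mul_left 2).add ((parseval_sq hd).summable.mul_left 2))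
    have e : lerayP n (fun j => b j n) j = b j n - (n j : ℂ) * φ n := by
      simp only [lerayP, hφ]; ring
    have h1 : ‖(n j : ℂ) * φ n‖ ≤ ‖fc (fun x => (dB₀ x : ℂ)) n‖ := by
      rw [← hdd]; exact norm_grad_le φ j n
    show ‖lerayP n (fun j => b j n) j‖ ^ 2 ≤ _
    rw [e]
    have h2 := norm_sub_le (b j n) ((n j : ℂ) * φ n)
    have h3 : ‖b j n - (n j : ℂ) * φ n‖ ≤ ‖b j n‖ + ‖fc (fun x => (dB₀ x : ℂ)) n‖ := by linarith
    have h4 := pow_le_pow_left₀ (norm_nonneg _) h3 2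
    show _ ≤ 2 * ‖b j n‖ ^ 2 + _
    nlinarith [sq_nonneg (‖b j n‖ - ‖fc (fun x => (dB₀ x : ℂ)) n‖)]

/-! ### Part E2: fields from coefficients -/

structure Fld (T : ℝ) (c : ℝ → Lat → ℂ) (f0 : Vec → ℝ) (f : ℝ → Vec → ℝ) : Prop where
  meas : Measurable (Function.uncurry f)
  per : ∀ t, Per (f t)
  alt : ∀ t ∈ Set.Ioo 0 T, f t = f0 ∨
    (MemLp (fun x => (f t x : ℂ)) 2 μT ∧ ∀ n, fc (fun x => (f t x : ℂ)) n = c t n)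
  ae : ∀ᵐ t ∂(tIoo T), MemLp (fun x => (f t x : ℂ)) 2 μT ∧ ∀ n, fc (fun x => (f t x : ℂ)) n = c t n

lemma exists_fld {T K : ℝ} {H : ℝ≥0∞} (hH : H ≠ ∞) {c : ℝ → Lat → ℂ} (hc : Good T K H c)
    (hsym : ∀ t n, (starRingEnd ℂ) (c t n) = c t (-n)) {f0 : Vec → ℝ} (hm : Measurable f0)
    (hp : Per f0) : ∃ f, Fld T c f0 f := by
  classical
  set S : ℝ → ℝ≥0∞ := fun t => ∑' n, ENNReal.ofReal (latSq n * ‖c t n‖ ^ 2) with hS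
  have hSm : Measurable S := Measurable.ennreal_tsum fun n =>
    (((hc.meas n).norm.pow_const 2).const_mul _).ennreal_ofReal
  set G : Set ℝ := {t | t ∈ Set.Ioo 0 T ∧ S t < ∞} with hG
  have hGm : MeasurableSet G := measurableSet_Ioo.inter (hSm measurableSet_Iio)
  have hspec : ∀ t ∈ G, MemLp (fun x => (rcn (c t) x : ℂ)) 2 μT ∧
      ∀ n, fc (fun x => (rcn (c t) x : ℂ)) n = c t n := by
    intro t ht
    refine rcn_spec (hsym t) (H := K + (S t).toReal) fun s => ?_
    have h1 := hc.l2 t ht.1 s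
    have h2 : ∑ n ∈ s, latSq n * ‖c t n‖ ^ 2 ≤ (S t).toReal := by
      rw [← ENNReal.ofReal_le_iff_le_toReal ht.2.ne, ENNReal.ofReal_sum_of_nonneg]
      · exact ENNReal.sum_le_tsum s
      · intro n _
        have := latSq_nonneg n
        positivity
    simp only [add_mul, one_mul, Finset.sum_add_distrib]
    exact add_le_add h1 h2
  refine ⟨fun t x => if t ∈ G then rcn (c t) x else f0 x, ?_, ?_, ?_, ?_⟩
  · exact Measurable.ite (measurable_fst hGm) (measurable_rcn hc.meas) (hm.comp measurable_snd)
  · intro t x n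
    by_cases h : t ∈ G
    · simp only [h, if_true]; exact rcn_per _ x n
    · simp only [h, if_false]; exact hp x n
  · intro t _
    by_cases h : t ∈ G
    · right
      simp only [h, if_true]
      exact hspec t h
    · left
      simp only [h, if_false]
  · have h1 : ∀ᵐ t ∂(tIoo T), S t < ∞ :=
      ae_lt_top hSm (ne_top_of_le_ne_top hH hc.h1)
    have h2 : ∀ᵐ t ∂(tIoo T), t ∈ Set.Ioo 0 T := ae_restrict_mem measurableSet_Ioo
    filter_upwards [h1, h2] with t a b
    have h : t ∈ G := ⟨b, a⟩
    simp only [h, if_true]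
    exact hspec t h

lemma eLpNorm_ofReal_eq (f : Vec → ℝ) : eLpNorm (fun x => (f x : ℂ)) 2 μT = eLpNorm f 2 μT :=
  eLpNorm_congr_norm_ae (Eventually.of_forall fun x => by simp)

lemma Fld.bound {T K : ℝ} {H : ℝ≥0∞} {c : ℝ → Lat → ℂ} {f0 : Vec → ℝ} {f : ℝ → Vec → ℝ}
    (h : Fld T c f0 f) (hc : Good T K H c) :
    ∀ᵐ t ∂(tIoo T), eLpNorm (f t) 2 μT ≤ ENNReal.ofReal K ^ (1/2 : ℝ) := by
  have h2 : ∀ᵐ t ∂(tIoo T), t ∈ Set.Ioo 0 T := ae_restrict_mem measurableSet_Ioo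
  filter_upwards [h.ae, h2] with t ⟨a, b⟩ ht
  have e := eLpNorm_sq_eq a
  rw [eLpNorm_ofReal_eq] at e
  simp only [b] at e
  have e2 := (hc.l2 t ht).etsum_le
  rw [← e] at e2
  calc eLpNorm (f t) 2 μT = (eLpNorm (f t) 2 μT ^ 2) ^ (1/2 : ℝ) := by
        rw [← ENNReal.rpow_natCast, ← ENNReal.rpow_mul]; simp
    _ ≤ _ := ENNReal.rpow_le_rpow e2 (by norm_num)

lemma Fld.hs {T K : ℝ} {H : ℝ≥0∞} (hH : H ≠ ∞) {c : ℝ → Lat → ℂ} {f0 : Vec → ℝ}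
    {f : ℝ → Vec → ℝ} (h : Fld T c f0 f) (hc : Good T K H c) :
    ∃ g : ℝ → ℝ≥0∞, Measurable g ∧ (∫⁻ t, g t ∂(tIoo T)) ≠ ∞ ∧
      ∀ᵐ t ∂(tIoo T), HsNorm 1 (fun x => (f t x : ℂ)) = g t ^ (1/2 : ℝ) := by
  have hm : ∀ n, Measurable fun t => ‖c t n‖ ^ 2 := fun n => (hc.meas n).norm.pow_const 2
  refine ⟨fun t => ∑' n, ENNReal.ofReal (‖c t n‖ ^ 2)
    + ∑' n, ENNReal.ofReal (latSq n * ‖c t n‖ ^ 2), ?_, ?_, ?_⟩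
  · exact (Measurable.ennreal_tsum fun n => (hm n).ennreal_ofReal).add
      (Measurable.ennreal_tsum fun n => ((hm n).const_mul _).ennreal_ofReal)
  · rw [lintegral_add_left (Measurable.ennreal_tsum fun n => (hm n).ennreal_ofReal)]
    refine ENNReal.add_ne_top.mpr ⟨?_, ne_top_of_le_ne_top hH hc.h1⟩
    have : ∫⁻ t, ∑' n, ENNReal.ofReal (‖c t n‖ ^ 2) ∂(tIoo T)
        ≤ ∫⁻ t in Set.Ioo 0 T, ENNReal.ofReal K :=
      setLIntegral_mono' measurableSet_Ioo fun t ht => (hc.l2 t ht).etsum_le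
    refine ne_top_of_le_ne_top ?_ this
    simp [ENNReal.mul_eq_top]
  · filter_upwards [h.ae] with t ⟨a, b⟩
    unfold HsNorm HsNormC sobSqC
    simp only [b]
    rw [← ENNReal.tsum_add]
    congr 2
    funext n
    rw [← ENNReal.ofReal_add (by positivity) (by have := latSq_nonneg n; positivity), latNorm_sq,
      Real.rpow_one]
    congr 1
    ring

lemma Fld.atZero {T : ℝ} (hT : 0 < T) {c : ℝ → Lat → ℂ} {f0 : Vec → ℝ} {f : ℝ → Vec → ℝ}
    (h : Fld T c f0 f) (h0 : MemLp (fun x => (f0 x : ℂ)) 2 μT)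
    (hc : ∀ ε > 0, ∀ᶠ t in 𝓝[>] (0:ℝ), L2b ε (fun n => c t n - fc (fun x => (f0 x : ℂ)) n)) :
    Tendsto (fun t => eLpNorm (fun x => f t x - f0 x) 2 μT) (𝓝[>] 0) (𝓝 0) := by
  have hsq : Tendsto (fun t => eLpNorm (fun x => f t x - f0 x) 2 μT ^ 2) (𝓝[>] 0) (𝓝 0) := by
    rw [ENNReal.tendsto_nhds_zero]
    intro ε hε
    obtain ⟨δ, hδ0, hδ⟩ : ∃ δ : ℝ, 0 < δ ∧ ENNReal.ofReal δ ≤ ε := by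
      obtain ⟨δ, hδ0, hδ⟩ := ENNReal.lt_iff_exists_nnreal_btwn.mp hε
      refine ⟨δ, by exact_mod_cast hδ0, ?_⟩
      rw [ENNReal.ofReal_coe_nnreal]; exact hδ.le
    filter_upwards [hc δ hδ0, Ioo_mem_nhdsGT hT] with t a ht
    rcases h.alt t ht with e | ⟨m, e⟩
    · simp [e]
    · have hs : MemLp (fun x => (f t x : ℂ) - (f0 x : ℂ)) 2 μT := m.sub h0
      have e1 := eLpNorm_sq_eq hs
      have e2 : eLpNorm (fun x => f t x - f0 x) 2 μT
          = eLpNorm (fun x => (f t x : ℂ) - (f0 x : ℂ)) 2 μT := by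
        rw [← eLpNorm_ofReal_eq]; simp
      rw [e2, e1]
      refine le_trans (le_of_eq ?_) (a.etsum_le.trans hδ)
      congr 1
      funext n
      rw [fc_sub (m.integrable (by norm_num)) (h0.integrable (by norm_num)), e]
  have := (ENNReal.continuous_rpow_const (y := (1/2:ℝ))).tendsto 0 |>.comp hsq
  rw [ENNReal.zero_rpow_of_pos (by norm_num)] at this
  refine this.congr fun t => ?_
  simp only [Function.comp]
  rw [← ENNReal.rpow_natCast, ← ENNReal.rpow_mul]; simp

/-- Assemble a vector field from components. -/
def mkV (f : Fin 3 → ℝ → Vec → ℝ) (t : ℝ) (x : Vec) : Vec := WithLp.toLp 2 (fun j => f j t x)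

@[simp] lemma mkV_apply (f : Fin 3 → ℝ → Vec → ℝ) (t : ℝ) (x : Vec) (j : Fin 3) :
    mkV f t x j = f j t x := rfl

lemma mkV_meas {f : Fin 3 → ℝ → Vec → ℝ} (hf : ∀ j, Measurable (Function.uncurry (f j))) :
    Measurable (Function.uncurry (mkV f)) := by
  have : Measurable fun p : ℝ × Vec => fun j => Function.uncurry (f j) p :=
    measurable_pi_lambda _ hf
  exact (MeasurableEquiv.toLp 2 (Fin 3 → ℝ)).measurable.comp this

lemma eLpNorm_vec_le {u : Vec → Vec} (hm : Measurable u) :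
    eLpNorm u 2 μT ≤ ∑ j, eLpNorm (fun x => u x j) 2 μT := by
  have h1 : ∀ j, AEStronglyMeasurable (fun x => |u x j|) μT := by
    intro j
    have hc : Continuous (fun v : Vec => |v j|) := by fun_prop
    exact (hc.measurable.comp hm).aestronglyMeasurable
  calc eLpNorm u 2 μT ≤ eLpNorm (∑ j, fun x => |u x j|) 2 μT := by
        refine eLpNorm_mono_real fun x => ?_
        rw [EuclideanSpace.norm_eq, Finset.sum_apply]
        rw [Real.sqrt_le_left (Finset.sum_nonneg fun _ _ => abs_nonneg _)]
        simp only [Real.norm_eq_abs]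
        exact Finset.sum_sq_le_sq_sum_of_nonneg (fun _ _ => abs_nonneg _)
    _ ≤ ∑ j, eLpNorm (fun x => |u x j|) 2 μT := eLpNorm_sum_le (fun j _ => h1 j) (by norm_num)
    _ = _ := by
        refine Finset.sum_congr rfl fun j _ => ?_
        exact eLpNorm_congr_norm_ae (Eventually.of_forall fun x => by simp)

lemma timeNorm_top_lt {T : ℝ} {F : ℝ → ℝ≥0∞} {C : ℝ≥0∞} (hC : C < ∞)
    (h : ∀ᵐ t ∂(tIoo T), F t ≤ C) : timeNorm ∞ T F < ∞ := by
  unfold timeNorm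
  rw [if_pos rfl]
  exact (essSup_le_of_ae_le _ h).trans_lt hC

lemma timeNorm_two_lt {T : ℝ} {F g : ℝ → ℝ≥0∞} {C : ℝ≥0∞} (hC : C ≠ ∞)
    (hg : (∫⁻ t, g t ∂(tIoo T)) ≠ ∞)
    (h : ∀ᵐ t ∂(tIoo T), F t ^ 2 ≤ C * g t) : timeNorm 2 T F < ∞ := by
  unfold timeNorm
  rw [if_neg (by norm_num)]
  refine ENNReal.rpow_lt_top_of_nonneg (by positivity) ?_
  refine ne_top_of_le_ne_top (b := ∫⁻ t, C * g t ∂(tIoo T)) ?_ (lintegral_mono_ae ?_)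
  · rw [lintegral_const_mul' _ _ hC]
    exact ENNReal.mul_ne_top hC hg
  · filter_upwards [h] with t ht
    simpa using ht

lemma vec_bound {T K : ℝ} {H : ℝ≥0∞} {c : Fin 3 → ℝ → Lat → ℂ} {f0 : Fin 3 → Vec → ℝ}
    {f : Fin 3 → ℝ → Vec → ℝ} (h : ∀ j, Fld T (c j) (f0 j) (f j)) (hc : ∀ j, Good T K H (c j)) :
    timeNorm ∞ T (fun t => eLpNorm (mkV f t) 2 μT) < ∞ := by
  refine timeNorm_top_lt (C := ∑ j : Fin 3, ENNReal.ofReal K ^ (1/2 : ℝ)) ?_ ?_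
  · exact ENNReal.sum_lt_top.mpr fun j _ =>
      ENNReal.rpow_lt_top_of_nonneg (by norm_num) ENNReal.ofReal_ne_top
  · have := fun j => (h j).bound (hc j)
    filter_upwards [ae_all_iff.mpr this] with t ht
    have hm : Measurable (mkV f t) := (mkV_meas fun j => (h j).meas).comp measurable_prodMk_left
    exact (eLpNorm_vec_le hm).trans (Finset.sum_le_sum fun j _ => ht j)

lemma vec_hs {T K : ℝ} {H : ℝ≥0∞} (hH : H ≠ ∞) {c : Fin 3 → ℝ → Lat → ℂ} {f0 : Fin 3 → Vec → ℝ}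
    {f : Fin 3 → ℝ → Vec → ℝ} (h : ∀ j, Fld T (c j) (f0 j) (f j)) (hc : ∀ j, Good T K H (c j)) :
    timeNorm 2 T (fun t => HsNormV 1 (mkV f t)) < ∞ := by
  choose g hgm hg1 hg2 using fun j => (h j).hs hH (hc j)
  refine timeNorm_two_lt (C := 9) (g := fun t => ∑ j, g j t) (by norm_num) ?_ ?_
  · rw [lintegral_finsetSum _ fun j _ => hgm j]
    exact ENNReal.sum_ne_top.mpr fun j _ => hg1 j
  · filter_upwards [ae_all_iff.mpr hg2] with t ht
    unfold HsNormV
    simp only [mkV_apply, ht]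
    have : ∑ j, g j t ^ (1/2:ℝ) ≤ ∑ j : Fin 3, (∑ i, g i t) ^ (1/2:ℝ) :=
      Finset.sum_le_sum fun j _ => ENNReal.rpow_le_rpow
        (Finset.single_le_sum (f := fun j => g j t) (fun _ _ => zero_le) (Finset.mem_univ j))
        (by norm_num)
    refine (pow_le_pow_left' this 2).trans ?_
    rw [Finset.sum_const, nsmul_eq_mul, mul_pow, ← ENNReal.rpow_natCast (_ ^ (1/2:ℝ)),
      ← ENNReal.rpow_mul]
    norm_num

lemma scal_hs {T K : ℝ} {H : ℝ≥0∞} (hH : H ≠ ∞) {c : ℝ → Lat → ℂ} {f0 : Vec → ℝ}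
    {f : ℝ → Vec → ℝ} (h : Fld T c f0 f) (hc : Good T K H c) :
    timeNorm 2 T (fun t => HsNorm 1 fun x => (f t x : ℂ)) < ∞ := by
  obtain ⟨g, hgm, hg1, hg2⟩ := h.hs hH hc
  refine timeNorm_two_lt (C := 1) (g := g) (by norm_num) hg1 ?_
  filter_upwards [hg2] with t ht
  rw [ht, ← ENNReal.rpow_natCast, ← ENNReal.rpow_mul]
  norm_num

lemma vec_init {T : ℝ} (hT : 0 < T) {c : Fin 3 → ℝ → Lat → ℂ} {v : Vec → Vec} (hv : Measurable v)
    {f : Fin 3 → ℝ → Vec → ℝ} (h : ∀ j, Fld T (c j) (fun x => v x j) (f j))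
    (h0 : ∀ j, MemLp (fun x => (v x j : ℂ)) 2 μT)
    (hc : ∀ j, ∀ ε > 0, ∀ᶠ t in 𝓝[>] (0:ℝ), L2b ε (fun n => c j t n - fc (fun x => (v x j : ℂ)) n)) :
    Tendsto (fun t => eLpNorm (fun x => mkV f t x - v x) 2 μT) (𝓝[>] 0) (𝓝 0) := by
  have h1 := tendsto_finsetSum Finset.univ fun j _ => (h j).atZero hT (h0 j) (hc j)
  rw [Finset.sum_const_zero] at h1
  refine tendsto_of_tendsto_of_tendsto_of_le_of_le tendsto_const_nhds h1 (fun _ => zero_le)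
    fun t => ?_
  have hm : Measurable (mkV f t) := (mkV_meas fun j => (h j).meas).comp measurable_prodMk_left
  exact eLpNorm_vec_le (hm.sub hv)

lemma mkV_per {f : Fin 3 → ℝ → Vec → ℝ} (hf : ∀ j t, Per (f j t)) (t : ℝ) : Per (mkV f t) := by
  intro x n
  unfold mkV
  congr 1
  funext j
  exact hf j t x n

/-! ### Part E3: weak identities at a fixed time -/

def PP (F : Vec → ℝ) (c : Lat → ℂ) : Prop :=
  Integrable F μT ∧ HasSum c (((∫ x, F x ∂μT : ℝ)) : ℂ)

lemma PP.add {F G : Vec → ℝ} {c d : Lat → ℂ} (h : PP F c) (k : PP G d) :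
    PP (fun x => F x + G x) (fun n => c n + d n) := by
  refine ⟨h.1.add k.1, ?_⟩
  rw [integral_add h.1 k.1, Complex.ofReal_add]
  exact h.2.add k.2

lemma PP.sub {F G : Vec → ℝ} {c d : Lat → ℂ} (h : PP F c) (k : PP G d) :
    PP (fun x => F x - G x) (fun n => c n - d n) := by
  refine ⟨h.1.sub k.1, ?_⟩
  rw [integral_sub h.1 k.1, Complex.ofReal_sub]
  exact h.2.sub k.2

lemma PP.mulc {F : Vec → ℝ} {c : Lat → ℂ} (h : PP F c) (a : ℝ) :
    PP (fun x => a * F x) (fun n => (a : ℂ) * c n) := by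
  refine ⟨h.1.const_mul a, ?_⟩
  rw [integral_const_mul, Complex.ofReal_mul]
  exact h.2.mul_left _

lemma PP.sum {F : Fin 3 → Vec → ℝ} {c : Fin 3 → Lat → ℂ} (h : ∀ j, PP (F j) (c j)) :
    PP (fun x => ∑ j, F j x) (fun n => ∑ j, c j n) := by
  refine ⟨integrable_finsetSum _ fun j _ => (h j).1, ?_⟩
  rw [integral_finsetSum _ fun j _ => (h j).1, Complex.ofReal_sum]
  exact hasSum_sum fun j _ => (h j).2

lemma PP.congr {F G : Vec → ℝ} {c d : Lat → ℂ} (h : PP F c) (hF : ∀ x, G x = F x)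
    (hc : ∀ n, d n = c n) : PP G d := by
  have : G = F := funext hF
  have h2 : d = c := funext hc
  subst this h2
  exact h

lemma PP.base {f g : Vec → ℝ} {c e : Lat → ℂ} (hf : Integrable (fun x => (f x : ℂ)) μT)
    (hg : Per g) (hs : ContDiff ℝ (⊤ : ℕ∞) g) (hc : ∀ n, fc (fun x => (f x : ℂ)) n = c n)
    (he : ∀ n, fc (fun x => (g x : ℂ)) n = e n) :
    PP (fun x => f x * g x) (fun n => c n * e (-n)) := by
  have hgc : Per (fun x => (g x : ℂ)) := fun x n => by simp only [hg x n]
  have hsc : ContDiff ℝ (⊤ : ℕ∞) (fun x => (g x : ℂ)) := Complex.ofRealCLM.contDiff.comp hs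
  have h := pairing hf hgc hsc
  have hI : Integrable (fun x => f x * g x) μT := by
    obtain ⟨D, hD⟩ := per_bounded hgc hsc.continuous
    have h1 : Integrable (fun x => (g x : ℂ) * (f x : ℂ)) μT :=
      hf.bdd_mul hsc.continuous.aestronglyMeasurable (Eventually.of_forall hD)
    have h2 := h1.re
    refine h2.congr (Eventually.of_forall fun x => ?_)
    simp [mul_comm]
  refine ⟨hI, ?_⟩
  have e1 : (((∫ x, f x * g x ∂μT : ℝ)) : ℂ) = ∫ x in cube, (f x : ℂ) * (g x : ℂ) := by
    have e0 : ∫ x, ((f x * g x : ℝ) : ℂ) ∂μT = (((∫ x, f x * g x ∂μT : ℝ)) : ℂ) := integral_ofReal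
    rw [← e0]
    push_cast
    rfl
  rw [e1]
  simp only [hc, he] at h
  have h3 := (Equiv.neg Lat).hasSum_iff.mpr h
  refine h3.congr_fun ?_
  intro n
  simp

lemma integrable_prod {f g : Vec → ℝ} (hf : MemLp (fun x => (f x : ℂ)) 2 μT)
    (hg : MemLp (fun x => (g x : ℂ)) 2 μT) : Integrable (fun x => ((f x * g x : ℝ) : ℂ)) μT := by
  have := hf.integrable_mul hg
  refine this.congr (Eventually.of_forall fun x => ?_)
  simp

lemma fc_pd_real {g : Vec → ℝ} (hg : Per g) (hs : ContDiff ℝ (⊤ : ℕ∞) g) (i : Fin 3) (n : Lat) :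
    fc (fun x => ((pd i g x : ℝ) : ℂ)) n = 2 * π * I * (n i : ℂ) * fc (fun x => (g x : ℂ)) n := by
  have hgc : Per (fun x => (g x : ℂ)) := fun x n => by simp only [hg x n]
  have hsc : ContDiff ℝ (⊤ : ℕ∞) (fun x => (g x : ℂ)) := Complex.ofRealCLM.contDiff.comp hs
  have e : (fun x => ((pd i g x : ℝ) : ℂ)) = pd i (fun y => (g y : ℂ)) :=
    funext fun x => pd_ofReal hs i x
  rw [e, fc_pd hgc hsc]

lemma lap_per_smooth {g : Vec → ℝ} (hg : Per g) (hs : ContDiff ℝ (⊤ : ℕ∞) g) :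
    Per (lap g) ∧ ContDiff ℝ (⊤ : ℕ∞) (lap g) ∧
    ∀ n, fc (fun x => ((lap g x : ℝ) : ℂ)) n
      = -(((4 * π ^ 2 * latSq n : ℝ)) : ℂ) * fc (fun x => (g x : ℂ)) n := by
  have p1 : ∀ i, Per (pd i g) := fun i => pd_per hg i
  have s1 : ∀ i, ContDiff ℝ (⊤ : ℕ∞) (pd i g) := fun i => pd_contDiff hs i
  have p2 : ∀ i, Per (pd i (pd i g)) := fun i => pd_per (p1 i) i
  have s2 : ∀ i, ContDiff ℝ (⊤ : ℕ∞) (pd i (pd i g)) := fun i => pd_contDiff (s1 i) i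
  have e : lap g = fun x => ∑ i, pd i (pd i g) x := rfl
  refine ⟨?_, ?_, fun n => ?_⟩
  · intro x n
    rw [e]
    exact Finset.sum_congr rfl fun i _ => p2 i x n
  · rw [e]
    exact ContDiff.sum fun i _ => s2 i
  · rw [e]
    simp only [Complex.ofReal_sum]
    rw [fc_sum Finset.univ (f := fun i x => ((pd i (pd i g) x : ℝ) : ℂ)) (fun i _ => ?_)]
    · simp only [fc_pd_real (p1 _) (s1 _), fc_pd_real hg hs]
      rw [Complex.ofReal_mul, latSq_cast, Finset.mul_sum, ← Finset.sum_neg_distrib, Finset.sum_mul]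
      refine Finset.sum_congr rfl fun i _ => ?_
      push_cast
      linear_combination (4 * (π:ℂ)^2 * (n i : ℂ) ^ 2 * fc (fun x => (g x : ℂ)) n) * Complex.I_sq
    · exact (integrable_of_cont_per (p2 i) (s2 i).continuous).ofReal

lemma div_slice {f : Vec → ℝ} {F : Fin 3 → Vec → ℝ}
    (hf : Integrable (fun x => (f x : ℂ)) μT) (hF : ∀ j, Integrable (fun x => (F j x : ℂ)) μT)
    (h : ∀ n, fc (fun x => (f x : ℂ)) n = 2 * π * I * ∑ j, (n j : ℂ) * fc (fun x => (F j x : ℂ)) n)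
    {g : Vec → ℝ} (hg : Per g) (hs : ContDiff ℝ (⊤ : ℕ∞) g) :
    (∫ x in cube, (f x * g x + ∑ j, F j x * pd j g x)) = 0 := by
  have h1 := (PP.base hf hg hs (fun n => rfl) (fun n => rfl)).add
    (PP.sum fun j => PP.base (hF j) (pd_per hg j) (pd_contDiff hs j) (fun n => rfl)
      (fun n => fc_pd_real hg hs j n))
  have h2 := h1.2
  have h3 : ∀ n, fc (fun x => (f x : ℂ)) n * fc (fun x => (g x : ℂ)) (-n) +
      ∑ j, fc (fun x => (F j x : ℂ)) n * (2 * π * I * ((-n) j : ℂ) * fc (fun x => (g x : ℂ)) (-n))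
      = 0 := by
    intro n
    rw [h]
    simp only [Fin.sum_univ_three, Pi.neg_apply]
    push_cast
    ring
  have h4 : HasSum (fun _ : Lat => (0:ℂ)) (((∫ x, (f x * g x + ∑ j, F j x * pd j g x) ∂μT : ℝ)) : ℂ) :=
    h2.congr_fun fun n => (h3 n).symm
  have h5 := h4.unique hasSum_zero
  exact_mod_cast h5

lemma weak_slice {a f g p q r : Fin 3 → Vec → ℝ} {d : Vec → ℝ}
    {a' f' g' p' q' r' : Fin 3 → Lat → ℂ} {d' : Lat → ℂ}
    (ha : ∀ j, MemLp (fun x => (a j x : ℂ)) 2 μT ∧ ∀ n, fc (fun x => (a j x : ℂ)) n = a' j n)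
    (hf : ∀ j, MemLp (fun x => (f j x : ℂ)) 2 μT ∧ ∀ n, fc (fun x => (f j x : ℂ)) n = f' j n)
    (hg : ∀ j, MemLp (fun x => (g j x : ℂ)) 2 μT ∧ ∀ n, fc (fun x => (g j x : ℂ)) n = g' j n)
    (hp : ∀ j, MemLp (fun x => (p j x : ℂ)) 2 μT ∧ ∀ n, fc (fun x => (p j x : ℂ)) n = p' j n)
    (hq : ∀ j, MemLp (fun x => (q j x : ℂ)) 2 μT ∧ ∀ n, fc (fun x => (q j x : ℂ)) n = q' j n)
    (hr : ∀ j, MemLp (fun x => (r j x : ℂ)) 2 μT ∧ ∀ n, fc (fun x => (r j x : ℂ)) n = r' j n)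
    (hd : MemLp (fun x => (d x : ℂ)) 2 μT ∧ ∀ n, fc (fun x => (d x : ℂ)) n = d' n)
    {ψ χ : Fin 3 → Vec → ℝ} (pψ : ∀ j, Per (ψ j)) (sψ : ∀ j, ContDiff ℝ (⊤ : ℕ∞) (ψ j))
    (pχ : ∀ j, Per (χ j)) (sχ : ∀ j, ContDiff ℝ (⊤ : ℕ∞) (χ j)) (ν : ℝ) :
    PP (fun x => (∑ j, a j x * χ j x) + ν * (∑ j, a j x * lap (ψ j) x)
        + (∑ i, ∑ j, f i x * g j x * pd i (ψ j) x) - (∑ i, ∑ j, p i x * q j x * pd i (ψ j) x)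
        - ∑ j, d x * r j x * ψ j x)
      (fun n => ∑ j, (a' j n * fc (fun x => (χ j x : ℂ)) (-n)
        + (-((ν * (4 * π ^ 2 * latSq n) : ℝ) : ℂ) * a' j n + NN f' g' p' q' d' r' j n)
          * fc (fun x => (ψ j x : ℂ)) (-n))) := by
  have hi : ∀ {f : Vec → ℂ}, MemLp f 2 μT → Integrable f μT := fun h => h.integrable (by norm_num)
  have hmul : ∀ {f g : Vec → ℝ} {c e : Lat → ℂ},
      (MemLp (fun x => (f x : ℂ)) 2 μT ∧ ∀ n, fc (fun x => (f x : ℂ)) n = c n) →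
      (MemLp (fun x => (g x : ℂ)) 2 μT ∧ ∀ n, fc (fun x => (g x : ℂ)) n = e n) →
      ∀ n, fc (fun x => ((f x * g x : ℝ) : ℂ)) n = cv c e n := by
    intro f g c e h1 h2 n
    rw [fc_mul_real h1.1 h2.1, funext h1.2, funext h2.2]
  have A := PP.sum fun j => PP.base (hi (ha j).1) (pχ j) (sχ j) (ha j).2 (fun n => rfl)
  have L := (PP.sum fun j => PP.base (hi (ha j).1) (lap_per_smooth (pψ j) (sψ j)).1
    (lap_per_smooth (pψ j) (sψ j)).2.1 (ha j).2 (lap_per_smooth (pψ j) (sψ j)).2.2).mulc ν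
  have F := PP.sum fun i => PP.sum fun j => PP.base (integrable_prod (hf i).1 (hg j).1)
    (pd_per (pψ j) i) (pd_contDiff (sψ j) i) (hmul (hf i) (hg j))
    (fun n => fc_pd_real (pψ j) (sψ j) i n)
  have P := PP.sum fun i => PP.sum fun j => PP.base (integrable_prod (hp i).1 (hq j).1)
    (pd_per (pψ j) i) (pd_contDiff (sψ j) i) (hmul (hp i) (hq j))
    (fun n => fc_pd_real (pψ j) (sψ j) i n)
  have R := PP.sum fun j => PP.base (integrable_prod hd.1 (hr j).1) (pψ j) (sψ j)
    (hmul hd (hr j)) (fun n => rfl)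
  refine ((((A.add L).add F).sub P).sub R).congr (fun x => rfl) fun n => ?_
  simp only [NN, Fin.sum_univ_three, latSq_neg, Pi.neg_apply]
  push_cast
  ring

/-! ### Part E4: summing the mode equations -/

/-- Fourier coefficients of a vector test function and of its time derivative. -/
def tc {T : ℝ} (ψ : TestFun T Vec) (t : ℝ) (j : Fin 3) (n : Lat) : ℂ :=
  fc (fun x => (ψ.f t x j : ℂ)) (-n)

def tc' {T : ℝ} (ψ : TestFun T Vec) (t : ℝ) (j : Fin 3) (n : Lat) : ℂ :=
  fc (fun x => (tderiv ψ.f t x j : ℂ)) (-n)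

lemma tc'_eq {T : ℝ} (ψ : TestFun T Vec) (t : ℝ) (j : Fin 3) (n : Lat) :
    tc' ψ t j n = fc (tderiv (fun t x => (ψ.f t x j : ℂ)) t) (-n) := by
  unfold tc'
  congr 1
  funext x
  exact tderiv_ofVec ψ j t x

lemma tc_hasDeriv {T : ℝ} (ψ : TestFun T Vec) (t : ℝ) (j : Fin 3) (n : Lat) :
    HasDerivAt (fun t => tc ψ t j n) (tc' ψ t j n) t := by
  rw [tc'_eq]
  exact (TT.ofVec ψ j).hasDerivAt_fc (-n) t

lemma tc_cont {T : ℝ} (ψ : TestFun T Vec) (j : Fin 3) (n : Lat) :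
    Continuous (fun t => tc ψ t j n) := (TT.ofVec ψ j).continuous_fc (-n)

lemma tc'_cont {T : ℝ} (ψ : TestFun T Vec) (j : Fin 3) (n : Lat) :
    Continuous (fun t => tc' ψ t j n) := by
  simp only [tc'_eq]
  exact (TT.ofVec ψ j).tderiv.continuous_fc (-n)

lemma tc_div {T : ℝ} (ψ : TestFun T Vec) (h : DivFreeT ψ) (t : ℝ) (n : Lat) :
    ∑ j, (n j : ℂ) * tc ψ t j n = 0 := by
  have hp : ∀ j, Per (fun y => ψ.f t y j) := fun j x m => by simp only [ψ.periodic t x m]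
  have h0 : fc (fun x => ((∑ i, pd i (fun y => ψ.f t y i) x : ℝ) : ℂ)) (-n) = 0 := by
    simp [h t, fc]
  simp only [Complex.ofReal_sum] at h0
  rw [fc_sum Finset.univ (f := fun i x => ((pd i (fun y => ψ.f t y i) x : ℝ) : ℂ))
    (fun i _ => (integrable_of_cont_per (pd_per (hp i) i)
      (pd_contDiff (comp_contDiff ψ t i) i).continuous).ofReal)] at h0
  simp only [fc_pd_real (hp _) (comp_contDiff ψ t _)] at h0
  have h2 : (2 * π * I : ℂ) ≠ 0 := by simp [Real.pi_ne_zero]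
  refine (mul_eq_zero.mp (?_ : (2 * π * I : ℂ) * _ = 0)).resolve_left h2
  rw [← neg_eq_zero, ← h0]
  simp only [tc, Fin.sum_univ_three, Pi.neg_apply]
  push_cast
  ring

lemma tc'_div {T : ℝ} (ψ : TestFun T Vec) (h : DivFreeT ψ) (t : ℝ) (n : Lat) :
    ∑ j, (n j : ℂ) * tc' ψ t j n = 0 := by
  have h1 : HasDerivAt (fun t => ∑ j, (n j : ℂ) * tc ψ t j n) (∑ j, (n j : ℂ) * tc' ψ t j n) t :=
    HasDerivAt.fun_sum fun j _ => (tc_hasDeriv ψ t j n).const_mul _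
  simp only [tc_div ψ h] at h1
  exact h1.unique (hasDerivAt_const t 0)

lemma tc_decay {T : ℝ} (ψ : TestFun T Vec) : ∃ C, 0 ≤ C ∧ ∀ t j n,
    (1 + latSq n) ^ 4 * ‖tc ψ t j n‖ ≤ C ∧ (1 + latSq n) ^ 3 * ‖tc' ψ t j n‖ ≤ C := by
  choose C1 hC1 using fun j => (TT.ofVec ψ j).Lop.decay
  choose C2 hC2 using fun j => (TT.ofVec ψ j).tderiv.decay
  refine ⟨∑ j, |C1 j| + ∑ j, |C2 j|, by positivity, fun t j n => ⟨?_, ?_⟩⟩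
  · have h := hC1 j t (-n)
    rw [fc_Lop ((TT.ofVec ψ j).2.1 t) ((TT.ofVec ψ j).slice t), norm_mul, Complex.norm_real,
      latSq_neg, Real.norm_eq_abs, abs_of_nonneg (by linarith [latSq_nonneg n])] at h
    have h2 := Finset.single_le_sum (f := fun j => |C1 j|) (fun _ _ => abs_nonneg _) (Finset.mem_univ j)
    have h3 : 0 ≤ ∑ j, |C2 j| := by positivity
    have h4 := le_abs_self (C1 j)
    have e : (1 + latSq n) ^ 4 * ‖tc ψ t j n‖
      = (1 + latSq n) ^ 3 * ((1 + latSq n) * ‖fc (fun x => (ψ.f t x j : ℂ)) (-n)‖) := by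
      unfold tc; ring
    rw [e]
    linarith
  · have h := hC2 j t (-n)
    rw [latSq_neg, ← tc'_eq] at h
    have h2 := Finset.single_le_sum (f := fun j => |C2 j|) (fun _ _ => abs_nonneg _) (Finset.mem_univ j)
    have h3 : 0 ≤ ∑ j, |C1 j| := by positivity
    have h4 := le_abs_self (C2 j)
    linarith

lemma Extr.weak_sum {ν : Fin 2 → ℝ} {T K : ℝ} (hT : 0 < T) {H : ℝ≥0∞} (hH : H ≠ ∞) {φ : Lat → ℂ}
    {w0 : Fin 2 → Fin 3 → Lat → ℂ}
    {M : ℕ → ℕ} {wN : ℕ → ℝ → Fin 2 → Fin 3 → Lat → ℂ} {w : ℝ → Fin 2 → Fin 3 → Lat → ℂ}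
    (h : Extr ν T K H φ w0 M wN w) (α : Fin 2) (ψ : TestFun T Vec) (hψ : DivFreeT ψ) :
    ∫ t in Set.Ioo 0 T, ∑' n, ∑ j, (w t α j n * tc' ψ t j n
      + RR ν (w t) (ph φ t) α j n * tc ψ t j n) = 0 := by
  obtain ⟨C, hC0, hC⟩ := tc_decay ψ
  have hg := h.limGood
  have hL := latSq_nonneg
  have b1 : ∀ t j n, ‖tc ψ t j n‖ ≤ C * ((1 + latSq n) ^ 3)⁻¹ * (1 + latSq n)⁻¹ := by
    intro t j n
    have h1 : (0:ℝ) < 1 + latSq n := by linarith [hL n]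
    have := (hC t j n).1
    rw [mul_assoc, ← mul_inv, ← pow_succ, ← div_eq_mul_inv, le_div_iff₀ (by positivity), mul_comm]
    exact this
  have b2 : ∀ t j n, ‖tc' ψ t j n‖ ≤ C * ((1 + latSq n) ^ 3)⁻¹ := by
    intro t j n
    have h1 : (0:ℝ) < 1 + latSq n := by linarith [hL n]
    have := (hC t j n).2
    rw [← div_eq_mul_inv, le_div_iff₀ (by positivity), mul_comm]
    exact this
  have c3 : ∀ n, ((1 + latSq n) ^ 3)⁻¹ ≤ 1 := fun n =>
    inv_le_one_of_one_le₀ (one_le_pow₀ (by linarith [hL n]))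
  have c1 : ∀ n, (1 + latSq n)⁻¹ ≤ 1 := fun n => inv_le_one_of_one_le₀ (by linarith [hL n])
  have c30 : ∀ n, 0 ≤ ((1 + latSq n) ^ 3)⁻¹ := fun n => by have := hL n; positivity
  have d2 : ∀ t j n, ‖tc' ψ t j n‖ ≤ C := fun t j n =>
    (b2 t j n).trans (mul_le_of_le_one_right hC0 (c3 n))
  have d1 : ∀ t j n, ‖tc ψ t j n‖ ≤ C := fun t j n => by
    refine (b1 t j n).trans ((mul_le_of_le_one_right (mul_nonneg hC0 (c30 n)) (c1 n)).trans ?_)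
    exact mul_le_of_le_one_right hC0 (c3 n)
  set F : Lat → ℝ → ℂ := fun n t => ∑ j, (w t α j n * tc' ψ t j n
      + RR ν (w t) (ph φ t) α j n * tc ψ t j n) with hF
  have hmode : ∀ n, ∫ t in Set.Ioo 0 T, F n t = 0 := by
    intro n
    refine Extr.weak hT hH h α n (θ := fun t j => tc ψ t j n) (θ' := fun t j => tc' ψ t j n)
      (fun j => tc'_cont ψ j n) (fun t j => tc_hasDeriv ψ t j n) ?_ ?_ (fun t => tc_div ψ hψ t n)
      (C := C) (fun t j => d1 t j n) (fun t j => d2 t j n)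
    · funext j
      obtain ⟨a, b, ha, hb, hab⟩ := (TT.ofVec ψ j).fc_supp
      exact hab 0 (fun hc => by linarith [hc.1]) (-n)
    · funext j
      obtain ⟨a, b, ha, hb, hab⟩ := (TT.ofVec ψ j).fc_supp
      exact hab T (fun hc => by linarith [hc.2]) (-n)
  have hIntg : ∀ n, IntegrableOn (F n) (Set.Ioo 0 T) := by
    intro n
    refine integrable_finsetSum _ fun j _ => ?_
    exact (int_mul_bdd ((hg.gw α j).int_coef n) (tc'_cont ψ j n) (fun t => d2 t j n)).add
      (int_mul_bdd (int_RR hg ν α j n) (tc_cont ψ j n) (fun t => d1 t j n))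
  set A : ℝ := Real.sqrt K with hA
  have hA0 : 0 ≤ A := Real.sqrt_nonneg _
  set D : ℝ := |ν α| * (4 * π ^ 2) * A + (12 * π * |K| + |K|) with hD
  have hD0 : 0 ≤ D := by positivity
  have hbd : ∀ n, ∀ t ∈ Set.Ioo 0 T, ‖F n t‖ ≤ 3 * (A * C + D * C) * ((1 + latSq n) ^ 3)⁻¹ := by
    intro n t ht
    have hl := hL n
    have hp : (0:ℝ) < 1 + latSq n := by linarith
    have hK : K ≤ |K| := le_abs_self K
    have r1 : ∀ j, ‖RR ν (w t) (ph φ t) α j n‖ ≤ D * (1 + latSq n) := by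
      intro j
      refine (norm_RR_le (ν := ν) (fun α i => (hg.gw α i).l2 t ht) (fun i => (hg.gB i).l2 t ht)
        (hg.gd.l2 t ht) α j n).trans ?_
      have k0 : 0 ≤ |ν α| * (4 * π ^ 2) * A := by positivity
      have k1 : 0 ≤ |K| := abs_nonneg K
      have k2 : 12 * π * K * latSq n ≤ 12 * π * |K| * latSq n := by gcongr
      have k3 : 0 ≤ 12 * π * |K| := by positivity
      rw [hD]
      nlinarith [mul_nonneg k1 hl, mul_nonneg k3 hl, mul_nonneg k0 hl]
    have term : ∀ j, ‖w t α j n * tc' ψ t j n + RR ν (w t) (ph φ t) α j n * tc ψ t j n‖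
        ≤ (A * C + D * C) * ((1 + latSq n) ^ 3)⁻¹ := by
      intro j
      refine (norm_add_le _ _).trans ?_
      rw [norm_mul, norm_mul, add_mul]
      refine add_le_add ?_ ?_
      · rw [mul_assoc]
        exact mul_le_mul (((hg.gw α j).l2 t ht).norm_le n) (b2 t j n) (norm_nonneg _) hA0
      · calc _ ≤ (D * (1 + latSq n)) * (C * ((1 + latSq n) ^ 3)⁻¹ * (1 + latSq n)⁻¹) :=
              mul_le_mul (r1 j) (b1 t j n) (norm_nonneg _) (by positivity)
          _ = _ := by field_simp
    calc ‖F n t‖ ≤ ∑ j : Fin 3, (A * C + D * C) * ((1 + latSq n) ^ 3)⁻¹ :=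
          norm_sum_le_of_le _ fun j _ => term j
      _ = _ := by simp; ring
  have hsum : Summable fun n => ∫ t in Set.Ioo 0 T, ‖F n t‖ := by
    refine Summable.of_nonneg_of_le (fun n => integral_nonneg fun t => norm_nonneg _) (fun n => ?_)
      (summable_lat3.mul_left (3 * (A * C + D * C) * T))
    calc ∫ t in Set.Ioo 0 T, ‖F n t‖
        ≤ ∫ t in Set.Ioo 0 T, 3 * (A * C + D * C) * ((1 + latSq n) ^ 3)⁻¹ := by
          refine setIntegral_mono_on (hIntg n).norm (integrable_const _) measurableSet_Ioo (hbd n)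
      _ = _ := by
          rw [setIntegral_const]
          simp [hT.le]
          ring
  have := integral_tsum_of_summable_integral_norm (μ := volume.restrict (Set.Ioo 0 T)) hIntg hsum
  rw [← this]
  simp only [hmode, tsum_zero]

/-- The time-slice identity integrates to zero. -/
lemma weak_final {T : ℝ} {F : ℝ → Vec → ℝ} {c : ℝ → Lat → ℂ}
    (h : ∀ᵐ t ∂(tIoo T), PP (F t) (c t)) (h0 : ∫ t in Set.Ioo 0 T, ∑' n, c t n = 0) :
    (∫ t in Set.Ioo 0 T, ∫ x in cube, F t x) = 0 := by
  have e : (((∫ t in Set.Ioo 0 T, ∫ x in cube, F t x : ℝ)) : ℂ) = 0 := by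
    have e0 : ∫ t in Set.Ioo 0 T, (((∫ x in cube, F t x : ℝ)) : ℂ)
      = (((∫ t in Set.Ioo 0 T, ∫ x in cube, F t x : ℝ)) : ℂ) := integral_ofReal
    rw [← e0, ← h0]
    refine integral_congr_ae ?_
    have h' : ∀ᵐ t ∂(volume.restrict (Set.Ioo 0 T)), PP (F t) (c t) := h
    filter_upwards [h'] with t ht
    exact ht.2.tsum_eq.symm
  exact_mod_cast e

lemma testT_smooth {T : ℝ} (ψ : TestFun T Vec) (t : ℝ) (j : Fin 3) :
    Per (fun x => tderiv ψ.f t x j) ∧ ContDiff ℝ (⊤ : ℕ∞) (fun x => tderiv ψ.f t x j) := by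
  have e : (fun x => tderiv ψ.f t x j) = fun x => (tderiv (fun t x => (ψ.f t x j : ℂ)) t x).re := by
    funext x
    rw [← tderiv_ofVec, Complex.ofReal_re]
  have h := (TT.ofVec ψ j).tderiv
  rw [e]
  exact ⟨fun x n => by simp only [h.2.1 t x n], Complex.reCLM.contDiff.comp (h.slice t)⟩

/-! ### Part E5: assembly -/

lemma ph_init {φ : Lat → ℂ} {Kd : ℝ} (hd : L2b Kd (dd φ)) (j : Fin 3) {ε : ℝ} (hε : 0 < ε) :
    ∀ᶠ t in 𝓝[>] (0:ℝ), L2b ε (fun n => (n j : ℂ) * ph φ t n - (n j : ℂ) * φ n) := by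
  set a : ℝ → Lat → ℝ := fun t n => (1 - Real.exp (-(lam n * t))) ^ 2 * ‖dd φ n‖ ^ 2 with ha
  have hlim : Tendsto (fun t => ∑' n, a t n) (𝓝[>] 0) (𝓝 (∑' _ : Lat, (0:ℝ))) := by
    refine tendsto_tsum_of_dominated_convergence (bound := fun n => ‖dd φ n‖ ^ 2) hd.summable ?_ ?_
    · intro n
      have hc : Continuous fun t => a t n := by simp only [ha]; fun_prop
      have h1 := hc.tendsto 0
      have e : a 0 n = 0 := by simp [ha]
      rw [e] at h1
      exact h1.mono_left nhdsWithin_le_nhds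
    · filter_upwards [self_mem_nhdsWithin] with t ht n
      have ht' : (0:ℝ) < t := ht
      have h1 : Real.exp (-(lam n * t)) ≤ 1 := by
        rw [Real.exp_le_one_iff]
        have := mul_pos (lam_pos n) ht'
        linarith
      have h2 := (Real.exp_pos (-(lam n * t))).le
      rw [Real.norm_of_nonneg (by positivity)]
      refine mul_le_of_le_one_left (by positivity) ?_
      nlinarith
  rw [tsum_zero] at hlim
  filter_upwards [hlim.eventually_le_const hε, self_mem_nhdsWithin] with t h1 ht s
  have ht' : (0:ℝ) < t := ht
  have hs : Summable (a t) := by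
    refine Summable.of_nonneg_of_le (fun n => by positivity) (fun n => ?_) hd.summable
    have h1 : Real.exp (-(lam n * t)) ≤ 1 := by
      rw [Real.exp_le_one_iff]
      have := mul_pos (lam_pos n) ht'
      linarith
    have h2 := (Real.exp_pos (-(lam n * t))).le
    refine mul_le_of_le_one_left (by positivity) ?_
    nlinarith
  refine le_trans (Finset.sum_le_sum fun n _ => ?_)
    ((hs.sum_le_tsum s (fun n _ => by positivity)).trans h1)
  have e : (n j : ℂ) * ph φ t n - (n j : ℂ) * φ n
      = -((1 - Real.exp (-(lam n * t)) : ℝ) : ℂ) * ((n j : ℂ) * φ n) := by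
    simp only [ph]
    push_cast
    ring
  show ‖(n j : ℂ) * ph φ t n - (n j : ℂ) * φ n‖ ^ 2 ≤ a t n
  rw [e, norm_mul, norm_neg, Complex.norm_real, mul_pow, Real.norm_eq_abs, sq_abs]
  have := norm_grad_le φ j n
  simp only [ha]
  gcongr

lemma conj_ph {φ : Lat → ℂ} (hφ : ∀ n, (starRingEnd ℂ) (φ n) = -φ (-n)) (t : ℝ) (n : Lat) :
    (starRingEnd ℂ) (ph φ t n) = -ph φ t (-n) := by
  simp only [ph, map_mul, Complex.conj_ofReal, hφ, lam, latSq_neg]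
  ring

lemma L2b_of_EE' {w : Fin 2 → Fin 3 → Lat → ℂ} {E : ℝ} (hE : ∀ s, EE s w ≤ E)
    (α : Fin 2) (j : Fin 3) : L2b E (w α j) := by
  intro s
  refine le_trans (Finset.sum_le_sum fun n _ => ?_) (hE s)
  refine le_trans ?_ (Finset.single_le_sum (f := fun α => ∑ j, ‖w α j n‖ ^ 2)
    (fun _ _ => Finset.sum_nonneg fun _ _ => by positivity) (Finset.mem_univ α))
  exact Finset.single_le_sum (f := fun j => ‖w α j n‖ ^ 2) (fun _ _ => by positivity)
    (Finset.mem_univ j)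

lemma existence_aux (ν₁ ν₂ T : ℝ) (h1 : 0 < ν₁) (h2 : 0 < ν₂) (hT : 0 < T)
    (u₀ B₀ : Vec → Vec) (dB₀ : Vec → ℝ)
    (hmu : Measurable u₀) (hmB : Measurable B₀) (hmd : Measurable dB₀)
    (hpu : Per u₀) (hpB : Per B₀) (hpd : Per dB₀)
    (hu₀ : eLpNorm u₀ 2 μT < ∞) (hB₀ : eLpNorm B₀ 2 μT < ∞)
    (hd₀ : eLpNorm dB₀ 2 μT < ∞)
    (hdiv : ∀ g : SpTest ℝ,
      (∫ x in cube, (dB₀ x * g.f x + ∑ j, B₀ x j * pd j g.f x)) = 0)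
    (hudiv : ∀ g : SpTest ℝ, (∫ x in cube, ∑ j, u₀ x j * pd j g.f x) = 0) :
    ∃ (u B : ℝ → Vec → Vec) (dB : ℝ → Vec → ℝ),
      LerayHopfMHD ν₁ ν₂ T u₀ B₀ u B dB := by
  have mu := memLp_comp hmu hu₀
  have mB := memLp_comp hmB hB₀
  have md := memLp_scal hmd hd₀
  obtain ⟨φ, w0, hI⟩ := exists_init mu mB md hdiv hudiv
  obtain ⟨Kd, hKd⟩ := L2b_of_memLp md
  have hdφ : L2b Kd (dd φ) := hKd.mono fun n => by rw [hI.hd]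
  have hE0 : ∀ S, EE S w0 ≤ ∑' n, ∑ α, ∑ j, ‖w0 α j n‖ ^ 2 := fun S =>
    hI.sw.sum_le_tsum S fun n _ => Finset.sum_nonneg fun _ _ => Finset.sum_nonneg fun _ _ => by
      positivity
  set ν : Fin 2 → ℝ := ![ν₁, ν₂] with hνd
  have hν : ∀ α, 0 < ν α := by
    intro α
    fin_cases α
    · exact h1
    · exact h2
  obtain ⟨K, H, M, wN, w, hH, h⟩ := extract ν hν hT hI.cφ hdφ hI.cw hI.dw hE0
  have hg := h.limGood
  have mcu : ∀ j, Measurable fun x => u₀ x j := fun j =>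
    (by fun_prop : Continuous fun v : Vec => v j).measurable.comp hmu
  have mcB : ∀ j, Measurable fun x => B₀ x j := fun j =>
    (by fun_prop : Continuous fun v : Vec => v j).measurable.comp hmB
  choose fu hfu using fun j => exists_fld hH (hg.gw 0 j) (fun t n => h.sym t 0 j n) (mcu j)
    (fun x n => by simp only [hpu x n])
  choose fB hfB using fun j => exists_fld hH (hg.gB j)
    (fun t n => conj_Bf (h.sym t) (conj_ph hI.cφ t) j n) (mcB j)
    (fun x n => by simp only [hpB x n])
  obtain ⟨fd, hfd⟩ := exists_fld hH hg.gd (fun t n => conj_dd (conj_ph hI.cφ t) n) hmd hpd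
  have aeu := ae_all_iff.mpr fun j => (hfu j).ae
  have aeB := ae_all_iff.mpr fun j => (hfB j).ae
  have aed := hfd.ae
  have hi : ∀ {f : Vec → ℂ}, MemLp f 2 μT → Integrable f μT := fun h => h.integrable (by norm_num)
  refine ⟨mkV fu, mkV fB, fd, mkV_meas fun j => (hfu j).meas, mkV_meas fun j => (hfB j).meas,
    hfd.meas, mkV_per fun j t => (hfu j).per t, mkV_per fun j t => (hfB j).per t, hfd.per,
    vec_bound hfu (fun j => hg.gw 0 j), vec_bound hfB hg.gB,
    timeNorm_top_lt (ENNReal.rpow_lt_top_of_nonneg (by norm_num) ENNReal.ofReal_ne_top)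
      (hfd.bound hg.gd),
    vec_hs hH hfu (fun j => hg.gw 0 j), vec_hs hH hfB hg.gB, scal_hs hH hfd hg.gd,
    ?_, ?_, ?_, ?_, ?_, ?_⟩
  · intro g
    refine integral_eq_zero_of_ae ?_
    have aeB' : ∀ᵐ t ∂(volume.restrict (Set.Ioo 0 T)), _ := aeB
    have aed' : ∀ᵐ t ∂(volume.restrict (Set.Ioo 0 T)), _ := aed
    filter_upwards [aeB', aed'] with t hB hd
    refine div_slice (F := fun j => fB j t) (hi hd.1) (fun j => hi (hB j).1) (fun n => ?_)
      (g.periodic t) (scal_contDiff g t)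
    rw [hd.2]
    simp only [(hB _).2]
    have hz := h.div t 1 n
    simp only [dd, Bf, latSq_cast, Fin.sum_univ_three] at hz ⊢
    linear_combination (-(2 * π * I)) * hz
  · intro g
    refine integral_eq_zero_of_ae ?_
    have aeu' : ∀ᵐ t ∂(volume.restrict (Set.Ioo 0 T)), _ := aeu
    filter_upwards [aeu'] with t hu
    have h0 : ∀ n, fc (fun _ => ((0:ℝ) : ℂ)) n = 0 := by simp [fc]
    have := div_slice (f := fun _ => 0) (F := fun j => fu j t) (by simp) (fun j => hi (hu j).1)
      (fun n => by
        rw [h0]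
        simp only [(hu _).2]
        rw [h.div t 0 n, mul_zero])
      (g.periodic t) (scal_contDiff g t)
    simpa using this
  · intro ψ hψ
    refine weak_final (c := fun t n => ∑ j, (w t 0 j n * tc' ψ t j n
      + RR ν (w t) (ph φ t) 0 j n * tc ψ t j n)) ?_ (Extr.weak_sum hT hH h 0 ψ hψ)
    filter_upwards [aeu, aeB, aed] with t hu hB hd
    refine (weak_slice (a := fun j => fu j t) (f := fun j => fu j t) (g := fun j => fu j t)
      (p := fun j => fB j t) (q := fun j => fB j t) (r := fun j => fB j t) (d := fd t)
      hu hu hu hB hB hB hd (ψ := fun j y => ψ.f t y j) (χ := fun j x => tderiv ψ.f t x j)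
      (fun j x m => by simp only [ψ.periodic t x m]) (fun j => comp_contDiff ψ t j)
      (fun j => (testT_smooth ψ t j).1) (fun j => (testT_smooth ψ t j).2) ν₁).congr
      (fun x => ?_) (fun n => ?_)
    · simp only [dotV, advPair, mkV_apply, Finset.mul_sum, mul_assoc]
    · rfl
  · intro ψ hψ
    refine weak_final (c := fun t n => ∑ j, (w t 1 j n * tc' ψ t j n
      + RR ν (w t) (ph φ t) 1 j n * tc ψ t j n)) ?_ (Extr.weak_sum hT hH h 1 ψ hψ)
    filter_upwards [aeu, aeB, aed] with t hu hB hd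
    refine (weak_slice (a := fun j => fB j t) (f := fun j => fu j t) (g := fun j => fB j t)
      (p := fun j => fB j t) (q := fun j => fu j t) (r := fun j => fu j t) (d := fd t)
      hB hu hB hB hu hu hd (ψ := fun j y => ψ.f t y j) (χ := fun j x => tderiv ψ.f t x j)
      (fun j x m => by simp only [ψ.periodic t x m]) (fun j => comp_contDiff ψ t j)
      (fun j => (testT_smooth ψ t j).1) (fun j => (testT_smooth ψ t j).2) ν₂).congr
      (fun x => ?_) (fun n => ?_)
    · simp only [dotV, advPair, mkV_apply, Finset.mul_sum, mul_assoc]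
    · have z1 := tc_div ψ hψ t n
      have z2 := tc'_div ψ hψ t n
      have e : ∀ j, RR ν (w t) (ph φ t) 1 j n = -((ν₂ * (4 * π ^ 2 * latSq n) : ℝ) : ℂ) * w t 1 j n
        + NN (w t 0) (Bf (w t) (ph φ t)) (Bf (w t) (ph φ t)) (w t 0) (dd (ph φ t)) (w t 0) j n :=
        fun j => rfl
      simp only [e]
      change _ = ∑ j, (Bf (w t) (ph φ t) j n * tc' ψ t j n
        + (-((ν₂ * (4 * π ^ 2 * latSq n) : ℝ) : ℂ) * Bf (w t) (ph φ t) j n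
          + NN (w t 0) (Bf (w t) (ph φ t)) (Bf (w t) (ph φ t)) (w t 0) (dd (ph φ t)) (w t 0) j n)
          * tc ψ t j n)
      have e2 : ∀ j, Bf (w t) (ph φ t) j n = w t 1 j n + (n j : ℂ) * ph φ t n := fun j => rfl
      generalize NN (w t 0) (Bf (w t) (ph φ t)) (Bf (w t) (ph φ t)) (w t 0) (dd (ph φ t)) (w t 0) = X
      simp only [e2, Fin.sum_univ_three] at z1 z2 ⊢
      linear_combination (-(ph φ t n)) * z2
        + ((ν₂ * (4 * π ^ 2 * latSq n) : ℝ) : ℂ) * ph φ t n * z1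
  · refine vec_init hT hmu hfu mu fun j ε hε => ?_
    filter_upwards [Extr.init_strong hT hdφ h hI.sw hε] with t ht
    have := L2b_of_EE' ht 0 j
    simp only [hI.hu] at this
    exact this
  · refine vec_init hT hmB hfB mB fun j ε hε => ?_
    filter_upwards [Extr.init_strong hT hdφ h hI.sw (by positivity : 0 < ε / 4),
      ph_init hdφ j (by positivity : 0 < ε / 4)] with t ht hp
    have h3 := ((L2b_of_EE' ht 1 j).add hp).mono' (by linarith : 2 * (ε / 4) + 2 * (ε / 4) ≤ ε)
    refine h3.mono fun n => le_of_eq ?_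
    rw [← hI.hB]
    simp only [Bf]
    congr 1
    ring

end MainProof

/-- global existence of Leray-Hopf weak solutions of the viscous and
resistive MHD equations for `L²` initial data whose magnetic part need not be
divergence-free (but has `L²` weak divergence), with weakly divergence-free `u₀`. -/
theorem leray_hopf_existence_MHD
    (ν₁ ν₂ T : ℝ) (h1 : 0 < ν₁) (h2 : 0 < ν₂) (hT : 0 < T)
    (u₀ B₀ : Vec → Vec) (dB₀ : Vec → ℝ)
    (hmu : Measurable u₀) (hmB : Measurable B₀) (hmd : Measurable dB₀)
    (hpu : Per u₀) (hpB : Per B₀) (hpd : Per dB₀)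
    (hu₀ : eLpNorm u₀ 2 μT < ∞) (hB₀ : eLpNorm B₀ 2 μT < ∞)
    (hd₀ : eLpNorm dB₀ 2 μT < ∞)
    (hdiv : ∀ g : SpTest ℝ,
      (∫ x in cube, (dB₀ x * g.f x + ∑ j, B₀ x j * pd j g.f x)) = 0)
    (hudiv : ∀ g : SpTest ℝ, (∫ x in cube, ∑ j, u₀ x j * pd j g.f x) = 0) :
    ∃ (u B : ℝ → Vec → Vec) (dB : ℝ → Vec → ℝ),
      LerayHopfMHD ν₁ ν₂ T u₀ B₀ u B dB := by
  exact existence_aux ν₁ ν₂ T h1 h2 hT u₀ B₀ dB₀ hmu hmB hmd hpu hpB hpd hu₀ hB₀ hd₀ hdiv hudiv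

end PaperHelicity
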